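/- Let n range over even positive integers and for each n let k(n) be a divisor of n with k(n) ≥ K₀(n). For a pairing G (a perfect matching of the 3n points {1,…,n}×{1,2,3}), let F_k(G) be the number of k-cycle factors of G, and let E[·] denote the average over all pairings G. Then limsup over even n → ∞ of E[F_{k(n)}²] / (E[F_{k(n)}])² ≤ 3. -/

import Mathlib

/-- `K₀(n) = log₂(2n/e) / (1 − (1/2)·log₂ 3)`. -/
noncomputable def K0 (n : ℕ) : ℝ :=
  Real.logb 2 (2 * n / Real.exp 1) / (1 - Real.logb 2 3 / 2)

/-- A pairing: a perfect matching of the `3n` points `{1,…,n}×{1,2,3}`, encoded as a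
fixed-point-free involution (the pairs are the orbits `{p, f p}`). -/
def Pairing (n : ℕ) : Type :=
  {f : Fin n × Fin 3 → Fin n × Fin 3 // Function.Involutive f ∧ ∀ p, f p ≠ p}

/-- `F_k(G)`: the number of `k`-cycle factors of the pairing `G`.  A sub-collection of
pairs is encoded as an `f`-invariant set `S` of points (a union of pairs); we require
that every vertex `v` has exactly two of its three points in `S`, and that every
connected component of the projected multigraph on `{1,…,n}` (with an edge `u ~ w`
whenever a pair of `S` joins a point of `u` to a point of `w`) has exactly `k`
vertices. -/
noncomputable def cfCount (n k : ℕ) (f : Fin n × Fin 3 → Fin n × Fin 3) : ℕ :=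
  Nat.card {S : Set (Fin n × Fin 3) //
    (∀ p, p ∈ S ↔ f p ∈ S) ∧
    (∀ v : Fin n, Nat.card {a : Fin 3 // (v, a) ∈ S} = 2) ∧
    (∀ v : Fin n,
      Set.ncard {w : Fin n |
        Relation.ReflTransGen (fun u u' => ∃ a : Fin 3, (u, a) ∈ S ∧ (f (u, a)).1 = u')
          v w} = k)}

/-- The expectation `E[F_k]` over a uniformly random pairing. -/
noncomputable def EF (n k : ℕ) : ℝ :=
  (∑' G : Pairing n, (cfCount n k G.1 : ℝ)) / (Nat.card (Pairing n) : ℝ)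

/-- The second moment `E[F_k²]` over a uniformly random pairing. -/
noncomputable def EF2 (n k : ℕ) : ℝ :=
  (∑' G : Pairing n, (cfCount n k G.1 : ℝ) ^ 2) / (Nat.card (Pairing n) : ℝ)


section modA1
/-- Fixed-point-free involutions of a type. -/
abbrev FPF (X : Type*) : Type _ := {f : X → X // Function.Involutive f ∧ ∀ p, f p ≠ p}

/-- `df q = (2q-1)!!`. -/
def df : ℕ → ℕ
  | 0 => 1
  | q + 1 => (2 * q + 1) * df q

theorem df_mul (q : ℕ) : df q * (2 ^ q * q.factorial) = (2 * q).factorial := by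
  induction q with
  | zero => simp [df]
  | succ q ih =>
    rw [show 2 * (q + 1) = 2 * q + 1 + 1 by ring, Nat.factorial_succ (2 * q + 1),
      Nat.factorial_succ (2 * q), ← ih, df, Nat.factorial_succ q, pow_succ]
    ring

theorem df_pos (q : ℕ) : 0 < df q := by
  induction q with
  | zero => simp [df]
  | succ q ih => rw [df]; positivity

theorem fpf_card (X : Type*) [Finite X] (q : ℕ) (h : Nat.card X = 2 * q) :
    Nat.card (FPF X) = df q := by
  classical
  have := Fintype.ofFinite X
  have hX : Fintype.card X = 2 * q := by rw [← h, Nat.card_eq_fintype_card]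
  have h1 : Nat.card (FPF X) =
      Nat.card {g : Equiv.Perm X // g.cycleType = Multiset.replicate q 2} := by
    refine Nat.card_congr ⟨fun f => ⟨f.2.1.toPerm, ?_⟩, fun g => ⟨g.1, ?_, ?_⟩, ?_, ?_⟩
    · have h2 : (f.2.1.toPerm : Equiv.Perm X) ^ 2 = 1 := by
        ext x; simp [pow_two, f.2.1 x]
      have h3 := Equiv.Perm.cycleType_of_pow_prime_eq_one h2
      have h4 : (f.2.1.toPerm : Equiv.Perm X).support = Finset.univ := by
        ext x; simp [f.2.2 x]
      have h5 := Equiv.Perm.sum_cycleType (f.2.1.toPerm : Equiv.Perm X)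
      rw [h4, Finset.card_univ, hX, h3, Multiset.sum_replicate, smul_eq_mul] at h5
      rw [h3]; congr 1; omega
    · have h2 : g.1 ^ 2 = 1 := by
        rw [Equiv.Perm.pow_prime_eq_one_iff, g.2]
        intro c hc; exact Multiset.eq_of_mem_replicate hc
      intro x
      have := congrArg (fun s : Equiv.Perm X => s x) h2
      simpa [pow_two] using this
    · have h5 := Equiv.Perm.sum_cycleType g.1
      rw [g.2, Multiset.sum_replicate, smul_eq_mul] at h5
      have h6 : g.1.support = Finset.univ := by
        rw [← Finset.card_eq_iff_eq_univ, hX]; omega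
      intro p
      rw [← Equiv.Perm.mem_support, h6]; simp
    · intro f; rfl
    · intro g; apply Subtype.ext; ext x; rfl
  have h2 := Equiv.Perm.card_of_cycleType_mul_eq X (Multiset.replicate q 2)
  rw [if_pos (by
    refine ⟨by simp [hX]; omega, fun a ha => by rw [Multiset.eq_of_mem_replicate ha]⟩)] at h2
  rw [h1, Nat.card_eq_fintype_card, Fintype.card_subtype]
  have h3 : (∏ n ∈ (Multiset.replicate q 2).toFinset, ((Multiset.replicate q 2).count n).factorial)
      = q.factorial := by
    rcases Nat.eq_zero_or_pos q with rfl | hq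
    · simp
    · rw [Multiset.toFinset_replicate, if_neg hq.ne']; simp
  rw [h3, hX, ← df_mul] at h2
  simp only [Multiset.sum_replicate, Multiset.prod_replicate, smul_eq_mul, mul_comm q 2, Nat.sub_self,
    Nat.factorial_zero, one_mul] at h2
  exact Nat.eq_of_mul_eq_mul_right (by positivity) h2

/-- Involutions with prescribed values on an invariant set: upper bound. -/
theorem fpf_ext_card_le {X : Type*} [Finite X] (D : Set X) (P : (X → X) → Prop) (q : ℕ)
    (hP : ∀ f g, P f → P g → ∀ x ∈ D, f x = g x) (hD : ∀ f, P f → ∀ x ∈ D, f x ∈ D)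
    (h : Nat.card ↥(Dᶜ) = 2 * q) :
    Nat.card {f : FPF X // P f.1} ≤ df q := by
  rw [← fpf_card ↥(Dᶜ) q h]
  have hc : ∀ f : {f : FPF X // P f.1}, ∀ x ∈ Dᶜ, f.1.1 x ∈ Dᶜ := by
    intro f x hx hx'
    have := hD f.1.1 f.2 _ hx'
    rw [f.1.2.1 x] at this
    exact hx this
  refine Nat.card_le_card_of_injective
    (fun f => (⟨fun x => ⟨f.1.1 x.1, hc f x.1 x.2⟩, ?_, ?_⟩ : FPF ↥(Dᶜ))) ?_
  · intro x; exact Subtype.ext (f.1.2.1 x.1)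
  · intro x hx; exact f.1.2.2 x.1 (congrArg Subtype.val hx)
  · intro f g hfg
    apply Subtype.ext; apply Subtype.ext; funext x
    by_cases hx : x ∈ D
    · exact hP _ _ f.2 g.2 x hx
    · have h1 := congrArg Subtype.val hfg
      have := congrFun h1 ⟨x, hx⟩
      exact congrArg Subtype.val this

/-- Involutions with prescribed values on an invariant set: lower bound. -/
theorem fpf_ext_card_ge {X : Type*} [Finite X] (D : Set X) (e : X → X)
    (hD : ∀ x ∈ D, e x ∈ D) (he : ∀ x ∈ D, e (e x) = x) (he' : ∀ x ∈ D, e x ≠ x) (q : ℕ)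
    (h : Nat.card ↥(Dᶜ) = 2 * q) :
    df q ≤ Nat.card {f : FPF X // ∀ x ∈ D, f.1 x = e x} := by
  classical
  rw [← fpf_card ↥(Dᶜ) q h]
  refine Nat.card_le_card_of_injective
    (fun g => (⟨⟨fun x => if hx : x ∈ D then e x else (g.1 ⟨x, hx⟩).1, ?_, ?_⟩, ?_⟩ :
      {f : FPF X // ∀ x ∈ D, f.1 x = e x})) ?_
  · intro x
    by_cases hx : x ∈ D
    · simp [hx, hD x hx, he x hx]
    · have : (g.1 ⟨x, hx⟩).1 ∉ D := (g.1 ⟨x, hx⟩).2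
      simp only [hx, dite_false, this, Subtype.coe_eta]
      rw [g.2.1]
  · intro x
    by_cases hx : x ∈ D
    · simp [hx, he' x hx]
    · simp only [hx, dite_false]
      intro h2
      exact g.2.2 ⟨x, hx⟩ (Subtype.ext h2)
  · intro x hx; simp [hx]
  · intro g1 g2 h12
    apply Subtype.ext; funext x
    have h1 := congrArg Subtype.val (congrArg Subtype.val h12)
    have h2 := congrFun h1 x.1
    have hx : x.1 ∉ D := x.2
    simp only [hx, dite_false, Subtype.coe_eta] at h2
    exact Subtype.ext h2

end modA1

section modA2
/-- The template vertex set: `c` cycles of length `k`. -/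
abbrev Tm (c k : ℕ) : Type := Fin c × ZMod k

def sc {c k : ℕ} (t : Tm c k) : Tm c k := (t.1, t.2 + 1)
def pd {c k : ℕ} (t : Tm c k) : Tm c k := (t.1, t.2 - 1)

@[simp] theorem sc_pd {c k : ℕ} (t : Tm c k) : sc (pd t) = t := by simp [sc, pd]
@[simp] theorem pd_sc {c k : ℕ} (t : Tm c k) : pd (sc t) = t := by simp [sc, pd]

/-- Fiberwise equivalences. -/
abbrev Fib (T V : Type*) : Type _ :=
  {φ : T × Fin 3 ≃ V × Fin 3 // ∀ t a b, (φ (t, a)).1 = (φ (t, b)).1}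

namespace Fib
variable {T V W : Type*}

def ps (φ : Fib T V) (t : T) : V := (φ.1 (t, 0)).1

theorem fst (φ : Fib T V) (t : T) (a : Fin 3) : (φ.1 (t, a)).1 = φ.ps t := φ.2 t a 0

theorem snd_surj (φ : Fib T V) (t : T) : Function.Surjective (fun a => (φ.1 (t, a)).2) := by
  apply Finite.surjective_of_injective
  intro a b hab
  have : φ.1 (t, a) = φ.1 (t, b) := Prod.ext (φ.2 t a b) hab
  have := φ.1.injective this
  simpa using this

theorem exists_lab (φ : Fib T V) (t : T) (b : Fin 3) : ∃ a, φ.1 (t, a) = (φ.ps t, b) := by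
  obtain ⟨a, ha⟩ := φ.snd_surj t b
  exact ⟨a, Prod.ext (φ.fst t a) ha⟩

theorem ps_inj (φ : Fib T V) : Function.Injective φ.ps := by
  intro t t' h
  obtain ⟨a, ha⟩ := φ.exists_lab t (φ.1 (t', 0)).2
  have : φ.1 (t, a) = φ.1 (t', 0) := by rw [ha, h]; exact Prod.ext rfl rfl
  exact congrArg Prod.fst (φ.1.injective this)

theorem ps_surj (φ : Fib T V) : Function.Surjective φ.ps := by
  intro v
  refine ⟨(φ.1.symm (v, 0)).1, ?_⟩
  rw [← φ.fst _ (φ.1.symm (v, 0)).2]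
  simp

def symm (φ : Fib T V) : Fib V T := ⟨φ.1.symm, by
  intro v a b
  apply φ.ps_inj
  rw [← φ.fst _ (φ.1.symm (v, a)).2, ← φ.fst _ (φ.1.symm (v, b)).2]
  simp⟩

def trans (φ : Fib T V) (χ : Fib V W) : Fib T W := ⟨φ.1.trans χ.1, by
  intro t a b
  have : ∀ x y : V × Fin 3, x.1 = y.1 → (χ.1 x).1 = (χ.1 y).1 := by
    rintro ⟨x1, x2⟩ ⟨y1, y2⟩ rfl; exact χ.2 _ _ _
  exact this _ _ (φ.2 t a b)⟩

@[simp] theorem symm_val (φ : Fib T V) : φ.symm.1 = φ.1.symm := rfl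
@[simp] theorem trans_val (φ : Fib T V) (χ : Fib V W) : (φ.trans χ).1 = φ.1.trans χ.1 := rfl

theorem ps_symm (φ : Fib T V) (t : T) : φ.symm.ps (φ.ps t) = t := by
  apply φ.ps_inj
  rw [← φ.fst _ (φ.1.symm (φ.ps t, 0)).2]
  show (φ.1 (((φ.1.symm (φ.ps t, 0)).1, (φ.1.symm (φ.ps t, 0)).2))).1 = _
  simp

end Fib

/-- `φ` is compatible with the pairing `f`. -/
def CRel {c k : ℕ} {V : Type*} (f : V × Fin 3 → V × Fin 3) (φ : Fib (Tm c k) V) : Prop :=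
  ∀ t, f (φ.1 (t, 0)) = φ.1 (sc t, 1)

/-- validity of a cycle factor -/
def Vld {V : Type*} (k : ℕ) (f : V × Fin 3 → V × Fin 3) (S : Set (V × Fin 3)) : Prop :=
    (∀ p, p ∈ S ↔ f p ∈ S) ∧
    (∀ v : V, Nat.card {a : Fin 3 // (v, a) ∈ S} = 2) ∧
    (∀ v : V,
      Set.ncard {w : V |
        Relation.ReflTransGen (fun u u' => ∃ a : Fin 3, (u, a) ∈ S ∧ (f (u, a)).1 = u')
          v w} = k)

def SS {c k : ℕ} {V : Type*} (φ : Fib (Tm c k) V) : Set (V × Fin 3) :=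
  {p | (φ.1.symm p).2 ≠ 2}

theorem CRel.rel1 {c k : ℕ} {V : Type*} {f : V × Fin 3 → V × Fin 3} (hf : Function.Involutive f)
    {φ : Fib (Tm c k) V} (h : CRel f φ) (t : Tm c k) : f (φ.1 (t, 1)) = φ.1 (pd t, 0) := by
  have := h (pd t)
  rw [sc_pd] at this
  rw [← this, hf]

theorem fin3_cases (b : Fin 3) (h : b ≠ 2) : b = 0 ∨ b = 1 := by
  revert b; decide

theorem mem_SS {c k : ℕ} {V : Type*} (φ : Fib (Tm c k) V) (x : Tm c k × Fin 3) :
    φ.1 x ∈ SS φ ↔ x.2 ≠ 2 := by simp [SS]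

/-- the orbit of a row is reachable -/
theorem SS_valid {c k : ℕ} [NeZero k] {V : Type*} {f : V × Fin 3 → V × Fin 3}
    (hf : Function.Involutive f) {φ : Fib (Tm c k) V} (h : CRel f φ) : Vld k f (SS φ) := by
  have hinv : ∀ p, p ∈ SS φ → f p ∈ SS φ := by
    intro p hp
    obtain ⟨⟨t, b⟩, rfl⟩ := φ.1.surjective p
    rw [mem_SS] at hp
    rcases fin3_cases b hp with rfl | rfl
    · rw [h, mem_SS]; simp
    · rw [h.rel1 hf, mem_SS]; simp
  refine ⟨fun p => ⟨hinv p, fun hp => by simpa [hf p] using hinv _ hp⟩, ?_, ?_⟩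
  · intro v
    obtain ⟨t, rfl⟩ := φ.ps_surj v
    have : Nat.card {a : Fin 3 // (φ.ps t, a) ∈ SS φ} = Nat.card {b : Fin 3 // b ≠ 2} := by
      symm
      refine Nat.card_congr (Equiv.ofBijective
        (fun b => ⟨(φ.1 (t, b.1)).2, ?_⟩) ⟨?_, ?_⟩)
      · have : (φ.ps t, (φ.1 (t, b.1)).2) = φ.1 (t, b.1) := Prod.ext (φ.fst t _).symm rfl
        rw [this, mem_SS]; exact b.2
      · intro b b' hb
        have hb := congrArg Subtype.val hb
        have : φ.1 (t, b.1) = φ.1 (t, b'.1) := Prod.ext (φ.2 _ _ _) hb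
        have := φ.1.injective this
        apply Subtype.ext; simpa using this
      · rintro ⟨a, ha⟩
        obtain ⟨b, hb⟩ := φ.exists_lab t a
        rw [← hb, mem_SS] at ha
        exact ⟨⟨b, ha⟩, Subtype.ext (by simp [hb])⟩
    rw [this, Nat.card_eq_fintype_card]
    decide
  · intro v
    obtain ⟨⟨i, j⟩, rfl⟩ := φ.ps_surj v
    have hset : {w : V | Relation.ReflTransGen
        (fun u u' => ∃ a : Fin 3, (u, a) ∈ SS φ ∧ (f (u, a)).1 = u') (φ.ps (i, j)) w}
        = Set.range (fun j' : ZMod k => φ.ps (i, j')) := by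
      ext w
      constructor
      · intro hw
        induction hw with
        | refl => exact ⟨j, rfl⟩
        | tail _ hbc ih =>
          obtain ⟨j', rfl⟩ := ih
          obtain ⟨a, ha, rfl⟩ := hbc
          obtain ⟨b, hb⟩ := φ.exists_lab (i, j') a
          rw [← hb, mem_SS] at ha
          simp only
          rw [← hb]
          rcases fin3_cases b ha with rfl | rfl
          · exact ⟨j' + 1, by rw [h, φ.fst]; rfl⟩
          · exact ⟨j' - 1, by rw [h.rel1 hf, φ.fst]; rfl⟩
      · rintro ⟨j', rfl⟩
        have key : ∀ m : ℕ, Relation.ReflTransGen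
          (fun u u' => ∃ a : Fin 3, (u, a) ∈ SS φ ∧ (f (u, a)).1 = u')
            (φ.ps (i, j)) (φ.ps (i, j + m)) := by
          intro m
          induction m with
          | zero => simp; exact Relation.ReflTransGen.refl
          | succ m ih =>
            refine ih.tail ⟨(φ.1 ((i, j + m), 0)).2, ?_, ?_⟩
            · have : (φ.ps (i, j + m), (φ.1 ((i, j + m), 0)).2) = φ.1 ((i, j + m), 0) := rfl
              rw [this, mem_SS]; simp
            · have : (φ.ps (i, j + m), (φ.1 ((i, j + m), 0)).2) = φ.1 ((i, j + m), 0) := rfl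
              rw [this, h, φ.fst]
              simp [sc, add_assoc]
        have := key (j' - j).val
        simpa using this
    rw [hset, ← Set.image_univ, Set.ncard_image_of_injective _ (by
      intro a b hab
      have := φ.ps_inj hab
      simpa using this), Set.ncard_univ, Nat.card_zmod]

end modA2

section modA3
theorem fin3_two (s : Finset (Fin 3)) (h : s.card = 2) : ∃ t, ∀ a, a ∈ s ↔ a ≠ t := by
  revert s; decide

theorem exists_fib {c k : ℕ} [NeZero k] {V : Type*} [Finite V] (hV : Nat.card V = c * k)
    {f : V × Fin 3 → V × Fin 3} (hf : Function.Involutive f) (hf' : ∀ p, f p ≠ p)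
    {S : Set (V × Fin 3)} (hS : Vld k f S) :
    ∃ φ : Fib (Tm c k) V, CRel f φ ∧ SS φ = S := by
  classical
  obtain ⟨hS1, hS2, hS3⟩ := hS
  have ht : ∀ v, ∃ t, ∀ a : Fin 3, (v, a) ∈ S ↔ a ≠ t := by
    intro v
    have h := hS2 v
    rw [Nat.card_eq_fintype_card, Fintype.card_subtype] at h
    obtain ⟨t, ht⟩ := fin3_two _ h
    exact ⟨t, fun a => by simpa using ht a⟩
  choose t ht using ht
  let r : V × Fin 3 → V × Fin 3 := fun p => (p.1, -(p.2 + t p.1))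
  have hr : Function.Involutive r := by
    rintro ⟨v, a⟩; simp [r]
  let R : Equiv.Perm (V × Fin 3) := hr.toPerm
  let F : Equiv.Perm (V × Fin 3) := hf.toPerm
  have hR1 : ∀ p, (R p).1 = p.1 := fun p => rfl
  have hRR : R * R = 1 := by ext1 x; exact hr x
  have hFF : F * F = 1 := by ext1 x; exact hf x
  have hRi : R⁻¹ = R := inv_eq_of_mul_eq_one_left hRR
  have hFi : F⁻¹ = F := inv_eq_of_mul_eq_one_left hFF
  have hRS : ∀ p, p ∈ S → R p ∈ S := by
    rintro ⟨v, a⟩ h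
    rw [ht] at h
    show (v, -(a + t v)) ∈ S
    rw [ht]
    revert h; generalize t v = x; revert a x; decide
  have hRne : ∀ p, p ∈ S → R p ≠ p := by
    rintro ⟨v, a⟩ h h2
    rw [ht] at h
    have h3 : -(a + t v) = a := congrArg Prod.snd h2
    clear h2
    revert h h3; generalize t v = x; revert a x; decide
  have hRother : ∀ p q, p ∈ S → q ∈ S → p.1 = q.1 → q = p ∨ q = R p := by
    rintro ⟨v, a⟩ ⟨w, b⟩ h1 h2 (rfl : v = w)
    rw [ht] at h1 h2
    have : b = a ∨ b = -(a + t v) := by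
      revert h1 h2; generalize t v = x; revert a b x; decide
    rcases this with rfl | rfl
    · left; rfl
    · right; rfl
  have hFS : ∀ p, p ∈ S → F p ∈ S := fun p hp => (hS1 p).1 hp
  let ν := R * F
  have hνi : ν⁻¹ = F * R := by simp [ν, hRi, hFi]
  have hconj : R * ν * R⁻¹ = ν⁻¹ := by
    rw [hνi, hRi]; simp only [ν, ← mul_assoc, hRR, one_mul]
  have hconjz : ∀ (i : ℤ) p, R ((ν ^ i) p) = (ν ^ (-i)) (R p) := by
    intro i p
    have : R * ν ^ i * R⁻¹ = ν ^ (-i) := by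
      rw [← conj_zpow, hconj, inv_zpow, zpow_neg]
    rw [← this]; simp
  have hνS : ∀ p, p ∈ S → ν p ∈ S := fun p hp => hRS _ (hFS _ hp)
  have hνiS : ∀ p, p ∈ S → ν⁻¹ p ∈ S := fun p hp => by rw [hνi]; exact hFS _ (hRS _ hp)
  have hνz : ∀ (i : ℤ) p, p ∈ S → (ν ^ i) p ∈ S := by
    intro i p hp
    induction i with
    | zero => simpa using hp
    | succ i ih =>
      have : ν ^ ((i : ℤ) + 1) = ν * ν ^ (i : ℤ) := by rw [add_comm, zpow_add, zpow_one]
      rw [this]; exact hνS _ ih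
    | pred i ih =>
      have : ν ^ (-(i : ℤ) - 1) = ν⁻¹ * ν ^ (-(i : ℤ)) := by
        rw [sub_eq_add_neg, add_comm, zpow_add, zpow_neg_one]
      rw [this]; exact hνiS _ ih
  have hno : ∀ (j : ℤ) p, p ∈ S → R p ≠ (ν ^ j) p := by
    intro j p hp hj
    rcases Int.even_or_odd' j with ⟨i, rfl | rfl⟩
    · apply hRne _ (hνz i p hp)
      rw [hconjz, hj, ← Equiv.Perm.mul_apply, ← zpow_add]; congr 2; ring
    · apply hf' ((ν ^ i) p)
      have h1 : F = R * ν := by simp only [ν, ← mul_assoc, hRR, one_mul]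
      show F _ = _
      rw [h1, Equiv.Perm.mul_apply, ← Equiv.Perm.mul_apply ν]
      have : ν * ν ^ i = ν ^ (i + 1) := by rw [add_comm, zpow_add, zpow_one]
      rw [this, hconjz, hj, ← Equiv.Perm.mul_apply, ← zpow_add]; congr 2; ring
  have hinj : ∀ (i j : ℤ) p, p ∈ S → ((ν ^ i) p).1 = ((ν ^ j) p).1 → (ν ^ i) p = (ν ^ j) p := by
    intro i j p hp h
    rcases hRother _ _ (hνz i p hp) (hνz j p hp) h with h1 | h1
    · exact h1.symm
    · exfalso
      apply hno (j - i) _ (hνz i p hp)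
      rw [← h1, ← Equiv.Perm.mul_apply, ← zpow_add]; congr 2; ring
  -- components
  let st : V → V → Prop := fun u u' => ∃ a : Fin 3, (u, a) ∈ S ∧ (f (u, a)).1 = u'
  have hcomp : ∀ p, p ∈ S → {w | Relation.ReflTransGen st p.1 w} =
      Set.range (fun j : ℤ => ((ν ^ j) p).1) := by
    intro p hp
    ext w
    constructor
    · intro hw
      induction hw with
      | refl => exact ⟨0, by simp⟩
      | tail _ hbc ih =>
        obtain ⟨j, rfl⟩ := ih
        obtain ⟨a, ha, rfl⟩ := hbc
        rcases hRother _ (((ν ^ j) p).1, a) (hνz j p hp) ha rfl with h1 | h1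
        · refine ⟨1 + j, ?_⟩
          simp only
          rw [h1, zpow_add, zpow_one, Equiv.Perm.mul_apply]
          rfl
        · refine ⟨-1 + j, ?_⟩
          simp only
          rw [h1, zpow_add, zpow_neg_one, Equiv.Perm.mul_apply, hνi]
          rfl
    · rintro ⟨j, rfl⟩
      have hstep : ∀ q, q ∈ S → st q.1 (ν q).1 := fun q hq => ⟨q.2, hq, rfl⟩
      have hstep' : ∀ q, q ∈ S → st q.1 (ν⁻¹ q).1 := fun q hq =>
        ⟨(R q).2, hRS q hq, by rw [hνi]; rfl⟩
      simp only [Set.mem_ofPred_eq]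
      induction j with
      | zero => simp; exact Relation.ReflTransGen.refl
      | succ i ih =>
        have : ν ^ ((i : ℤ) + 1) = ν * ν ^ (i : ℤ) := by rw [add_comm, zpow_add, zpow_one]
        rw [this]; exact ih.tail (hstep _ (hνz _ _ hp))
      | pred i ih =>
        have : ν ^ (-(i : ℤ) - 1) = ν⁻¹ * ν ^ (-(i : ℤ)) := by
          rw [sub_eq_add_neg, add_comm, zpow_add, zpow_neg_one]
        rw [this]; exact ih.tail (hstep' _ (hνz _ _ hp))
  have hper : ∀ p, p ∈ S → (ν ^ k) p = p := by
    intro p hp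
    have h1 := hS3 p.1
    change ({w | Relation.ReflTransGen st p.1 w} : Set V).ncard = k at h1
    rw [hcomp p hp] at h1
    have h2 : Set.range (fun j : ℤ => ((ν ^ j) p).1) =
        Prod.fst '' (MulAction.orbit (Subgroup.zpowers ν) p) := by
      ext w; constructor
      · rintro ⟨j, rfl⟩
        exact ⟨(ν ^ j) p, ⟨⟨ν ^ j, j, rfl⟩, rfl⟩, rfl⟩
      · rintro ⟨_, ⟨⟨_, j, rfl⟩, rfl⟩, rfl⟩
        exact ⟨j, rfl⟩
    rw [h2, Set.InjOn.ncard_image] at h1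
    · have := Fintype.ofFinite V
      have h3 := MulAction.minimalPeriod_eq_card (a := ν) (b := p)
      rw [← Nat.card_eq_fintype_card, Nat.card_coe_set_eq, h1] at h3
      have h4 := Function.isPeriodicPt_minimalPeriod (ν • · : V × Fin 3 → V × Fin 3) p
      rw [h3] at h4
      have h5 : (ν • · : V × Fin 3 → V × Fin 3)^[k] p = p := h4
      rw [smul_iterate] at h5
      exact h5
    · rintro _ ⟨⟨_, j, rfl⟩, rfl⟩ _ ⟨⟨_, j', rfl⟩, rfl⟩ h
      exact hinj j j' p hp h
  have hmod : ∀ p, p ∈ S → ∀ m : ℕ, (ν ^ (m % k)) p = (ν ^ m) p := by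
    intro p hp m
    have h1 : ∀ l : ℕ, ((ν ^ k) ^ l) p = p := by
      intro l
      induction l with
      | zero => simp
      | succ l ih => rw [pow_succ, Equiv.Perm.mul_apply, hper p hp, ih]
    conv_rhs => rw [← Nat.mod_add_div m k, pow_add, pow_mul, Equiv.Perm.mul_apply, h1]
  -- quotient
  have hsymm : Std.Symm st := by
    refine ⟨?_⟩
    rintro u u' ⟨a, ha, rfl⟩
    refine ⟨(f (u, a)).2, (hS1 _).1 ha, ?_⟩
    show (f (f (u, a))).1 = u
    rw [hf]
  have hsymm' : ∀ u v, Relation.ReflTransGen st u v → Relation.ReflTransGen st v u :=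
    (Relation.ReflTransGen.stdSymm (r := st)).symm
  let Q : Setoid V := ⟨Relation.ReflTransGen st, ⟨fun _ => Relation.ReflTransGen.refl,
    fun h => hsymm' _ _ h, fun h h' => h.trans h'⟩⟩
  have hQ : Nat.card (Quotient Q) = c := by
    have h1 : Nat.card V = Nat.card (Σ y : Quotient Q, {x // (Quotient.mk Q x) = y}) :=
      Nat.card_congr (Equiv.sigmaFiberEquiv (Quotient.mk Q)).symm
    have h2 : ∀ y : Quotient Q, Nat.card {x // (Quotient.mk Q x) = y} = k := by
      intro y
      obtain ⟨v, rfl⟩ := Quotient.exists_rep y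
      have := hS3 v
      rw [← this, ← Nat.card_coe_set_eq]
      refine Nat.card_congr (Equiv.subtypeEquivRight fun x => ?_)
      rw [Quotient.eq]
      exact ⟨fun h => hsymm' _ _ h,
        fun h => hsymm' _ _ h⟩
    have := Fintype.ofFinite V
    rw [Nat.card_sigma, Finset.sum_congr rfl (fun y _ => h2 y), Finset.sum_const, hV,
      Finset.card_univ, ← Nat.card_eq_fintype_card, smul_eq_mul] at h1
    exact (Nat.eq_of_mul_eq_mul_right (NeZero.pos k) h1).symm
  let eQ : Fin c ≃ Quotient Q := (Finite.equivFinOfCardEq hQ).symm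
  let q : Fin c → V × Fin 3 := fun i => ((eQ i).out, t (eQ i).out + 1)
  have hq : ∀ i, q i ∈ S := by
    intro i; rw [ht]; simp
  let x : Tm c k → V × Fin 3 := fun y => (ν ^ y.2.val) (q y.1)
  have hx : ∀ y, x y ∈ S := fun y => by
    have := hνz (y.2.val : ℕ) (q y.1) (hq _)
    rw [zpow_natCast] at this
    exact this
  have hxsc : ∀ y, x (sc y) = ν (x y) := by
    intro y
    simp only [x, sc]
    rw [ZMod.val_add, hmod _ (hq _), ← Equiv.Perm.mul_apply, ← pow_succ']
    rw [← hmod _ (hq _), Nat.add_mod, ← hmod _ (hq y.1) (y.2.val + 1), Nat.add_mod y.2.val 1]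
    congr 3
    rcases Nat.lt_or_ge 1 k with hk | hk
    · have : Fact (1 < k) := ⟨hk⟩
      rw [ZMod.val_one]
    · have hk1 : k = 1 := le_antisymm hk (NeZero.pos k)
      subst hk1; simp [Nat.mod_one]
  have hxsurj : ∀ v, ∃ y, (x y).1 = v := by
    intro v
    let i := eQ.symm (Quotient.mk Q v)
    have h1 : Relation.ReflTransGen st (q i).1 v := by
      have : Quotient.mk Q (eQ i).out = Quotient.mk Q v := by
        rw [Quotient.out_eq]; simp [i]
      exact Quotient.exact this
    have h2 : v ∈ {w | Relation.ReflTransGen st (q i).1 w} := h1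
    rw [hcomp _ (hq i)] at h2
    obtain ⟨j, hj⟩ := h2
    refine ⟨(i, (j : ZMod k)), ?_⟩
    rw [← hj]
    simp only [x]
    have h3 : (ν ^ j) (q i) = (ν ^ (j % k)) (q i) := by
      have hz : ∀ l : ℤ, ((ν ^ (k : ℤ)) ^ l) (q i) = q i := by
        intro l
        exact Equiv.Perm.zpow_apply_eq_self_of_apply_eq_self
          (by rw [zpow_natCast]; exact hper _ (hq i)) l
      conv_lhs => rw [← Int.emod_add_mul_ediv j k, zpow_add, zpow_mul, Equiv.Perm.mul_apply, hz]
    rw [h3, ← ZMod.val_intCast, zpow_natCast]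
  let g : Tm c k × Fin 3 → V × Fin 3 := fun y =>
    if y.2 = 0 then x y.1 else if y.2 = 1 then R (x y.1) else ((x y.1).1, t (x y.1).1)
  have hg1 : ∀ y b, (g (y, b)).1 = (x y).1 := by
    intro y b
    simp only [g]; split_ifs <;> simp [hR1]
  have hgs : Function.Surjective g := by
    rintro ⟨v, a⟩
    obtain ⟨y, rfl⟩ := hxsurj v
    have h1 := hx y
    rcases hxy : x y with ⟨w, b⟩
    rw [hxy, ht] at h1
    show ∃ z, g z = (w, a)
    have : a = b ∨ a = -(b + t w) ∨ a = t w := by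
      clear hxy; revert h1; generalize t w = z; revert a b z; decide
    rcases this with h2 | h2 | h2
    · exact ⟨(y, 0), by simp [g, hxy, h2]⟩
    · exact ⟨(y, 1), by simp only [g, hxy, h2]; rfl⟩
    · exact ⟨(y, 2), by simp [g, hxy, h2]⟩
  have hgb : Function.Bijective g := by
    have := Fintype.ofFinite V
    rw [Fintype.bijective_iff_surjective_and_card]
    refine ⟨hgs, ?_⟩
    rw [Nat.card_eq_fintype_card] at hV
    simp [hV, ZMod.card]
  refine ⟨⟨Equiv.ofBijective g hgb, fun y a b => by simp [hg1]⟩, ?_, ?_⟩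
  · intro y
    show f (g (y, 0)) = g (sc y, 1)
    simp only [g, if_true, hxsc]
    have : R (ν (x y)) = F (x y) := by
      simp only [ν]; rw [← Equiv.Perm.mul_apply, ← mul_assoc, hRR, one_mul]
    simp [this]; rfl
  · ext p
    obtain ⟨⟨y, b⟩, rfl⟩ := hgb.2 p
    have h0 := mem_SS (⟨Equiv.ofBijective g hgb, fun y a b => by simp [hg1]⟩ : Fib (Tm c k) V) (y, b)
    refine h0.trans ?_
    simp only [g]
    split_ifs with h1 h2
    · simp [h1, hx]
    · simp [h2, hRS _ (hx _)]
    · have : b = 2 := by clear h0; revert h1 h2; revert b; decide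
      simp only [this, ht]; simp

end modA3

section modA4
def eT {c k : ℕ} (x : Tm c k × Fin 3) : Tm c k × Fin 3 :=
  if x.2 = 0 then (sc x.1, 1) else if x.2 = 1 then (pd x.1, 0) else x

theorem CRel.eT {c k : ℕ} {V : Type*} {f : V × Fin 3 → V × Fin 3} (hf : Function.Involutive f)
    {φ : Fib (Tm c k) V} (h : CRel f φ) (x : Tm c k × Fin 3) (hx : x.2 ≠ 2) :
    f (φ.1 x) = φ.1 (eT x) := by
  obtain ⟨t, b⟩ := x
  rcases fin3_cases b hx with rfl | rfl
  · simp [_root_.eT, h t]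
  · simp [_root_.eT, h.rel1 hf t]

abbrev Gam (c k : ℕ) : Type :=
  {α : Fib (Tm c k) (Tm c k) // (∀ x, (α.1 x).2 ≠ 2 ↔ x.2 ≠ 2) ∧
    ∀ t, eT (α.1 (t, 0)) = α.1 (sc t, 1)}

theorem fiber_card {c k : ℕ} [NeZero k] {V : Type*} {f : V × Fin 3 → V × Fin 3}
    (hf : Function.Involutive f) {φ0 : Fib (Tm c k) V} (h0 : CRel f φ0) :
    Nat.card {φ : Fib (Tm c k) V // CRel f φ ∧ SS φ = SS φ0} = Nat.card (Gam c k) := by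
  symm
  refine Nat.card_congr ⟨fun α => ⟨α.1.trans φ0, ?_, ?_⟩, fun φ => ⟨φ.1.trans φ0.symm, ?_, ?_⟩,
    ?_, ?_⟩
  · intro t
    simp only [Fib.trans_val, Equiv.trans_apply]
    rw [h0.eT hf _ ((α.2.1 (t, 0)).2 (by simp)), α.2.2]
  · ext p
    obtain ⟨x, rfl⟩ := (α.1.trans φ0).1.surjective p
    rw [mem_SS]
    simp only [Fib.trans_val, Equiv.trans_apply]
    rw [mem_SS, α.2.1]
  · intro x
    have h1 := mem_SS φ.1 x
    rw [φ.2.2] at h1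
    exact h1
  · intro t
    have h1 := (mem_SS φ.1 (t, 0)).2 (by simp)
    rw [φ.2.2] at h1
    have h2 := h0.eT hf (φ0.1.symm (φ.1.1 (t, 0))) h1
    simp only [Fib.trans_val, Fib.symm_val, Equiv.trans_apply]
    rw [Equiv.eq_symm_apply, ← h2, Equiv.apply_symm_apply, φ.2.1 t]
  · intro α; apply Subtype.ext; apply Subtype.ext; ext1 x; simp
  · intro φ; apply Subtype.ext; apply Subtype.ext; ext1 x; simp

theorem card_CRel {c k : ℕ} [NeZero k] {V : Type*} [Finite V] (hV : Nat.card V = c * k)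
    {f : V × Fin 3 → V × Fin 3} (hf : Function.Involutive f) (hf' : ∀ p, f p ≠ p) :
    Nat.card {φ : Fib (Tm c k) V // CRel f φ} =
      Nat.card {S : Set (V × Fin 3) // Vld k f S} * Nat.card (Gam c k) := by
  classical
  have h1 : Nat.card {φ : Fib (Tm c k) V // CRel f φ} =
      Nat.card (Σ S : {S : Set (V × Fin 3) // Vld k f S},
        {φ : {φ : Fib (Tm c k) V // CRel f φ} // (⟨SS φ.1, SS_valid hf φ.2⟩ :
          {S : Set (V × Fin 3) // Vld k f S}) = S}) :=
    Nat.card_congr (Equiv.sigmaFiberEquiv _).symm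
  have := Fintype.ofFinite {S : Set (V × Fin 3) // Vld k f S}
  rw [h1, Nat.card_sigma, Finset.sum_congr rfl (g := fun _ => Nat.card (Gam c k))]
  · simp [Nat.card_eq_fintype_card]
  · rintro ⟨S, hS⟩ -
    obtain ⟨φ0, h0, rfl⟩ := exists_fib hV hf hf' hS
    rw [← fiber_card hf h0]
    refine Nat.card_congr ⟨fun φ => ⟨φ.1.1, φ.1.2, congrArg Subtype.val φ.2⟩,
      fun φ => ⟨⟨φ.1, φ.2.1⟩, Subtype.ext φ.2.2⟩, fun φ => rfl, fun φ => rfl⟩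

/-- standard pairs -/
abbrev Zset (c k : ℕ) : Type :=
  {x : FPF (Tm c k × Fin 3) × Fib (Tm c k) (Tm c k) //
    (∀ t, x.1.1 (t, 0) = (sc t, 1)) ∧ CRel x.1.1 x.2}

theorem card_Fib_ge {T V : Type*} [Finite T] [Finite V] (n : ℕ) (hT : Nat.card T = n)
    (hV : Nat.card V = n) : n.factorial * 6 ^ n ≤ Nat.card (Fib T V) := by
  classical
  have := Fintype.ofFinite T
  have := Fintype.ofFinite V
  have h1 : Nat.card ((T ≃ V) × (T → Equiv.Perm (Fin 3))) = n.factorial * 6 ^ n := by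
    rw [Nat.card_prod, Nat.card_eq_fintype_card, Nat.card_eq_fintype_card]
    rw [Nat.card_eq_fintype_card] at hT hV
    rw [Fintype.card_equiv (Fintype.equivOfCardEq (hT.trans hV.symm)), hT, Fintype.card_fun,
      Fintype.card_perm, hT]
    rfl
  rw [← h1]
  refine Nat.card_le_card_of_injective (fun x => (⟨Equiv.prodShear x.1 x.2, fun t a b => rfl⟩ :
    Fib T V)) ?_
  rintro ⟨e, π⟩ ⟨e', π'⟩ h
  have h := congrArg Subtype.val h
  simp only at h
  have h2 : ∀ t a, (e t, π t a) = (e' t, π' t a) := fun t a =>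
    congrArg (fun s : T × Fin 3 ≃ V × Fin 3 => s (t, a)) h
  refine Prod.ext (Equiv.ext fun t => congrArg Prod.fst (h2 t 0)) ?_
  funext t; exact Equiv.ext fun a => congrArg Prod.snd (h2 t a)

theorem Tm_card (c k : ℕ) : Nat.card (Tm c k) = c * k := by
  rw [Nat.card_prod, Nat.card_fin, Nat.card_zmod]

theorem card_f_ge {c k : ℕ} [NeZero k] {V : Type*} [Finite V] (N : ℕ) (hk2 : 2 ≤ k)
    (hN : c * k = 2 * N) (φ : Fib (Tm c k) V) :
    df N ≤ Nat.card {f : FPF (V × Fin 3) // CRel f.1 φ} := by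
  have hcard : Nat.card ↥((SS φ)ᶜ) = 2 * N := by
    rw [← hN, ← Tm_card]
    symm
    refine Nat.card_congr (Equiv.ofBijective (fun t => ⟨φ.1 (t, 2), ?_⟩) ⟨?_, ?_⟩)
    · simp [SS]
    · intro t t' h
      have := φ.1.injective (congrArg Subtype.val h)
      simpa using this
    · rintro ⟨p, hp⟩
      obtain ⟨⟨t, b⟩, rfl⟩ := φ.1.surjective p
      have hb : b = 2 := by
        by_contra hb
        exact hp ((mem_SS φ (t, b)).2 hb)
      subst hb
      exact ⟨t, rfl⟩
  have hee : ∀ x : Tm c k × Fin 3, x.2 ≠ 2 → eT (eT x) = x := by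
    rintro ⟨t, b⟩ hb
    rcases fin3_cases b hb with rfl | rfl <;> simp [eT]
  have he2 : ∀ x : Tm c k × Fin 3, x.2 ≠ 2 → (eT x).2 ≠ 2 := by
    rintro ⟨t, b⟩ hb
    rcases fin3_cases b hb with rfl | rfl <;> simp [eT]
  have hne : ∀ x : Tm c k × Fin 3, x.2 ≠ 2 → eT x ≠ x := by
    rintro ⟨t, b⟩ hb
    rcases fin3_cases b hb with rfl | rfl <;> simp [eT]
  have h := fpf_ext_card_ge (SS φ) (fun p => φ.1 (eT (φ.1.symm p))) ?_ ?_ ?_ N hcard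
  · refine h.trans (Nat.card_le_card_of_injective
      (fun f => (⟨f.1, ?_⟩ : {f : FPF (V × Fin 3) // CRel f.1 φ})) ?_)
    · intro t
      have := f.2 (φ.1 (t, 0)) ((mem_SS φ (t, 0)).2 (by simp))
      simp only [Equiv.symm_apply_apply] at this
      rw [this]; simp [eT]
    · intro f f' h
      have h' := congrArg Subtype.val h
      exact Subtype.ext h'
  · intro p hp; exact (mem_SS φ _).2 (he2 _ hp)
  · intro p hp; simp only [Equiv.symm_apply_apply]; rw [hee _ hp]; simp
  · intro p hp h
    apply hne _ hp
    rw [Equiv.eq_symm_apply]; exact h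

theorem pairs_le (c k : ℕ) [NeZero k] {V : Type*} [Finite V] :
    Nat.card {x : FPF (V × Fin 3) × Fib (Tm c k) V × Fib (Tm c k) V //
      CRel x.1.1 x.2.1 ∧ CRel x.1.1 x.2.2} ≤ Nat.card (Fib (Tm c k) V) * Nat.card (Zset c k) := by
  rw [← Nat.card_prod]
  refine Nat.card_le_card_of_injective (fun x => (x.1.2.1,
    (⟨(⟨fun p => x.1.2.1.1.symm (x.1.1.1 (x.1.2.1.1 p)), ?_, ?_⟩, x.1.2.2.trans x.1.2.1.symm),
      ?_, ?_⟩ : Zset c k))) ?_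
  · intro p; simp [x.1.1.2.1 _]
  · intro p h
    rw [Equiv.symm_apply_eq] at h
    exact x.1.1.2.2 _ h
  · intro t
    simp only
    rw [x.2.1 t]; simp
  · intro t
    simp only [Fib.trans_val, Fib.symm_val, Equiv.trans_apply, Equiv.apply_symm_apply]
    rw [x.2.2 t]
  · rintro ⟨⟨f, φ1, φ2⟩, h1, h2⟩ ⟨⟨f', φ1', φ2'⟩, h1', h2'⟩ h
    simp only [Prod.mk.injEq, Subtype.mk.injEq] at h
    obtain ⟨rfl, h3, h4⟩ := h
    have h5 : f = f' := by
      apply Subtype.ext; funext p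
      have := congrFun h3 (φ1.1.symm p)
      simpa using this
    have h6 : φ2 = φ2' := by
      apply Subtype.ext; ext1 p
      have := congrArg (fun s : Fib (Tm c k) (Tm c k) => s.1 p) h4
      simpa using this
    subst h5; subst h6; rfl

theorem ratio_le (c k : ℕ) [NeZero k] (hk2 : 2 ≤ k) (N : ℕ) (hN : c * k = 2 * N) :
    EF2 (c * k) k / (EF (c * k) k) ^ 2 ≤
      (df (3 * N) : ℝ) * Nat.card (Zset c k) /
        ((c * k).factorial * 6 ^ (c * k) * (df N : ℝ) ^ 2) := by
  classical
  set n := c * k with hn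
  have hV : Nat.card (Fin n) = c * k := by rw [Nat.card_fin]
  let P := FPF (Fin n × Fin 3)
  have hfin : Fintype P := Fintype.ofFinite P
  have hfin2 : Fintype (Fib (Tm c k) (Fin n)) := Fintype.ofFinite _
  have hP : Nat.card P = df (3 * N) := fpf_card _ _ (by
    rw [Nat.card_prod, Nat.card_fin, Nat.card_fin, hN]; ring)
  set γ : ℕ := Nat.card (Gam c k) with hγ
  have hcf : ∀ f : P, Nat.card {φ : Fib (Tm c k) (Fin n) // CRel f.1 φ} = cfCount n k f.1 * γ :=
    fun f => card_CRel hV f.2.1 f.2.2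
  have e1 : EF n k = (∑ f : P, (cfCount n k f.1 : ℝ)) / df (3 * N) := by
    rw [EF]
    change (∑' f : P, (cfCount n k f.1 : ℝ)) / (Nat.card P : ℝ) = _
    rw [tsum_fintype, hP]
  have e2 : EF2 n k = (∑ f : P, (cfCount n k f.1 : ℝ) ^ 2) / df (3 * N) := by
    rw [EF2]
    change (∑' f : P, (cfCount n k f.1 : ℝ) ^ 2) / (Nat.card P : ℝ) = _
    rw [tsum_fintype, hP]
  set X : ℝ := ∑ f : P, (cfCount n k f.1 : ℝ) with hX
  set Y : ℝ := ∑ f : P, (cfCount n k f.1 : ℝ) ^ 2 with hY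
  set M : ℕ := Nat.card (Fib (Tm c k) (Fin n)) with hM
  have hM' : n.factorial * 6 ^ n ≤ M := card_Fib_ge n (by rw [Tm_card]) (by rw [Nat.card_fin])
  -- first moment
  have hXl : (M : ℝ) * df N ≤ γ * X := by
    have h1 : M * df N ≤ ∑ φ : Fib (Tm c k) (Fin n), Nat.card {f : P // CRel f.1 φ} := by
      rw [hM, Nat.card_eq_fintype_card, ← Finset.card_univ, ← smul_eq_mul]
      exact Finset.card_nsmul_le_sum _ _ _ (fun φ _ => card_f_ge N hk2 hN φ)
    have h2 : ∑ φ : Fib (Tm c k) (Fin n), Nat.card {f : P // CRel f.1 φ} =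
        ∑ f : P, Nat.card {φ : Fib (Tm c k) (Fin n) // CRel f.1 φ} := by
      rw [← Nat.card_sigma, ← Nat.card_sigma]
      refine Nat.card_congr ⟨fun x => ⟨x.2.1, x.1, x.2.2⟩, fun x => ⟨x.2.1, x.1, x.2.2⟩,
        fun x => rfl, fun x => rfl⟩
    rw [h2, Finset.sum_congr rfl (fun f _ => hcf f), ← Finset.sum_mul] at h1
    rw [hX, mul_comm (γ : ℝ)]
    exact_mod_cast h1
  have hYu : (γ : ℝ) ^ 2 * Y ≤ M * Nat.card (Zset c k) := by
    have h1 := pairs_le c k (V := Fin n)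
    have h2 : Nat.card {x : FPF (Fin n × Fin 3) × Fib (Tm c k) (Fin n) × Fib (Tm c k) (Fin n) //
      CRel x.1.1 x.2.1 ∧ CRel x.1.1 x.2.2} =
        ∑ f : P, Nat.card {φ : Fib (Tm c k) (Fin n) // CRel f.1 φ} ^ 2 := by
      simp_rw [sq, ← Nat.card_prod]
      rw [← Nat.card_sigma]
      refine Nat.card_congr ⟨fun x => ⟨x.1.1, ⟨x.1.2.1, x.2.1⟩, ⟨x.1.2.2, x.2.2⟩⟩,
        fun x => ⟨⟨x.1, x.2.1.1, x.2.2.1⟩, x.2.1.2, x.2.2.2⟩, fun x => rfl, fun x => rfl⟩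
    rw [h2, Finset.sum_congr rfl (fun f _ => by rw [hcf f, mul_pow]), ← Finset.sum_mul] at h1
    rw [hY, mul_comm ((γ : ℝ) ^ 2)]
    exact_mod_cast h1
  have hMpos : (0 : ℝ) < M := by
    have : 0 < n.factorial * 6 ^ n := by positivity
    exact_mod_cast lt_of_lt_of_le this hM'
  have hdN : (0 : ℝ) < df N := by exact_mod_cast df_pos N
  have hd3 : (0 : ℝ) < df (3 * N) := by exact_mod_cast df_pos (3 * N)
  have hγX : 0 < γ * X := lt_of_lt_of_le (by positivity) hXl
  have hγ0 : (γ : ℝ) ≠ 0 := by rintro h; rw [h] at hγX; simp at hγX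
  have hX0 : X ≠ 0 := by rintro h; rw [h] at hγX; simp at hγX
  rw [e1, e2]
  have e3 : Y / (df (3 * N) : ℝ) / (X / df (3 * N)) ^ 2 =
      df (3 * N) * ((γ : ℝ) ^ 2 * Y) / (γ * X) ^ 2 := by
    field_simp
  rw [e3]
  calc df (3 * N) * ((γ : ℝ) ^ 2 * Y) / (γ * X) ^ 2
      ≤ df (3 * N) * (M * Nat.card (Zset c k)) / (M * df N) ^ 2 := by gcongr
    _ = df (3 * N) * Nat.card (Zset c k) / (M * (df N : ℝ) ^ 2) := by field_simp
    _ ≤ _ := by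
      gcongr
      exact_mod_cast hM'

end modA4

section modA5
section moves
variable {c k : ℕ}

def bk (v : Tm c k) (j : ℕ) : Tm c k := (v.1, v.2 - (j : ZMod k))
def fw (v : Tm c k) (j : ℕ) : Tm c k := (v.1, v.2 + (j : ZMod k))

@[simp] theorem bk_zero (v : Tm c k) : bk v 0 = v := by simp [bk]
@[simp] theorem fw_zero (v : Tm c k) : fw v 0 = v := by simp [fw]
theorem sc_bk (v : Tm c k) (j : ℕ) : sc (bk v (j + 1)) = bk v j := by
  simp [bk, sc]; ring
theorem pd_bk (v : Tm c k) (j : ℕ) : pd (bk v j) = bk v (j + 1) := by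
  simp [bk, pd, sub_sub]
theorem sc_fw (v : Tm c k) (j : ℕ) : sc (fw v j) = fw v (j + 1) := by simp [fw, sc, add_assoc]
theorem pd_fw (v : Tm c k) (j : ℕ) : pd (fw v (j + 1)) = fw v j := by
  simp [fw, pd, ← add_assoc]
theorem bk_fw (v : Tm c k) (i j : ℕ) (h : j ≤ i) : bk (fw v i) j = fw v (i - j) := by
  simp [bk, fw, Nat.cast_sub h, add_sub_assoc]
theorem bk_card (v : Tm c k) : bk v k = v := by simp [bk]

/-- the length of the piece ending at `v` -/
noncomputable def lab (A : Set (Tm c k)) (v : Tm c k) : ℕ := sInf {l | 1 ≤ l ∧ bk v l ∈ A}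

theorem lab_eq {A : Set (Tm c k)} {v : Tm c k} {l : ℕ} (h1 : 1 ≤ l) (h2 : bk v l ∈ A)
    (h3 : ∀ j, 1 ≤ j → j < l → bk v j ∉ A) : lab A v = l := by
  have hm : l ∈ {l | 1 ≤ l ∧ bk v l ∈ A} := ⟨h1, h2⟩
  apply le_antisymm (Nat.sInf_le hm)
  by_contra h
  have := Nat.sInf_mem ⟨l, hm⟩
  exact h3 _ this.1 (not_le.1 h) this.2

theorem lab_spec [NeZero k] {A : Set (Tm c k)} {v : Tm c k} (hv : v ∈ A) :
    1 ≤ lab A v ∧ lab A v ≤ k ∧ bk v (lab A v) ∈ A ∧ ∀ j, 1 ≤ j → j < lab A v → bk v j ∉ A := by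
  have hm : k ∈ {l | 1 ≤ l ∧ bk v l ∈ A} := ⟨NeZero.pos k, by rw [bk_card]; exact hv⟩
  have h := Nat.sInf_mem ⟨k, hm⟩
  refine ⟨h.1, Nat.sInf_le hm, h.2, fun j h1 h2 h3 => ?_⟩
  exact absurd (Nat.sInf_le (show j ∈ {l | 1 ≤ l ∧ bk v l ∈ A} from ⟨h1, h3⟩)) (not_le.2 h2)

end moves

section adm
variable {c k : ℕ}

/-- admissible pairs -/
structure Adm (g : Tm c k × Fin 3 → Tm c k × Fin 3) (φ : Fib (Tm c k) (Tm c k)) : Prop where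
  inv : Function.Involutive g
  std : ∀ t, g (t, 0) = (sc t, 1)
  rel : CRel g φ

def oo (φ : Fib (Tm c k) (Tm c k)) (t : Tm c k) : Fin 3 := (φ.1 (t, 0)).2
def ii (φ : Fib (Tm c k) (Tm c k)) (t : Tm c k) : Fin 3 := (φ.1 (t, 1)).2
def DD (φ : Fib (Tm c k) (Tm c k)) (t : Tm c k) : Prop := oo φ t = 0 ∨ ii φ t = 1
def AA (φ : Fib (Tm c k) (Tm c k)) : Set (Tm c k) := {t | oo φ t = 2}
def UU (A : Set (Tm c k)) : Set (Fin c) := {r | ∀ j, (r, j) ∉ A}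

variable {g : Tm c k × Fin 3 → Tm c k × Fin 3} {φ : Fib (Tm c k) (Tm c k)}

theorem val0 (φ : Fib (Tm c k) (Tm c k)) (t : Tm c k) : φ.1 (t, 0) = (φ.ps t, oo φ t) :=
  Prod.ext (φ.fst t 0) rfl
theorem val1 (φ : Fib (Tm c k) (Tm c k)) (t : Tm c k) : φ.1 (t, 1) = (φ.ps t, ii φ t) :=
  Prod.ext (φ.fst t 1) rfl
theorem oo_ne_ii (φ : Fib (Tm c k) (Tm c k)) (t : Tm c k) : oo φ t ≠ ii φ t := by
  intro h
  have : φ.1 (t, 0) = φ.1 (t, 1) := by rw [val0, val1, h]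
  simpa using φ.1.injective this
theorem val2 (φ : Fib (Tm c k) (Tm c k)) (t : Tm c k) (b : Fin 3) (h0 : b ≠ oo φ t)
    (h1 : b ≠ ii φ t) : φ.1 (t, 2) = (φ.ps t, b) := by
  obtain ⟨a, ha⟩ := φ.exists_lab t b
  have : a = 2 := by
    by_contra h
    rcases fin3_cases a h with rfl | rfl
    · rw [val0] at ha; exact h0 (congrArg Prod.snd ha).symm
    · rw [val1] at ha; exact h1 (congrArg Prod.snd ha).symm
  rw [← this]; exact ha

namespace Adm

theorem std1 (h : Adm g φ) (t) : g (t, 1) = (pd t, 0) := by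
  have := h.std (pd t); rw [sc_pd] at this; rw [← this, h.inv]

theorem g_lab (h : Adm g φ) (x : Tm c k × Fin 3) : (g x).2 = 2 ↔ x.2 = 2 := by
  have key : ∀ y : Tm c k × Fin 3, y.2 ≠ 2 → (g y).2 ≠ 2 := by
    rintro ⟨t, b⟩ hb
    rcases fin3_cases b hb with rfl | rfl
    · rw [h.std]; simp
    · rw [h.std1]; simp
  constructor
  · intro h1; by_contra h2; exact key x h2 h1
  · intro h1; by_contra h2
    have := key _ h2
    rw [h.inv] at this; exact this h1

/-- the conjugate pair -/
theorem symm (h : Adm g φ) : Adm (fun p => φ.1.symm (g (φ.1 p))) φ.symm where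
  inv := fun p => by simp [h.inv _]
  std := fun t => by rw [h.rel t]; simp
  rel := fun t => by simp [h.std t]

theorem f_lab (h : Adm g φ) (x : Tm c k × Fin 3) : (φ.1.symm (g (φ.1 x))).2 = 2 ↔ x.2 = 2 :=
  h.symm.g_lab x

theorem F0 (h : Adm g φ) {t} (ht : oo φ t = 0) : φ.1 (sc t, 1) = (sc (φ.ps t), 1) := by
  rw [← h.rel t, val0, ht, h.std]
theorem F1 (h : Adm g φ) {t} (ht : oo φ t = 1) : φ.1 (sc t, 1) = (pd (φ.ps t), 0) := by
  rw [← h.rel t, val0, ht, h.std1]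
theorem F2 (h : Adm g φ) (t) : oo φ t = 2 ↔ ii φ (sc t) = 2 := by
  have h1 : φ.1 (sc t, 1) = g (φ.1 (t, 0)) := (h.rel t).symm
  have h2 := h.g_lab (φ.1 (t, 0))
  rw [← h1] at h2
  exact h2.symm
theorem F2' (h : Adm g φ) (t) : ii φ t = 2 ↔ pd t ∈ AA φ := by
  have := h.F2 (pd t); rw [sc_pd] at this; exact this.symm

theorem D_sc (h : Adm g φ) {t} (ht : t ∉ AA φ) : DD φ (sc t) ↔ DD φ t := by
  rcases fin3_cases _ ht with h0 | h0
  · have h1 : ii φ (sc t) = 1 := congrArg Prod.snd (h.F0 h0)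
    simp [DD, h0, h1]
  · have h1 : ii φ (sc t) = 0 := congrArg Prod.snd (h.F1 h0)
    have h2 := oo_ne_ii φ (sc t)
    have h3 := oo_ne_ii φ t
    rw [h1] at h2; rw [h0] at h3
    simp [DD, h0, h1, h2, h3.symm]

theorem ps_fwd (h : Adm g φ) {t} (ht : t ∉ AA φ) (hD : DD φ t) : φ.ps (sc t) = sc (φ.ps t) := by
  have h0 : oo φ t = 0 := by
    rcases fin3_cases _ ht with h0 | h0
    · exact h0
    · rcases hD with h1 | h1
      · exact h1
      · exact absurd (h0.trans h1.symm) (oo_ne_ii φ t)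
  rw [← φ.fst _ 1, h.F0 h0]

theorem ps_bwd (h : Adm g φ) {t} (ht : t ∉ AA φ) (hD : ¬ DD φ t) :
    φ.ps (sc t) = pd (φ.ps t) := by
  have h0 : oo φ t = 1 := by
    rcases fin3_cases _ ht with h0 | h0
    · exact absurd (Or.inl h0) hD
    · exact h0
  rw [← φ.fst _ 1, h.F1 h0]

theorem piece (h : Adm g φ) {t} {l : ℕ} (hl : ∀ j, 1 ≤ j → j < l → bk t j ∉ AA φ) (j : ℕ)
    (hj : j < l) : (DD φ (bk t j) ↔ DD φ t) ∧ (DD φ t → φ.ps (bk t j) = bk (φ.ps t) j) ∧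
      (¬ DD φ t → φ.ps (bk t j) = fw (φ.ps t) j) := by
  induction j with
  | zero => simp
  | succ j ih =>
    obtain ⟨i1, i2, i3⟩ := ih (by omega)
    have hA := hl (j + 1) (by omega) hj
    have hD := h.D_sc hA
    rw [sc_bk] at hD
    refine ⟨hD.symm.trans i1, fun hd => ?_, fun hd => ?_⟩
    · have h1 := h.ps_fwd hA (hD.1 (i1.2 hd))
      rw [sc_bk, i2 hd] at h1
      rw [← pd_bk (φ.ps t) j, h1, pd_sc]
    · have h1 := h.ps_bwd hA (fun hd' => hd (i1.1 (hD.2 hd')))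
      rw [sc_bk, i3 hd] at h1
      rw [← sc_fw (φ.ps t) j, h1, sc_pd]

end Adm

/-- the matched end of piece -/
noncomputable def PP (φ : Fib (Tm c k) (Tm c k)) (t : Tm c k) : Tm c k := by
  classical exact if DD φ t then φ.ps t else fw (φ.ps t) (lab (AA φ) t - 1)

theorem oo_of (φ : Fib (Tm c k) (Tm c k)) {t} (ht : oo φ t ≠ 2) (hD : DD φ t) : oo φ t = 0 := by
  rcases fin3_cases _ ht with h0 | h0
  · exact h0
  · rcases hD with h1 | h1
    · exact h1
    · exact absurd (h0.trans h1.symm) (oo_ne_ii φ t)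
theorem oo_of' (φ : Fib (Tm c k) (Tm c k)) {t} (ht : oo φ t ≠ 2) (hD : ¬ DD φ t) :
    oo φ t = 1 := by
  rcases fin3_cases _ ht with h0 | h0
  · exact absurd (Or.inl h0) hD
  · exact h0
theorem ii_of (φ : Fib (Tm c k) (Tm c k)) {t} (ht : ii φ t ≠ 2) (hD : DD φ t) : ii φ t = 1 := by
  rcases fin3_cases _ ht with h0 | h0
  · rcases hD with h1 | h1
    · exact absurd (h1.trans h0.symm) (oo_ne_ii φ t)
    · exact h1
  · exact h0
theorem ii_of' (φ : Fib (Tm c k) (Tm c k)) {t} (ht : ii φ t ≠ 2) (hD : ¬ DD φ t) :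
    ii φ t = 0 := by
  rcases fin3_cases _ ht with h0 | h0
  · exact h0
  · exact absurd (Or.inr h0) hD

theorem mem_AAs (φ : Fib (Tm c k) (Tm c k)) (t : Tm c k) (h : φ.1 (t, 2) = (φ.ps t, 0)) :
    φ.ps t ∈ AA φ.symm := by
  show (φ.1.symm (φ.ps t, 0)).2 = 2
  rw [← h]; simp
theorem not_mem_AAs (φ : Fib (Tm c k) (Tm c k)) (t : Tm c k) (h : oo φ t = 0 ∨ ii φ t = 0) :
    φ.ps t ∉ AA φ.symm := by
  show (φ.1.symm (φ.ps t, 0)).2 ≠ 2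
  rcases h with h | h
  · rw [← h, ← val0]; simp
  · rw [← h, ← val1]; simp

namespace Adm

theorem lab_ge [NeZero k] (h : Adm g φ) {t} (ht : t ∈ AA φ) : 2 ≤ lab (AA φ) t := by
  obtain ⟨h1, -, h3, -⟩ := lab_spec ht
  by_contra h4
  have h5 : lab (AA φ) t = 1 := by omega
  rw [h5] at h3
  have h6 : bk t 1 = pd t := by rw [← pd_bk, bk_zero]
  rw [h6, ← h.F2'] at h3
  exact oo_ne_ii φ t ((show oo φ t = 2 from ht).trans h3.symm)

theorem PP_spec [NeZero k] (h : Adm g φ) {t} (ht : t ∈ AA φ) :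
    PP φ t ∈ AA φ.symm ∧ lab (AA φ.symm) (PP φ t) = lab (AA φ) t := by
  classical
  have hl2 := h.lab_ge ht
  obtain ⟨-, -, hlA, hlj⟩ := lab_spec ht
  obtain ⟨l, hl⟩ : ∃ l, l = lab (AA φ) t := ⟨_, rfl⟩
  rw [← hl] at hl2 hlA hlj ⊢
  have hot : oo φ t = 2 := ht
  have hit : ii φ t ≠ 2 := fun h' => oo_ne_ii φ t (hot.trans h'.symm)
  obtain ⟨m, rfl⟩ : ∃ m, l = m + 2 := ⟨l - 2, by omega⟩
  -- start of the piece
  obtain ⟨s1, s2, s3⟩ := h.piece hlj (m + 1) (by omega)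
  have hsA : bk t (m + 1) ∉ AA φ := hlj _ (by omega) (by omega)
  have hsi : ii φ (bk t (m + 1)) = 2 := by
    rw [h.F2', pd_bk]; exact hlA
  by_cases hD : DD φ t
  · have hP : PP φ t = φ.ps t := by simp [PP, hD]
    rw [hP]
    have hi1 := ii_of φ hit hD
    have hmem : φ.ps t ∈ AA φ.symm := mem_AAs φ t (val2 φ t 0 (by simp [hot]) (by simp [hi1]))
    refine ⟨hmem, lab_eq (by omega) ?_ ?_⟩
    · have ho := oo_of φ hsA (s1.2 hD)
      have hv := val2 φ (bk t (m + 1)) 1 (by simp [ho]) (by simp [hsi])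
      have h1 := h.f_lab (bk t (m + 1), 2)
      rw [hv, h.std1, s2 hD, pd_bk] at h1
      exact h1.2 rfl
    · intro j hj1 hj2
      obtain ⟨p1, p2, p3⟩ := h.piece hlj j hj2
      rw [← p2 hD]
      exact not_mem_AAs φ _ (Or.inl (oo_of φ (hlj j hj1 hj2) (p1.2 hD)))
  · have hP : PP φ t = φ.ps (bk t (m + 1)) := by
      simp only [PP, hD, if_false, ← hl]; rw [s3 hD]; rfl
    have hs3 := s3 hD
    rw [hP]
    have ho := oo_of' φ hsA (fun h' => hD (s1.1 h'))
    refine ⟨mem_AAs φ _ (val2 φ _ 0 (by simp [ho]) (by simp [hsi])), lab_eq (by omega) ?_ ?_⟩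
    · have hi0 := ii_of' φ hit hD
      have hv := val2 φ t 1 (by simp [hot]) (by simp [hi0])
      have h1 := h.f_lab (t, 2)
      rw [hv, h.std1] at h1
      have h2 : bk (φ.ps (bk t (m + 1))) (m + 2) = pd (φ.ps t) := by
        rw [hs3, ← pd_bk, bk_fw _ _ _ le_rfl, Nat.sub_self, fw_zero]
      rw [h2]; exact h1.2 rfl
    · intro j hj1 hj2
      obtain ⟨p1, p2, p3⟩ := h.piece hlj (m + 1 - j) (by omega)
      rw [hs3, bk_fw _ _ _ (by omega), ← p3 hD]
      refine not_mem_AAs φ _ (Or.inr (ii_of' φ ?_ (fun h' => hD (p1.1 h'))))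
      rw [Ne, h.F2', pd_bk]
      exact hlj _ (by omega) (by omega)

theorem PP_inj [NeZero k] (h : Adm g φ) : Set.InjOn (PP φ) (AA φ) := by
  classical
  have key : ∀ t ∈ AA φ, ∀ t' ∈ AA φ, PP φ t = PP φ t' → DD φ t → ¬ DD φ t' → False := by
    intro t ht t' ht' he hD hD'
    obtain ⟨-, -, -, hlj⟩ := lab_spec ht'
    have h2 := h.lab_ge ht'
    obtain ⟨-, -, s3⟩ := h.piece hlj (lab (AA φ) t' - 1) (by omega)
    simp only [PP, hD, hD', if_true, if_false] at he
    rw [← s3 hD'] at he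
    have := φ.ps_inj he
    exact hlj (lab (AA φ) t' - 1) (by omega) (by omega) (this ▸ ht)
  intro t ht t' ht' he
  have hle : lab (AA φ) t = lab (AA φ) t' := by
    rw [← (h.PP_spec ht).2, ← (h.PP_spec ht').2, he]
  by_cases hD : DD φ t <;> by_cases hD' : DD φ t'
  · simp only [PP, hD, hD', if_true] at he
    exact φ.ps_inj he
  · exact (key t ht t' ht' he hD hD').elim
  · exact (key t' ht' t ht he.symm hD' hD).elim
  · simp only [PP, hD, hD', if_false, hle, fw] at he
    apply φ.ps_inj
    have h1 := congrArg Prod.fst he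
    have h2 := congrArg Prod.snd he
    simp only at h1 h2
    exact Prod.ext h1 (add_right_cancel h2)

theorem row (h : Adm g φ) {r : Fin c} (hr : r ∈ UU (AA φ)) (j : ℕ) :
    (DD φ (fw (r, 0) j) ↔ DD φ (r, 0)) ∧
    (DD φ (r, 0) → φ.ps (fw (r, 0) j) = fw (φ.ps (r, 0)) j) ∧
    (¬ DD φ (r, 0) → φ.ps (fw (r, 0) j) = bk (φ.ps (r, 0)) j) := by
  induction j with
  | zero => simp
  | succ j ih =>
    obtain ⟨i1, i2, i3⟩ := ih
    have hA : fw (r, (0 : ZMod k)) j ∉ AA φ := hr _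
    have hD := h.D_sc hA
    rw [sc_fw] at hD
    refine ⟨hD.trans i1, fun hd => ?_, fun hd => ?_⟩
    · rw [← sc_fw, h.ps_fwd hA (i1.2 hd), i2 hd, sc_fw]
    · rw [← sc_fw, h.ps_bwd hA (fun h' => hd (i1.1 h')), i3 hd, pd_bk]

theorem row_surj [NeZero k] (h : Adm g φ) {r : Fin c} (hr : r ∈ UU (AA φ)) (j' : ZMod k) :
    ∃ j, φ.ps (r, j) = ((φ.ps (r, 0)).1, j') := by
  by_cases hD : DD φ (r, 0)
  · refine ⟨_, (((h.row hr (j' - (φ.ps (r, 0)).2).val).2.1 hD)).trans ?_⟩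
    simp [fw]
  · refine ⟨_, (((h.row hr ((φ.ps (r, 0)).2 - j').val).2.2 hD)).trans ?_⟩
    simp [bk]

theorem row_U [NeZero k] (h : Adm g φ) {r : Fin c} (hr : r ∈ UU (AA φ)) :
    (φ.ps (r, 0)).1 ∈ UU (AA φ.symm) := by
  intro j'
  obtain ⟨j, hj⟩ := h.row_surj hr j'
  rw [← hj]
  apply not_mem_AAs
  have h1 : ii φ (r, j) ≠ 2 := by rw [Ne, h.F2']; exact hr _
  by_cases hD : DD φ (r, j)
  · exact Or.inl (oo_of φ (hr j) hD)
  · exact Or.inr (ii_of' φ h1 hD)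

theorem row_inj [NeZero k] (h : Adm g φ) :
    Set.InjOn (fun r => (φ.ps (r, 0)).1) (UU (AA φ)) := by
  intro r hr r' hr' he
  obtain ⟨j, hj⟩ := h.row_surj hr 0
  obtain ⟨j', hj'⟩ := h.row_surj hr' 0
  simp only at he
  rw [he, ← hj'] at hj
  exact congrArg Prod.fst (φ.ps_inj hj)

/-- `φ` is determined by its encoding -/
theorem determined [NeZero k] {g' : Tm c k × Fin 3 → Tm c k × Fin 3}
    {φ' : Fib (Tm c k) (Tm c k)} (h : Adm g φ) (h' : Adm g' φ') (hA : AA φ = AA φ')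
    (hP : ∀ t ∈ AA φ, PP φ t = PP φ' t) (hD : ∀ t ∈ AA φ, (DD φ t ↔ DD φ' t))
    (hU : ∀ r ∈ UU (AA φ), φ.ps (r, 0) = φ'.ps (r, 0) ∧ (DD φ (r, 0) ↔ DD φ' (r, 0))) :
    φ = φ' := by
  classical
  have key : ∀ t, φ.ps t = φ'.ps t ∧ (DD φ t ↔ DD φ' t) := by
    rintro ⟨r, j⟩
    by_cases hr : r ∈ UU (AA φ)
    · obtain ⟨a1, a2⟩ := hU r hr
      obtain ⟨b1, b2, b3⟩ := h.row hr j.val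
      obtain ⟨c1, c2, c3⟩ := h'.row (hA ▸ hr) j.val
      have hj : fw (r, (0 : ZMod k)) j.val = (r, j) := by simp [fw]
      rw [hj] at b1 b2 b3 c1 c2 c3
      refine ⟨?_, b1.trans (a2.trans c1.symm)⟩
      by_cases hd : DD φ (r, 0)
      · rw [b2 hd, c2 (a2.1 hd), a1]
      · rw [b3 hd, c3 (fun h => hd (a2.2 h)), a1]
    · simp only [UU, Set.mem_ofPred_eq, not_forall, not_not] at hr
      obtain ⟨j', hj'⟩ := hr
      have main : ∀ m : ℕ, ∀ t, fw t m ∈ AA φ → φ.ps t = φ'.ps t ∧ (DD φ t ↔ DD φ' t) := by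
        intro m
        induction m with
        | zero =>
          intro t ht
          rw [fw_zero] at ht
          have hd := hD t ht
          refine ⟨?_, hd⟩
          have hp := hP t ht
          by_cases hd1 : DD φ t
          · simpa [PP, hd1, hd.1 hd1] using hp
          · have hd2 : ¬ DD φ' t := fun h => hd1 (hd.2 h)
            simp only [PP, hd1, hd2, if_false, ← hA, fw] at hp
            have h1 := congrArg Prod.fst hp
            have h2 := congrArg Prod.snd hp
            simp only at h1 h2
            exact Prod.ext h1 (add_right_cancel h2)
        | succ m ih =>
          intro t ht
          by_cases htA : t ∈ AA φ
          · exact (by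
              have hd := hD t htA
              refine ⟨?_, hd⟩
              have hp := hP t htA
              by_cases hd1 : DD φ t
              · simpa [PP, hd1, hd.1 hd1] using hp
              · have hd2 : ¬ DD φ' t := fun h => hd1 (hd.2 h)
                simp only [PP, hd1, hd2, if_false, ← hA, fw] at hp
                have h1 := congrArg Prod.fst hp
                have h2 := congrArg Prod.snd hp
                simp only at h1 h2
                exact Prod.ext h1 (add_right_cancel h2))
          · have h1 := ih (sc t) (by
              have : fw (sc t) m = fw t (m + 1) := by simp [fw, sc]; ring
              rw [this]; exact ht)
            have htA' : t ∉ AA φ' := hA ▸ htA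
            have e1 := h.D_sc htA
            have e2 := h'.D_sc htA'
            have e3 : DD φ t ↔ DD φ' t := e1.symm.trans (h1.2.trans e2)
            refine ⟨?_, e3⟩
            by_cases hd : DD φ t
            · have f1 := h.ps_fwd htA hd
              have f2 := h'.ps_fwd htA' (e3.1 hd)
              rw [← pd_sc (φ.ps t), ← f1, h1.1, f2, pd_sc]
            · have f1 := h.ps_bwd htA hd
              have f2 := h'.ps_bwd htA' (fun h => hd (e3.2 h))
              rw [← sc_pd (φ.ps t), ← f1, h1.1, f2, sc_pd]
      refine main (j' - j).val (r, j) ?_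
      have : fw (r, j) (j' - j).val = (r, j') := by simp [fw]
      rw [this]; exact hj'
  have hoo : ∀ t, oo φ t = oo φ' t := by
    intro t
    by_cases ht : t ∈ AA φ
    · have ht' : t ∈ AA φ' := hA ▸ ht
      exact (show oo φ t = 2 from ht).trans (show oo φ' t = 2 from ht').symm
    · have ht' : t ∉ AA φ' := hA ▸ ht
      by_cases hd : DD φ t
      · rw [oo_of φ ht hd, oo_of φ' ht' ((key t).2.1 hd)]
      · rw [oo_of' φ ht hd, oo_of' φ' ht' (fun h => hd ((key t).2.2 h))]
  have hii : ∀ t, ii φ t = ii φ' t := by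
    intro t
    have h2 : ii φ t = 2 ↔ ii φ' t = 2 := by rw [h.F2', h'.F2', hA]
    by_cases ht : ii φ t = 2
    · rw [ht, h2.1 ht]
    · have ht' : ii φ' t ≠ 2 := fun h => ht (h2.2 h)
      by_cases hd : DD φ t
      · rw [ii_of φ ht hd, ii_of φ' ht' ((key t).2.1 hd)]
      · rw [ii_of' φ ht hd, ii_of' φ' ht' (fun h => hd ((key t).2.2 h))]
  apply Subtype.ext
  ext1 ⟨t, b⟩
  by_cases hb : b = 2
  · subst hb
    obtain ⟨x, hx0, hx1⟩ : ∃ x : Fin 3, x ≠ oo φ t ∧ x ≠ ii φ t := by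
      generalize oo φ t = a; generalize ii φ t = b; revert a b; decide
    rw [val2 φ t x hx0 hx1, val2 φ' t x (hoo t ▸ hx0) (hii t ▸ hx1), (key t).1]
  · rcases fin3_cases b hb with rfl | rfl
    · rw [val0, val0, hoo, (key t).1]
    · rw [val1, val1, hii, (key t).1]

end Adm
end adm

end modA5

section modA6
theorem card_lab_equiv {α β ι : Type*} [Finite α] [Finite β] [Fintype ι] (f : α → ι)
    (f' : β → ι) :
    Nat.card {e : α ≃ β // ∀ a, f' (e a) = f a} ≤ ∏ i, (Nat.card {a // f a = i}).factorial := by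
  classical
  have := Fintype.ofFinite α
  rcases isEmpty_or_nonempty {e : α ≃ β // ∀ a, f' (e a) = f a} with h | ⟨⟨e0, h0⟩⟩
  · simp
  · have h1 := DomMulAct.stabilizer_card f
    simp only [← Nat.card_eq_fintype_card] at h1
    rw [← h1]
    refine Nat.card_le_card_of_injective (fun e => ⟨e.1.trans e0.symm, ?_⟩) ?_
    · funext a
      have := h0 (e0.symm (e.1 a))
      simp at this
      simp [← this, e.2]
    · intro e e' h
      have h2 := congrArg Subtype.val h
      simp only at h2
      apply Subtype.ext
      ext a
      have h3 := congrArg (fun s : Equiv.Perm α => e0 (s a)) h2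
      simpa using h3

section
variable {c k : ℕ}

/-- multiplicities of the lengths -/
noncomputable def mult (A : Set (Tm c k)) : Fin (k + 1) →₀ ℕ :=
  Finsupp.equivFunOnFinite.symm (fun i => Nat.card {v : A // lab A v.1 = i.1})

theorem mult_apply (A : Set (Tm c k)) (i : Fin (k + 1)) :
    mult A i = Nat.card {v : A // lab A v.1 = i.1} := rfl

/-- bundled equivalence from an injection -/
theorem exists_equiv_of_inj {α β : Type*} [Finite α] [Finite β] (f : α → β)
    (hf : Function.Injective f) (h : Nat.card α = Nat.card β) : ∃ e : α ≃ β, ∀ a, e a = f a :=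
  ⟨Equiv.ofBijective f ((Nat.bijective_iff_injective_and_card f).2 ⟨hf, h⟩), fun _ => rfl⟩

variable [NeZero k]

theorem Fib.symm_symm {T V : Type*} (φ : Fib T V) : φ.symm.symm = φ := rfl

theorem AA_card_le {g : Tm c k × Fin 3 → Tm c k × Fin 3} {φ : Fib (Tm c k) (Tm c k)}
    (h : Adm g φ) : Nat.card (AA φ) ≤ Nat.card (AA φ.symm) :=
  Nat.card_le_card_of_injective (fun t => (⟨PP φ t.1, (h.PP_spec t.2).1⟩ : AA φ.symm))
    (fun t t' e => Subtype.ext (h.PP_inj t.2 t'.2 (congrArg Subtype.val e)))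

theorem UU_card_le {g : Tm c k × Fin 3 → Tm c k × Fin 3} {φ : Fib (Tm c k) (Tm c k)}
    (h : Adm g φ) : Nat.card (UU (AA φ)) ≤ Nat.card (UU (AA φ.symm)) :=
  Nat.card_le_card_of_injective (fun r => (⟨(φ.ps (r.1, 0)).1, h.row_U r.2⟩ : UU (AA φ.symm)))
    (fun t t' e => Subtype.ext (h.row_inj t.2 t'.2 (congrArg Subtype.val e)))

theorem Adm.AA_card {g : Tm c k × Fin 3 → Tm c k × Fin 3} {φ : Fib (Tm c k) (Tm c k)}
    (h : Adm g φ) : Nat.card (AA φ) = Nat.card (AA φ.symm) :=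
  le_antisymm (AA_card_le h) (AA_card_le h.symm)

theorem Adm.UU_card {g : Tm c k × Fin 3 → Tm c k × Fin 3} {φ : Fib (Tm c k) (Tm c k)}
    (h : Adm g φ) : Nat.card (UU (AA φ)) = Nat.card (UU (AA φ.symm)) :=
  le_antisymm (UU_card_le h) (UU_card_le h.symm)

theorem Adm.equivA {g : Tm c k × Fin 3 → Tm c k × Fin 3} {φ : Fib (Tm c k) (Tm c k)}
    (h : Adm g φ) : ∃ e : AA φ ≃ AA φ.symm, ∀ a, (e a).1 = PP φ a.1 := by
  obtain ⟨e, he⟩ := exists_equiv_of_inj (fun t : AA φ => (⟨PP φ t.1, (h.PP_spec t.2).1⟩ : AA φ.symm))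
    (fun t t' e => Subtype.ext (h.PP_inj t.2 t'.2 (congrArg Subtype.val e))) h.AA_card
  exact ⟨e, fun a => by rw [he a]⟩

theorem Adm.equivU {g : Tm c k × Fin 3 → Tm c k × Fin 3} {φ : Fib (Tm c k) (Tm c k)}
    (h : Adm g φ) : ∃ e : UU (AA φ) ≃ UU (AA φ.symm), ∀ r, (e r).1 = (φ.ps (r.1, 0)).1 := by
  obtain ⟨e, he⟩ := exists_equiv_of_inj
    (fun r : UU (AA φ) => (⟨(φ.ps (r.1, 0)).1, h.row_U r.2⟩ : UU (AA φ.symm)))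
    (fun t t' e => Subtype.ext (h.row_inj t.2 t'.2 (congrArg Subtype.val e))) h.UU_card
  exact ⟨e, fun a => by rw [he a]⟩

theorem Adm.mult_eq {g : Tm c k × Fin 3 → Tm c k × Fin 3} {φ : Fib (Tm c k) (Tm c k)}
    (h : Adm g φ) : mult (AA φ) = mult (AA φ.symm) := by
  obtain ⟨e, he⟩ := h.equivA
  ext i
  rw [mult_apply, mult_apply]
  refine Nat.card_congr (e.subtypeEquiv fun a => ?_)
  rw [he, (h.PP_spec a.2).2]

theorem count_phi (A1 A2 : Set (Tm c k)) :
    Nat.card {φ : Fib (Tm c k) (Tm c k) // (∃ g, Adm g φ) ∧ AA φ = A2 ∧ AA φ.symm = A1} ≤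
      (∏ i, (mult A2 i).factorial) * 2 ^ (Nat.card A2) *
        ((Nat.card (UU A2)).factorial * (2 * k) ^ (Nat.card (UU A2))) := by
  classical
  let f1 : A1 → Fin (k + 1) := fun v => ⟨min (lab A1 v.1) k, by omega⟩
  let f2 : A2 → Fin (k + 1) := fun v => ⟨min (lab A2 v.1) k, by omega⟩
  have hf1 : ∀ v i, f1 v = i ↔ lab A1 v.1 = i.1 := by
    intro v i
    have := (lab_spec v.2).2.1
    simp only [f1, Fin.ext_iff]
    omega
  have hf2 : ∀ v i, f2 v = i ↔ lab A2 v.1 = i.1 := by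
    intro v i
    have := (lab_spec v.2).2.1
    simp only [f2, Fin.ext_iff]
    omega
  have c1 := card_lab_equiv f2 f1
  have c1' : ∏ i, (Nat.card {a // f2 a = i}).factorial = ∏ i, (mult A2 i).factorial := by
    refine Finset.prod_congr rfl fun i _ => ?_
    rw [mult_apply]
    congr 1
    exact Nat.card_congr (Equiv.subtypeEquivRight fun v => hf2 v i)
  rw [c1'] at c1
  have c2 : Nat.card (UU A2 ≃ UU A1) ≤ (Nat.card (UU A2)).factorial := by
    rcases isEmpty_or_nonempty (UU A2 ≃ UU A1) with h | ⟨⟨e0⟩⟩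
    · simp
    · rw [Nat.card_eq_fintype_card, Fintype.card_equiv e0, Nat.card_eq_fintype_card]
  have c3 : Nat.card (A2 → Prop) = 2 ^ (Nat.card A2) := by
    rw [Nat.card_fun]; simp
  have c4 : Nat.card (UU A2 → ZMod k × Prop) = (2 * k) ^ (Nat.card (UU A2)) := by
    rw [Nat.card_fun]; simp [mul_comm]
  have key : Nat.card {φ : Fib (Tm c k) (Tm c k) // (∃ g, Adm g φ) ∧ AA φ = A2 ∧ AA φ.symm = A1}
      ≤ Nat.card (({e : A2 ≃ A1 // ∀ a, f1 (e a) = f2 a} × (A2 → Prop)) ×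
        ((UU A2 ≃ UU A1) × (UU A2 → ZMod k × Prop))) := by
    have hex : ∀ φ : {φ : Fib (Tm c k) (Tm c k) // (∃ g, Adm g φ) ∧ AA φ = A2 ∧ AA φ.symm = A1},
        ∃ y : ({e : A2 ≃ A1 // ∀ a, f1 (e a) = f2 a} × (A2 → Prop)) ×
        ((UU A2 ≃ UU A1) × (UU A2 → ZMod k × Prop)),
        (∀ a, (y.1.1.1 a).1 = PP φ.1 a.1) ∧ (∀ a, y.1.2 a = DD φ.1 a.1) ∧
        (∀ r, (y.2.1 r).1 = (φ.1.ps (r.1, 0)).1) ∧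
        (∀ r, y.2.2 r = ((φ.1.ps (r.1, 0)).2, DD φ.1 (r.1, 0))) := by
      rintro ⟨φ, ⟨g, h⟩, rfl, rfl⟩
      obtain ⟨e, he⟩ := h.equivA
      obtain ⟨e', he'⟩ := h.equivU
      refine ⟨((⟨e, fun a => ?_⟩, fun a => DD φ a.1), (e', fun r => ((φ.ps (r.1, 0)).2,
        DD φ (r.1, 0)))), he, fun a => rfl, he', fun r => rfl⟩
      rw [hf1, he, (h.PP_spec a.2).2, ← hf2]
    choose y hy using hex
    refine Nat.card_le_card_of_injective y ?_
    rintro ⟨φ, ⟨g, h⟩, h2, h3⟩ ⟨φ', ⟨g', h'⟩, h2', h3'⟩ hyy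
    obtain ⟨a1, a2, a3, a4⟩ := hy ⟨φ, ⟨g, h⟩, h2, h3⟩
    obtain ⟨b1, b2, b3, b4⟩ := hy ⟨φ', ⟨g', h'⟩, h2', h3'⟩
    rw [hyy] at a1 a2 a3 a4
    apply Subtype.ext
    refine h.determined h' (h2.trans h2'.symm) ?_ ?_ ?_
    · intro t ht
      exact (a1 ⟨t, h2 ▸ ht⟩).symm.trans (b1 ⟨t, h2 ▸ ht⟩)
    · intro t ht
      exact iff_of_eq ((a2 ⟨t, h2 ▸ ht⟩).symm.trans (b2 ⟨t, h2 ▸ ht⟩))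
    · intro r hr
      have e1 := (a3 ⟨r, h2 ▸ hr⟩).symm.trans (b3 ⟨r, h2 ▸ hr⟩)
      have e2 := (a4 ⟨r, h2 ▸ hr⟩).symm.trans (b4 ⟨r, h2 ▸ hr⟩)
      exact ⟨Prod.ext e1 (congrArg Prod.fst e2), iff_of_eq (congrArg Prod.snd e2)⟩
  refine key.trans ?_
  rw [Nat.card_prod, Nat.card_prod, Nat.card_prod, c3, c4]
  gcongr

theorem count_g (N : ℕ) (hN : c * k = 2 * N) (φ : Fib (Tm c k) (Tm c k)) :
    Nat.card {f : FPF (Tm c k × Fin 3) // (∀ t, f.1 (t, 0) = (sc t, 1)) ∧ CRel f.1 φ} ≤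
      df (N - Nat.card (AA φ)) := by
  classical
  by_cases hex : ∃ f : FPF (Tm c k × Fin 3), (∀ t, f.1 (t, 0) = (sc t, 1)) ∧ CRel f.1 φ
  swap
  · have : IsEmpty {f : FPF (Tm c k × Fin 3) // (∀ t, f.1 (t, 0) = (sc t, 1)) ∧ CRel f.1 φ} :=
      ⟨fun f => hex ⟨f.1, f.2⟩⟩
    rw [Nat.card_of_isEmpty]; exact Nat.zero_le _
  obtain ⟨f0, h0, h0'⟩ := hex
  have hadm : Adm f0.1 φ := ⟨f0.2.1, h0, h0'⟩
  -- work with the involutive ones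
  have step : Nat.card {f : FPF (Tm c k × Fin 3) // (∀ t, f.1 (t, 0) = (sc t, 1)) ∧ CRel f.1 φ} =
      Nat.card {f : FPF (Tm c k × Fin 3) // Adm f.1 φ} :=
    Nat.card_congr (Equiv.subtypeEquivRight fun f =>
      ⟨fun h => ⟨f.2.1, h.1, h.2⟩, fun h => ⟨h.std, h.rel⟩⟩)
  rw [step]
  refine fpf_ext_card_le {x | x.2 ≠ 2 ∨ (φ.1.symm x).2 ≠ 2} (fun f => Adm f φ) _ ?_ ?_ ?_
  · intro f g hf hg x hx
    rcases hx with hx | hx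
    · obtain ⟨t, b⟩ := x
      rcases fin3_cases b hx with rfl | rfl
      · rw [hf.std, hg.std]
      · rw [hf.std1, hg.std1]
    · have hx' : ∀ f, Adm f φ → f x = φ.1 (φ.1.symm (f (φ.1 (φ.1.symm x)))) := by
        intro f _; simp
      rw [hx' f hf, hx' g hg]
      generalize φ.1.symm x = y at hx
      obtain ⟨t, b⟩ := y
      have e1 := hf.symm; have e2 := hg.symm
      rcases fin3_cases b hx with rfl | rfl
      · rw [e1.std, e2.std]
      · rw [e1.std1, e2.std1]
  · intro f hf x hx
    rcases hx with hx | hx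
    · exact Or.inl (fun h => hx ((hf.g_lab x).1 h))
    · refine Or.inr (fun h => hx ?_)
      have := hf.f_lab (φ.1.symm x)
      simp only [Equiv.apply_symm_apply] at this
      exact this.1 h
  · have hAc : Nat.card (AA φ) + Nat.card {t | ii φ t = 2} = Nat.card ↥({t | oo φ t = 2 ∨ ii φ t = 2}) := by
      rw [Nat.card_coe_set_eq, Nat.card_coe_set_eq, Nat.card_coe_set_eq]
      rw [← Set.ncard_union_eq]
      · rfl
      · rw [Set.disjoint_left]
        intro t h1 h2
        exact oo_ne_ii φ t ((show oo φ t = 2 from h1).trans (show ii φ t = 2 from h2).symm)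
    have hI : Nat.card {t | ii φ t = 2} = Nat.card (AA φ) :=
      Nat.card_congr ⟨fun t => ⟨pd t.1, (hadm.F2' t.1).1 t.2⟩,
        fun t => ⟨sc t.1, (hadm.F2 t.1).1 t.2⟩, fun t => by simp, fun t => by simp⟩
    have hcompl : Nat.card ↥({t | oo φ t = 2 ∨ ii φ t = 2}) +
        Nat.card ↥({t | oo φ t = 2 ∨ ii φ t = 2}ᶜ) = 2 * N := by
      rw [← hN, ← Tm_card, Nat.card_coe_set_eq, Nat.card_coe_set_eq, Set.ncard_add_ncard_compl]
    have hfin : Nat.card ↥({x : Tm c k × Fin 3 | x.2 ≠ 2 ∨ (φ.1.symm x).2 ≠ 2}ᶜ) =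
        Nat.card ↥({t | oo φ t = 2 ∨ ii φ t = 2}ᶜ) := by
      symm
      have h22 : ∀ t, t ∈ ({t | oo φ t = 2 ∨ ii φ t = 2}ᶜ : Set _) → φ.1 (t, 2) = (φ.ps t, 2) := by
        intro t ht
        simp only [Set.mem_compl_iff, Set.mem_ofPred_eq, not_or] at ht
        exact val2 φ t 2 (Ne.symm ht.1) (Ne.symm ht.2)
      refine Nat.card_congr (Equiv.ofBijective (fun t => ⟨φ.1 (t.1, 2), ?_⟩) ⟨?_, ?_⟩)
      · simp only [Set.mem_compl_iff, Set.mem_ofPred_eq, not_or, not_not]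
        rw [h22 _ t.2]
        exact ⟨rfl, by rw [← h22 _ t.2]; simp⟩
      · intro t t' h
        have := φ.1.injective (congrArg Subtype.val h)
        exact Subtype.ext (congrArg Prod.fst this)
      · rintro ⟨x, hx⟩
        simp only [Set.mem_compl_iff, Set.mem_ofPred_eq, not_or, not_not] at hx
        obtain ⟨h1, h2⟩ := hx
        have e : x = φ.1 ((φ.1.symm x).1, 2) := by
          rw [← h2]; simp
        refine ⟨⟨(φ.1.symm x).1, ?_⟩, Subtype.ext e.symm⟩
        simp only [Set.mem_compl_iff, Set.mem_ofPred_eq, not_or]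
        generalize (φ.1.symm x).1 = t at e
        rw [e] at h1
        constructor
        · intro h3
          have : φ.1 (t, 0) = φ.1 (t, 2) := Prod.ext ((φ.fst t 0).trans (φ.fst t 2).symm)
            ((show (φ.1 (t, 0)).2 = 2 from h3).trans h1.symm)
          simpa using φ.1.injective this
        · intro h3
          have : φ.1 (t, 1) = φ.1 (t, 2) := Prod.ext ((φ.fst t 1).trans (φ.fst t 2).symm)
            ((show (φ.1 (t, 1)).2 = 2 from h3).trans h1.symm)
          simpa using φ.1.injective this
    rw [hfin]
    omega

/-- good sets -/
def Gd (A : Set (Tm c k)) : Prop := ∀ v ∈ A, 2 ≤ lab A v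

/-- weights -/
noncomputable def VV (k N u : ℕ) (m : Fin (k + 1) →₀ ℕ) : ℕ :=
  (∏ i, (m i).factorial) * 2 ^ m.degree * (u.factorial * (2 * k) ^ u) * df (N - m.degree)

theorem mult_degree (A : Set (Tm c k)) : (mult A).degree = Nat.card A := by
  classical
  rw [Finsupp.degree_eq_sum]
  simp only [mult_apply]
  rw [← Nat.card_sigma]
  refine Nat.card_congr ⟨fun x => x.2.1, fun v => ⟨⟨lab A v.1, by
    have := (lab_spec v.2).2.1; omega⟩, ⟨v, rfl⟩⟩, ?_, ?_⟩
  · rintro ⟨⟨i, hi⟩, v, hv⟩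
    simp only at hv
    subst hv; rfl
  · intro v; rfl

open Classical in
theorem Z_le (N : ℕ) (hN : c * k = 2 * N) :
    Nat.card (Zset c k) ≤ ∑ A1 : Set (Tm c k), ∑ A2 : Set (Tm c k),
      if (Gd A1 ∧ Gd A2 ∧ (Nat.card (UU A1), mult A1) = (Nat.card (UU A2), mult A2)) then
        VV k N (Nat.card (UU A2)) (mult A2) else 0 := by
  classical
  have := Fintype.ofFinite (Fib (Tm c k) (Tm c k))
  have h1 : Nat.card (Zset c k) = ∑ φ : Fib (Tm c k) (Tm c k),
      Nat.card {f : FPF (Tm c k × Fin 3) // (∀ t, f.1 (t, 0) = (sc t, 1)) ∧ CRel f.1 φ} := by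
    rw [← Nat.card_sigma]
    exact Nat.card_congr ⟨fun x => ⟨x.1.2, ⟨x.1.1, x.2⟩⟩, fun x => ⟨(x.2.1, x.1), x.2.2⟩,
      fun x => rfl, fun x => rfl⟩
  have h2 : Nat.card (Zset c k) ≤ ∑ φ : Fib (Tm c k) (Tm c k),
      if ∃ g, Adm g φ then df (N - Nat.card (AA φ)) else 0 := by
    rw [h1]
    refine Finset.sum_le_sum fun φ _ => ?_
    split_ifs with h
    · exact count_g N hN φ
    · have : IsEmpty {f : FPF (Tm c k × Fin 3) // (∀ t, f.1 (t, 0) = (sc t, 1)) ∧ CRel f.1 φ} :=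
        ⟨fun f => h ⟨f.1.1, f.1.2.1, f.2.1, f.2.2⟩⟩
      rw [Nat.card_of_isEmpty]
  refine h2.trans ?_
  rw [← Finset.sum_fiberwise (s := Finset.univ) (g := fun φ => AA φ.symm)]
  refine Finset.sum_le_sum fun A1 _ => ?_
  rw [← Finset.sum_fiberwise (s := Finset.filter _ _) (g := fun φ => AA φ)]
  refine Finset.sum_le_sum fun A2 _ => ?_
  rw [← Finset.sum_filter, Finset.filter_filter, Finset.filter_filter]
  by_cases hne : ∃ φ : Fib (Tm c k) (Tm c k), (∃ g, Adm g φ) ∧ AA φ = A2 ∧ AA φ.symm = A1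
  swap
  · rw [Finset.sum_eq_zero]
    · exact Nat.zero_le _
    · intro φ hφ
      simp only [Finset.mem_filter, Finset.mem_univ, true_and] at hφ
      exact absurd ⟨φ, hφ.2.2, hφ.2.1, hφ.1⟩ hne
  rw [if_pos]
  · have h3 : ∀ φ ∈ Finset.univ.filter (fun φ : Fib (Tm c k) (Tm c k) =>
        AA φ.symm = A1 ∧ AA φ = A2 ∧ ∃ g, Adm g φ), df (N - Nat.card (AA φ)) =
          df (N - Nat.card A2) := by
      intro φ hφ
      simp only [Finset.mem_filter, Finset.mem_univ, true_and] at hφ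
      rw [hφ.2.1]
    rw [Finset.sum_congr rfl h3, Finset.sum_const, smul_eq_mul, VV, mult_degree]
    refine Nat.mul_le_mul_right _ ?_
    refine le_trans (le_of_eq ?_) (count_phi A1 A2)
    rw [Nat.card_eq_fintype_card, Fintype.card_subtype]
    congr 1
    ext φ
    simp only [Finset.mem_filter, Finset.mem_univ, true_and]
    tauto
  · obtain ⟨φ, ⟨g, h⟩, rfl, rfl⟩ := hne
    exact ⟨fun v hv => h.symm.lab_ge hv, fun v hv => h.lab_ge hv,
      Prod.ext h.UU_card.symm h.mult_eq.symm⟩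

end

end modA6

section modA7
section walks
variable {R : Type*} [CommSemiring R] (x : ℕ → R)

/-- transfer matrix powers -/
def Mx : ℕ → ℕ → ℕ → R
  | 0, d, e => if d = e then 1 else 0
  | j + 1, d, e => x (d + 1) * Mx j 0 e + Mx j (d + 1) e

def hh (j : ℕ) : R := Mx x j 0 0

def pp (k : ℕ) : R := ∑ d ∈ Finset.range k, Mx x k d d

theorem Mx_shift (j d e : ℕ) : Mx x (j + 1) d (e + 1) = Mx x j d e := by
  induction j generalizing d with
  | zero => simp [Mx]
  | succ j ih => rw [Mx, ih, ih]; rfl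

theorem Mx_shift' (j d e i : ℕ) : Mx x (j + i) d (e + i) = Mx x j d e := by
  induction i with
  | zero => rfl
  | succ i ih => rw [← add_assoc, ← add_assoc, Mx_shift, ih]

theorem Mx_hit (j d : ℕ) :
    Mx x (j + 1) d 0 = ∑ i ∈ Finset.range (j + 1), x (d + 1 + i) * hh x (j - i) := by
  induction j generalizing d with
  | zero => simp [Mx, hh]
  | succ j ih =>
    have h1 : ∀ i ∈ Finset.range (j + 1), x (d + 1 + 1 + i) * hh x (j - i) =
        x (d + 1 + (i + 1)) * hh x (j + 1 - (i + 1)) := fun i _ => by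
      rw [show d + 1 + 1 + i = d + 1 + (i + 1) by ring, Nat.add_sub_add_right]
    rw [Finset.sum_range_succ', Mx, ih (d + 1), add_comm, Finset.sum_congr rfl h1]
    rfl

theorem hh_zero : hh x 0 = 1 := by simp [hh, Mx]

theorem hh_succ (j : ℕ) :
    hh x (j + 1) = ∑ i ∈ Finset.range (j + 1), x (i + 1) * hh x (j - i) := by
  rw [hh, Mx_hit]
  simp [add_comm]

theorem pp_eq (k : ℕ) :
    pp x k = ∑ l ∈ Finset.range k, ((l + 1 : ℕ) : R) * (x (l + 1) * hh x (k - 1 - l)) := by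
  have h1 : ∀ d ∈ Finset.range k, Mx x k d d =
      ∑ l ∈ Finset.range k, if d ≤ l then x (l + 1) * hh x (k - 1 - l) else 0 := by
    intro d hd
    rw [Finset.mem_range] at hd
    obtain ⟨j, rfl⟩ : ∃ j, k = j + 1 + d := ⟨k - 1 - d, by omega⟩
    have := Mx_shift' x (j + 1) d 0 d
    rw [zero_add] at this
    rw [this, Mx_hit, ← Finset.sum_filter]
    refine Finset.sum_bij' (fun i _ => d + i) (fun l _ => l - d) ?_ ?_ ?_ ?_ ?_
    · intro i hi; simp at hi ⊢; omega
    · intro i hi; simp at hi ⊢; omega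
    · intro i hi; simp
    · intro i hi; simp at hi ⊢; omega
    · intro i hi
      rw [show d + i + 1 = d + 1 + i by ring, show j + 1 + d - 1 - (d + i) = j - i by omega]
  rw [pp, Finset.sum_congr rfl h1, Finset.sum_comm]
  refine Finset.sum_congr rfl fun l hl => ?_
  rw [← Finset.sum_filter, Finset.sum_const, nsmul_eq_mul]
  congr 2
  rw [← Finset.card_range (l + 1)]
  congr 1
  ext d
  simp at hl ⊢
  omega

theorem Mx_map {S : Type*} [CommSemiring S] (f : R →+* S) (j d e : ℕ) :
    f (Mx x j d e) = Mx (fun i => f (x i)) j d e := by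
  induction j generalizing d with
  | zero => simp only [Mx]; split_ifs <;> simp
  | succ j ih => simp [Mx, ih]

theorem hh_map {S : Type*} [CommSemiring S] (f : R →+* S) (j : ℕ) :
    f (hh x j) = hh (fun i => f (x i)) j := Mx_map x f j 0 0

theorem pp_map {S : Type*} [CommSemiring S] (f : R →+* S) (j : ℕ) :
    f (pp x j) = pp (fun i => f (x i)) j := by
  simp [pp, Mx_map]

open Classical in
noncomputable def WE : (j : ℕ) → ℕ → ℕ → (Fin j → Prop) → R
  | 0, d, e, _ => if d = e then 1 else 0
  | j + 1, d, e, b => if b 0 then x (d + 1) * WE j 0 e (Fin.tail b) else WE j (d + 1) e (Fin.tail b)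

theorem sum_WE (j d e : ℕ) : ∑ b : Fin j → Prop, WE x j d e b = Mx x j d e := by
  classical
  induction j generalizing d with
  | zero => simp [WE, Mx]
  | succ j ih =>
    rw [← (Fin.consEquiv (fun _ : Fin (j + 1) => Prop)).sum_comp, Fintype.sum_prod_type,
      Fintype.sum_Prop]
    simp only [Fin.consEquiv, Equiv.coe_fn_mk, WE, Fin.cons_zero, Fin.tail_cons, if_true, if_false]
    rw [← Finset.mul_sum, ih, ih]; rfl

open Classical in
theorem WE_eq (j : ℕ) (b : Fin j → Prop) (b' : ℕ → Prop) (hb : ∀ i : Fin j, b i ↔ b' i)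
    (α : ℕ → ℕ) (hα : ∀ i, i < j → α (i + 1) = if b' i then 0 else α i + 1) (e : ℕ) :
    WE x j (α 0) e b = if α j = e then
      ∏ i ∈ Finset.range j, (if b' i then x (α i + 1) else 1) else 0 := by
  induction j generalizing b' α with
  | zero => simp [WE]
  | succ j ih =>
    have h0 := hα 0 (by omega)
    have hb0 := hb 0
    have := ih (Fin.tail b) (fun i => b' (i + 1)) (fun i => by
      have := hb i.succ; simpa [Fin.tail] using this) (fun i => α (i + 1))
      (fun i hi => hα (i + 1) (by omega))
    simp only [zero_add] at this
    simp only [Fin.val_zero] at hb0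
    rw [Finset.prod_range_succ']
    by_cases h : b' 0
    · rw [if_pos h] at h0
      rw [WE, if_pos (hb0.2 h), if_pos h]
      rw [h0] at this
      rw [this]
      split_ifs <;> simp [mul_comm]
    · rw [if_neg h] at h0
      rw [WE, if_neg (fun h' => h (hb0.1 h')), if_neg h]
      rw [zero_add] at h0
      rw [← h0, this]
      simp

end walks

section cyc
variable {k : ℕ}

noncomputable def labZ (B : Set (ZMod k)) (j : ZMod k) : ℕ := sInf {l : ℕ | 1 ≤ l ∧ j - (l : ZMod k) ∈ B}

theorem labZ_spec [NeZero k] {B : Set (ZMod k)} (hB : B.Nonempty) (j : ZMod k) :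
    1 ≤ labZ B j ∧ labZ B j ≤ k ∧ j - (labZ B j : ZMod k) ∈ B ∧
      ∀ i, 1 ≤ i → i < labZ B j → j - (i : ZMod k) ∉ B := by
  obtain ⟨b, hb⟩ := hB
  have hm : ∃ l, l ≤ k ∧ l ∈ {l : ℕ | 1 ≤ l ∧ j - (l : ZMod k) ∈ B} := by
    by_cases h : (j - b).val = 0
    · refine ⟨k, le_rfl, NeZero.pos k, ?_⟩
      rw [ZMod.val_eq_zero, sub_eq_zero] at h
      simpa [h] using hb
    · exact ⟨(j - b).val, (ZMod.val_lt _).le, Nat.pos_of_ne_zero h, by simpa using hb⟩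
  obtain ⟨l, hl, hm⟩ := hm
  have h := Nat.sInf_mem ⟨l, hm⟩
  refine ⟨h.1, (Nat.sInf_le hm).trans hl, h.2, fun i h1 h2 h3 => ?_⟩
  exact absurd (Nat.sInf_le (show i ∈ {l : ℕ | 1 ≤ l ∧ j - (l : ZMod k) ∈ B} from ⟨h1, h3⟩))
    (not_le.2 h2)

theorem labZ_eq {B : Set (ZMod k)} {j : ZMod k} {l : ℕ} (h1 : 1 ≤ l) (h2 : j - (l : ZMod k) ∈ B)
    (h3 : ∀ i, 1 ≤ i → i < l → j - (i : ZMod k) ∉ B) : labZ B j = l := by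
  have hm : l ∈ {l : ℕ | 1 ≤ l ∧ j - (l : ZMod k) ∈ B} := ⟨h1, h2⟩
  apply le_antisymm (Nat.sInf_le hm)
  by_contra h
  have := Nat.sInf_mem ⟨l, hm⟩
  exact h3 _ this.1 (not_le.1 h) this.2

open Classical in
theorem labZ_succ [NeZero k] {B : Set (ZMod k)} (hB : B.Nonempty) (j : ZMod k) :
    labZ B (j + 1) = if j ∈ B then 1 else labZ B j + 1 := by
  split_ifs with h
  · exact labZ_eq le_rfl (by simpa using h) (fun i h1 h2 => by omega)
  · obtain ⟨h1, -, h3, h4⟩ := labZ_spec hB j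
    refine labZ_eq (by omega) ?_ ?_
    · push_cast; convert h3 using 1; ring
    · intro i hi1 hi2
      obtain ⟨i, rfl⟩ : ∃ i', i = i' + 1 := ⟨i - 1, by omega⟩
      rcases Nat.eq_zero_or_pos i with rfl | hp
      · simpa using h
      · have := h4 i hp (by omega)
        intro h5; apply this; push_cast at h5; convert h5 using 1; ring

variable {R : Type*} [CommSemiring R] (x : ℕ → R)

/-- weight of a row -/
noncomputable def wtZ (B : Set (ZMod k)) : R := by
  classical exact ∏ j : Fin k, if ((j.1 : ZMod k)) ∈ B then x (labZ B (j.1 : ZMod k)) else 1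

open Classical in
theorem wt_eq [NeZero k] (B : Set (ZMod k)) :
    ∑ d ∈ Finset.range k, WE x k d d (fun i : Fin k => ((i.1 : ZMod k)) ∈ B) =
      if B.Nonempty then wtZ x B else 0 := by
  -- general ages
  obtain ⟨age, age0, ages⟩ : ∃ age : ℕ → ℕ → ℕ, (∀ d, age d 0 = d) ∧
      ∀ d i, age d (i + 1) = if ((i : ℕ) : ZMod k) ∈ B then 0 else age d i + 1 :=
    ⟨fun d i => Nat.rec d (fun i a => if ((i : ℕ) : ZMod k) ∈ B then 0 else a + 1) i,
      fun d => rfl, fun d i => rfl⟩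
  have hW : ∀ d, WE x k d d (fun i : Fin k => ((i.1 : ZMod k)) ∈ B) = if age d k = d then
      ∏ i ∈ Finset.range k, (if ((i : ℕ) : ZMod k) ∈ B then x (age d i + 1) else 1) else 0 := by
    intro d
    have := WE_eq x k (fun i : Fin k => ((i.1 : ZMod k)) ∈ B) (fun i => ((i : ℕ) : ZMod k) ∈ B)
      (fun i => Iff.rfl) (age d) (fun i _ => ages d i) d
    rw [age0] at this
    exact this
  split_ifs with hB
  · -- nonempty
    have hl : ∀ i, age (labZ B 0 - 1) i = labZ B ((i : ℕ) : ZMod k) - 1 := by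
      intro i
      induction i with
      | zero => simp [age0]
      | succ i ih =>
        rw [ages, ih]
        push_cast
        rw [labZ_succ hB]
        have := (labZ_spec hB ((i : ℕ) : ZMod k)).1
        split_ifs <;> omega
    have hmerge : ∀ d i, (∃ j < i, ((j : ℕ) : ZMod k) ∈ B) → age d i = age (labZ B 0 - 1) i := by
      intro d i
      induction i with
      | zero => rintro ⟨j, hj, -⟩; omega
      | succ i ih =>
        rintro ⟨j, hj, hjB⟩
        rw [ages, ages]
        split_ifs with h
        · rfl
        · have : j ≠ i := fun e => h (e ▸ hjB)
          rw [ih ⟨j, by omega, hjB⟩]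
    have hd0 := labZ_spec hB 0
    have hk : age (labZ B 0 - 1) k = labZ B 0 - 1 := by rw [hl]; simp
    rw [Finset.sum_eq_single (labZ B 0 - 1)]
    · rw [hW, if_pos hk, wtZ, ← Fin.prod_univ_eq_prod_range
        (fun i => if ((i : ℕ) : ZMod k) ∈ B then x (age (labZ B 0 - 1) i + 1) else 1)]
      refine Finset.prod_congr rfl fun i _ => ?_
      rw [hl, Nat.sub_add_cancel (labZ_spec hB _).1]
    · intro d _ hd
      rw [hW, if_neg]
      rw [hmerge d k, hk]
      · exact fun h => hd h.symm
      · obtain ⟨b, hb⟩ := hB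
        exact ⟨b.val, ZMod.val_lt b, by simpa using hb⟩
    · intro h; simp at h; omega
  · refine Finset.sum_eq_zero fun d _ => ?_
    rw [hW, if_neg]
    have hB' : B = ∅ := Set.not_nonempty_iff_eq_empty.1 hB
    have : ∀ i, age d i = d + i := by
      intro i
      induction i with
      | zero => rw [age0]; rfl
      | succ i ih => rw [ages, ih]; simp [hB']; ring
    rw [this]
    have := NeZero.pos k
    omega

open Classical in
theorem sum_wt [NeZero k] (t : R) :
    ∑ B : Set (ZMod k), (if B.Nonempty then wtZ x B else t) = t + pp x k := by
  have h1 : ∑ B : Set (ZMod k), (if B.Nonempty then wtZ x B else 0) = pp x k := by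
    simp only [← wt_eq]
    rw [Finset.sum_comm, pp]
    refine Finset.sum_congr rfl fun d _ => ?_
    rw [← sum_WE]
    have hbij : Function.Bijective (fun B : Set (ZMod k) => fun i : Fin k => ((i.1 : ZMod k)) ∈ B) := by
      constructor
      · intro B B' h
        ext b
        have := congrFun h ⟨b.val, ZMod.val_lt b⟩
        simpa using this
      · intro f
        refine ⟨{b | f ⟨b.val, ZMod.val_lt b⟩}, ?_⟩
        funext i
        simp [ZMod.val_natCast, Nat.mod_eq_of_lt i.2]
    exact Fintype.sum_bijective _ hbij _ _ (fun B => rfl)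
  have h2 : ∀ B : Set (ZMod k), (if B.Nonempty then wtZ x B else t) =
      (if B.Nonempty then wtZ x B else 0) + (if B = ∅ then t else 0) := by
    intro B
    rcases B.eq_empty_or_nonempty with rfl | h
    · simp
    · simp [h, h.ne_empty]
  simp only [h2]
  rw [Finset.sum_add_distrib, h1, add_comm]
  congr 1
  simp

end cyc

end modA7

section modA8
/-- generic variables -/
noncomputable def xs (k l : ℕ) : MvPolynomial (Fin (k + 1)) ℕ :=
  if h : 2 ≤ l ∧ l ≤ k then MvPolynomial.X ⟨l, by omega⟩ else 0

section
variable {c k : ℕ} [NeZero k]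

open Classical in
theorem mono_eq (A : Set (Tm c k)) :
    ∏ v : Tm c k, (if v ∈ A then xs k (lab A v) else 1) =
      if Gd A then MvPolynomial.monomial (mult A) 1 else 0 := by
  split_ifs with h
  · rw [Finset.prod_ite, Finset.prod_const_one, mul_one]
    have h1 : ∀ v ∈ Finset.univ.filter (fun v => v ∈ A), xs k (lab A v) =
        MvPolynomial.X (⟨min (lab A v) k, by omega⟩ : Fin (k + 1)) := by
      intro v hv
      simp only [Finset.mem_filter, Finset.mem_univ, true_and] at hv
      have h2 := (lab_spec hv).2.1
      rw [xs, dif_pos ⟨h v hv, h2⟩]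
      congr 1
      exact Fin.ext (min_eq_left h2).symm
    rw [Finset.prod_congr rfl h1]
    rw [MvPolynomial.monomial_eq, Finsupp.prod_fintype _ _ (fun i => pow_zero _)]
    rw [← Finset.prod_fiberwise (s := Finset.univ.filter (fun v => v ∈ A))
      (g := fun v => (⟨min (lab A v) k, by omega⟩ : Fin (k + 1)))]
    rw [map_one, one_mul]
    refine Finset.prod_congr rfl fun i _ => ?_
    rw [Finset.prod_congr rfl (g := fun _ => MvPolynomial.X i), Finset.prod_const]
    · congr 1
      rw [mult_apply, Finset.filter_filter, ← Fintype.card_subtype, ← Nat.card_eq_fintype_card]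
      refine Nat.card_congr ⟨fun v => ⟨⟨v.1, v.2.1⟩, ?_⟩, fun v => ⟨v.1.1, v.1.2, ?_⟩, fun v => rfl,
        fun v => rfl⟩
      · have := congrArg Fin.val v.2.2
        have := (lab_spec v.2.1).2.1
        simp only at *
        omega
      · have := v.2
        have := (lab_spec v.1.2).2.1
        apply Fin.ext; simp only; omega
    · intro v hv
      simp only [Finset.mem_filter] at hv
      rw [hv.2]
  · simp only [Gd, not_forall, not_le] at h
    obtain ⟨v, hv, h2⟩ := h
    refine Finset.prod_eq_zero (Finset.mem_univ v) ?_
    rw [if_pos hv, xs, dif_neg (by omega)]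

theorem lab_labZ (A : Set (Tm c k)) (r : Fin c) (j : ZMod k) :
    lab A (r, j) = labZ {j | (r, j) ∈ A} j := rfl

open Classical in
theorem wtZ_eq {R : Type*} [CommSemiring R] (x : ℕ → R) (B : Set (ZMod k)) :
    wtZ x B = ∏ j : ZMod k, if j ∈ B then x (labZ B j) else 1 := by
  rw [wtZ]
  have hbij : Function.Bijective (fun i : Fin k => (i.1 : ZMod k)) := by
    constructor
    · intro i i' h
      have := congrArg ZMod.val h
      simp only [ZMod.val_natCast, Nat.mod_eq_of_lt i.2, Nat.mod_eq_of_lt i'.2] at this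
      exact Fin.ext this
    · intro b; exact ⟨⟨b.val, ZMod.val_lt b⟩, by simp⟩
  exact Fintype.prod_bijective _ hbij _ _ (fun i => rfl)

open Classical Polynomial in
theorem gen_eq : ∑ A : Set (Tm c k), (X : (MvPolynomial (Fin (k + 1)) ℕ)[X]) ^ (Nat.card (UU A)) *
      C (if Gd A then MvPolynomial.monomial (mult A) 1 else 0) = (X + C (pp (xs k) k)) ^ c := by
  have h1 : ∀ A : Set (Tm c k), (X : (MvPolynomial (Fin (k + 1)) ℕ)[X]) ^ (Nat.card (UU A)) *
      C (if Gd A then MvPolynomial.monomial (mult A) 1 else 0) =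
      ∏ r : Fin c, (fun B : Set (ZMod k) => if B.Nonempty then wtZ (fun i => C (xs k i)) B else X)
        {j | (r, j) ∈ A} := by
    intro A
    rw [← mono_eq, map_prod, Fintype.prod_prod_type, Nat.card_eq_fintype_card,
      Fintype.card_ofFinset, ← Finset.prod_const, Finset.prod_filter, ← Finset.prod_mul_distrib]
    refine Finset.prod_congr rfl fun r _ => ?_
    by_cases hr : {j | (r, j) ∈ A}.Nonempty
    · simp only [hr, if_true]
      rw [if_neg, one_mul, wtZ_eq]
      · refine Finset.prod_congr rfl fun j _ => ?_
        rw [lab_labZ]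
        by_cases h : (r, j) ∈ A
        · simp [h]
        · simp [h]
      · obtain ⟨j, hj⟩ := hr
        exact fun h => h j hj
    · simp only [hr, if_false]
      have hr' : ∀ j, (r, j) ∉ A := fun j hj => hr ⟨j, hj⟩
      rw [if_pos (show r ∈ UU A from hr'), Finset.prod_eq_one, mul_one]
      intro j _
      simp [hr' j]
  rw [Finset.sum_congr rfl (fun A _ => h1 A)]
  have h2 := sum_wt (k := k) (fun i => (C (xs k i) : (MvPolynomial (Fin (k + 1)) ℕ)[X])) X
  rw [← pp_map] at h2
  rw [← h2, Fintype.sum_pow]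
  have hbij : Function.Bijective (fun A : Set (Tm c k) => fun r : Fin c => {j | (r, j) ∈ A}) := by
    constructor
    · intro A A' h
      ext ⟨r, j⟩
      have := congrFun h r
      exact Set.ext_iff.1 this j
    · intro f
      exact ⟨{v | v.2 ∈ f v.1}, rfl⟩
  exact Fintype.sum_bijective _ hbij _ _ (fun A => rfl)

open Classical in
theorem count_key (u : ℕ) (m : Fin (k + 1) →₀ ℕ) :
    (Finset.univ.filter (fun A : Set (Tm c k) => Gd A ∧ (Nat.card (UU A), mult A) = (u, m))).card =
      c.choose u * MvPolynomial.coeff m (pp (xs k) k ^ (c - u)) := by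
  have h := congrArg (fun P => MvPolynomial.coeff m (Polynomial.coeff P u)) (gen_eq (c := c) (k := k))
  rw [Polynomial.coeff_X_add_C_pow, Polynomial.finsetSum_coeff, MvPolynomial.coeff_sum] at h
  rw [mul_comm (pp (xs k) k ^ (c - u)), ← map_natCast (MvPolynomial.C), MvPolynomial.coeff_C_mul] at h
  simp only [Nat.cast_id] at h
  rw [← h, Finset.card_filter]
  refine Finset.sum_congr rfl fun A _ => ?_
  rw [mul_comm, Polynomial.coeff_C_mul_X_pow]
  simp only [Prod.mk.injEq]
  by_cases h1 : Gd A
  · simp only [h1, true_and, if_true]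
    by_cases h2 : Nat.card (UU A) = u
    · simp only [h2, true_and, if_true, MvPolynomial.coeff_monomial]
    · rw [if_neg (fun h => h2 h.1), if_neg (fun h => h2 h.symm)]; simp
  · simp [h1]

/-- main combinatorial bound -/
theorem Z_le_I (N : ℕ) (hN : c * k = 2 * N) :
    Nat.card (Zset c k) ≤ ∑ u ∈ Finset.range (c + 1),
      ∑ m ∈ (pp (xs k) k ^ (c - u)).support,
        (c.choose u * MvPolynomial.coeff m (pp (xs k) k ^ (c - u))) ^ 2 * VV k N u m := by
  classical
  refine (Z_le N hN).trans ?_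
  rw [Finset.sum_comm]
  have h1 : ∀ A2 : Set (Tm c k), (∑ A1 : Set (Tm c k),
      if (Gd A1 ∧ Gd A2 ∧ (Nat.card (UU A1), mult A1) = (Nat.card (UU A2), mult A2)) then
        VV k N (Nat.card (UU A2)) (mult A2) else 0) = if Gd A2 then
        (fun κ : ℕ × (Fin (k + 1) →₀ ℕ) =>
          c.choose κ.1 * MvPolynomial.coeff κ.2 (pp (xs k) k ^ (c - κ.1)) * VV k N κ.1 κ.2)
          (Nat.card (UU A2), mult A2) else 0 := by
    intro A2
    by_cases h : Gd A2
    · simp only [h, true_and, if_true]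
      rw [← count_key, ← Finset.sum_filter, Finset.sum_const, smul_eq_mul]
    · simp [h]
  rw [Finset.sum_congr rfl (fun A2 _ => h1 A2), ← Finset.sum_filter,
    Finset.sum_comp (fun κ : ℕ × (Fin (k + 1) →₀ ℕ) =>
      c.choose κ.1 * MvPolynomial.coeff κ.2 (pp (xs k) k ^ (c - κ.1)) * VV k N κ.1 κ.2)
      (fun A2 : Set (Tm c k) => (Nat.card (UU A2), mult A2))]
  set S := (Finset.range (c + 1)).biUnion (fun u => (pp (xs k) k ^ (c - u)).support) with hS
  have h2 : ∀ κ : ℕ × (Fin (k + 1) →₀ ℕ),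
      ((Finset.univ.filter (fun A : Set (Tm c k) => Gd A)).filter
        (fun A => (Nat.card (UU A), mult A) = κ)).card =
      c.choose κ.1 * MvPolynomial.coeff κ.2 (pp (xs k) k ^ (c - κ.1)) := by
    intro κ
    rw [← count_key, Finset.filter_filter]
  calc _ ≤ ∑ κ ∈ Finset.range (c + 1) ×ˢ S,
        (c.choose κ.1 * MvPolynomial.coeff κ.2 (pp (xs k) k ^ (c - κ.1))) ^ 2 * VV k N κ.1 κ.2 := by
        simp only [h2, smul_eq_mul, ← mul_assoc, ← sq]
        refine Finset.sum_le_sum_of_ne_zero ?_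
        intro κ hκ hne
        have h3 : c.choose κ.1 * MvPolynomial.coeff κ.2 (pp (xs k) k ^ (c - κ.1)) ≠ 0 := by
          intro h; rw [h] at hne; simp at hne
        have h4 : κ.1 < c + 1 := by
          by_contra h5
          rw [Nat.choose_eq_zero_of_lt (by omega)] at h3
          simp at h3
        rw [Finset.mem_product]
        refine ⟨Finset.mem_range.2 h4, ?_⟩
        rw [hS, Finset.mem_biUnion]
        exact ⟨κ.1, Finset.mem_range.2 h4, MvPolynomial.mem_support_iff.2 (right_ne_zero_of_mul h3)⟩
    _ = _ := by
        rw [Finset.sum_product]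
        refine Finset.sum_congr rfl fun u hu => ?_
        symm
        refine Finset.sum_subset ?_ ?_
        · exact Finset.subset_biUnion_of_mem (fun u => (pp (xs k) k ^ (c - u)).support) hu
        · intro m _ hm
          rw [MvPolynomial.notMem_support_iff] at hm
          simp [hm]

end

end modA8

section modE1
section
open MvPolynomial
variable {k : ℕ}

/-- product of factorials -/
def pf (m : Fin (k + 1) →₀ ℕ) : ℕ := ∏ i, (m i).factorial

/-- value at a length -/
def mval (m : Fin (k + 1) →₀ ℕ) (l : ℕ) : ℕ := if h : 2 ≤ l ∧ l ≤ k then m ⟨l, by omega⟩ else 0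

theorem sum_mval_le (m : Fin (k + 1) →₀ ℕ) (f : ℕ → ℕ) (j : ℕ) :
    ∑ i ∈ Finset.range j, f (i + 1) * mval m (i + 1) ≤ ∑ i, f i.1 * m i := by
  have h1 : ∑ i ∈ Finset.range j, f (i + 1) * mval m (i + 1) ≤
      ∑ l ∈ Finset.range (k + 1), f l * (if h : l < k + 1 then m ⟨l, h⟩ else 0) := by
    rw [← Finset.sum_image (f := fun l => f l * mval m l) (g := fun i => i + 1)
      (fun a _ b _ h => by simpa using h)]
    calc _ ≤ ∑ l ∈ (Finset.range j).image (fun i => i + 1),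
          f l * (if h : l < k + 1 then m ⟨l, h⟩ else 0) := by
          refine Finset.sum_le_sum fun l _ => ?_
          refine Nat.mul_le_mul_left _ ?_
          unfold mval
          split_ifs <;> omega
      _ ≤ _ := by
          refine Finset.sum_le_sum_of_ne_zero fun l _ h => ?_
          rw [Finset.mem_range]
          by_contra h'
          rw [dif_neg h'] at h
          simp at h
  refine h1.trans (le_of_eq ?_)
  rw [← Fin.sum_univ_eq_sum_range (fun l => f l * (if h : l < k + 1 then m ⟨l, h⟩ else 0))]
  refine Finset.sum_congr rfl fun i _ => by rw [dif_pos i.2]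

theorem coeff_xs_mul (l : ℕ) (Q : MvPolynomial (Fin (k + 1)) ℕ) (m : Fin (k + 1) →₀ ℕ) (b w : ℕ)
    (hb : ∀ m', m'.degree + 1 = m.degree → (∑ i, i.1 * m' i) + l = ∑ i, i.1 * m i →
      coeff m' Q * pf m' ≤ b) :
    coeff m (xs k l * Q) * pf m ≤ mval m l * b := by
  classical
  unfold xs mval
  split_ifs with h
  · rw [coeff_X_mul']
    split_ifs with hm
    · set s : Fin (k + 1) := ⟨l, by omega⟩ with hs
      have hpos : 1 ≤ m s := Nat.one_le_iff_ne_zero.2 (Finsupp.mem_support_iff.1 hm)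
      have hle : Finsupp.single s 1 ≤ m := by
        rw [Finsupp.single_le_iff]; exact hpos
      obtain ⟨m', rfl⟩ := exists_add_of_le hle
      have e1 : Finsupp.single s 1 + m' - Finsupp.single s 1 = m' := by simp
      rw [e1]
      have hpf : pf (Finsupp.single s 1 + m') = (m' s + 1) * pf m' := by
        unfold pf
        rw [← Finset.mul_prod_erase _ _ (Finset.mem_univ s),
          ← Finset.mul_prod_erase _ (fun i => (m' i).factorial) (Finset.mem_univ s)]
        have : ∀ i ∈ Finset.univ.erase s, ((Finsupp.single s 1 + m' : Fin (k + 1) →₀ ℕ) i).factorial =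
            (m' i).factorial := by
          intro i hi
          have : i ≠ s := (Finset.mem_erase.1 hi).1
          simp [Finsupp.single_apply, this.symm]
        rw [Finset.prod_congr rfl this]
        simp only [Finsupp.add_apply, Finsupp.single_eq_same]
        rw [add_comm 1, Nat.factorial_succ]; ring
      have hmm : (Finsupp.single s 1 + m' : Fin (k + 1) →₀ ℕ) s = m' s + 1 := by simp [add_comm]
      rw [hpf, hmm]
      have := hb m' (by simp [add_comm, map_add]) (by
        simp only [Finsupp.add_apply, mul_add, Finset.sum_add_distrib]
        rw [add_comm]
        congr 1
        rw [Finset.sum_eq_single s]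
        · simp [hs]
        · intro i _ hi; simp [Finsupp.single_apply, hi.symm]
        · simp)
      calc _ = (m' s + 1) * (coeff m' Q * pf m') := by ring
        _ ≤ _ := Nat.mul_le_mul_left _ this
    · simp
  · simp

/-- good polynomials -/
def GP (Q : MvPolynomial (Fin (k + 1)) ℕ) : Prop := ∀ m, coeff m Q * pf m ≤ m.degree.factorial

theorem GP_one : GP (1 : MvPolynomial (Fin (k + 1)) ℕ) := by
  intro m
  rw [coeff_one]
  split_ifs with h
  · subst h; simp [pf]
  · simp

theorem GP_hh (j : ℕ) (Q : MvPolynomial (Fin (k + 1)) ℕ) (hQ : GP Q) : GP (hh (xs k) j * Q) := by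
  induction j using Nat.strong_induction_on with
  | _ j ih =>
    rcases j with _ | j
    · rw [hh_zero, one_mul]; exact hQ
    · intro m
      rw [hh_succ, Finset.sum_mul, coeff_sum, Finset.sum_mul]
      rcases Nat.eq_zero_or_pos m.degree with h0 | hpos
      · have : ∑ i ∈ Finset.range (j + 1), coeff m (xs k (i + 1) * hh (xs k) (j - i) * Q) * pf m ≤
            ∑ i ∈ Finset.range (j + 1), 0 := by
          refine Finset.sum_le_sum fun i _ => ?_
          rw [mul_assoc]
          exact (coeff_xs_mul _ _ m 0 0 (fun m' h => by omega)).trans (by simp)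
        refine this.trans ?_
        simp
      · have : ∑ i ∈ Finset.range (j + 1), coeff m (xs k (i + 1) * hh (xs k) (j - i) * Q) * pf m ≤
            ∑ i ∈ Finset.range (j + 1), 1 * mval m (i + 1) * (m.degree - 1).factorial := by
          refine Finset.sum_le_sum fun i _ => ?_
          rw [mul_assoc, one_mul]
          refine coeff_xs_mul _ _ m _ 0 (fun m' h _ => ?_)
          rw [show m.degree - 1 = m'.degree by omega]
          exact ih (j - i) (by omega) m'
        refine this.trans ?_
        rw [← Finset.sum_mul, ← Nat.mul_factorial_pred hpos.ne']
        refine Nat.mul_le_mul_right _ ?_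
        refine (sum_mval_le m (fun _ => 1) (j + 1)).trans ?_
        rw [Finsupp.degree_eq_sum]; simp

theorem GP_pow (j c : ℕ) : GP (hh (xs k) j ^ c) := by
  induction c with
  | zero => rw [pow_zero]; exact GP_one
  | succ c ih => rw [pow_succ']; exact GP_hh _ _ ih

theorem GP_h (j : ℕ) : GP (hh (xs k) j) := by
  have := GP_pow (k := k) j 1
  rwa [pow_one] at this

/-- coefficientwise order -/
def CLe {σ : Type*} (P Q : MvPolynomial σ ℕ) : Prop := ∀ m, coeff m P ≤ coeff m Q

theorem CLe.mul {σ : Type*} {P Q P' Q' : MvPolynomial σ ℕ} (h : CLe P Q) (h' : CLe P' Q') :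
    CLe (P * P') (Q * Q') := by
  classical
  intro m
  rw [coeff_mul, coeff_mul]
  exact Finset.sum_le_sum fun x _ => Nat.mul_le_mul (h _) (h' _)

theorem CLe.pow {σ : Type*} {P Q : MvPolynomial σ ℕ} (h : CLe P Q) (c : ℕ) :
    CLe (P ^ c) (Q ^ c) := by
  induction c with
  | zero => intro m; simp
  | succ c ih => rw [pow_succ, pow_succ]; exact ih.mul h

theorem pp_CLe (j : ℕ) : CLe (pp (xs k) j) (C j * hh (xs k) j) := by
  intro m
  rcases j with _ | j
  · simp [pp]
  rw [pp_eq, hh_succ, coeff_C_mul, coeff_sum, coeff_sum, Finset.mul_sum]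
  refine Finset.sum_le_sum fun i hi => ?_
  rw [← map_natCast (C : ℕ →+* MvPolynomial (Fin (k + 1)) ℕ), coeff_C_mul]
  simp only [Nat.cast_id, Nat.add_sub_cancel]
  rw [Finset.mem_range] at hi
  exact Nat.mul_le_mul_right _ (by omega)

/-- bound for powers of `p` -/
theorem coeff_pp_pow (j c : ℕ) (m : Fin (k + 1) →₀ ℕ) :
    coeff m (pp (xs k) j ^ c) * pf m ≤ j ^ c * m.degree.factorial := by
  have h1 := (pp_CLe (k := k) j).pow c m
  rw [mul_pow, ← map_pow, coeff_C_mul] at h1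
  calc _ ≤ j ^ c * coeff m (hh (xs k) j ^ c) * pf m := Nat.mul_le_mul_right _ h1
    _ = j ^ c * (coeff m (hh (xs k) j ^ c) * pf m) := by ring
    _ ≤ _ := Nat.mul_le_mul_left _ (GP_pow j c m)

theorem xs_wh (l : ℕ) : IsWeightedHomogeneous (fun i : Fin (k + 1) => i.1) (xs k l) l := by
  unfold xs
  split_ifs with h
  · exact isWeightedHomogeneous_X ℕ _ _
  · exact isWeightedHomogeneous_zero _ _ _

theorem hh_wh (j : ℕ) : IsWeightedHomogeneous (fun i : Fin (k + 1) => i.1) (hh (xs k) j) j := by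
  induction j using Nat.strong_induction_on with
  | _ j ih =>
    rcases j with _ | j
    · rw [hh_zero]; exact isWeightedHomogeneous_one _ _
    · rw [hh_succ]
      refine IsWeightedHomogeneous.sum _ _ _ fun i hi => ?_
      rw [Finset.mem_range] at hi
      have := (xs_wh (k := k) (i + 1)).mul (ih (j - i) (by omega))
      rwa [show i + 1 + (j - i) = j + 1 by omega] at this

theorem pp_wh (j : ℕ) : IsWeightedHomogeneous (fun i : Fin (k + 1) => i.1) (pp (xs k) j) j := by
  rw [pp_eq]
  refine IsWeightedHomogeneous.sum _ _ _ fun i hi => ?_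
  rw [Finset.mem_range] at hi
  have := ((xs_wh (k := k) (i + 1)).mul (hh_wh (j - 1 - i)))
  rw [show i + 1 + (j - 1 - i) = j by omega] at this
  have h2 := (isWeightedHomogeneous_C (R := ℕ) (fun i : Fin (k + 1) => i.1) (i + 1)).mul this
  rw [zero_add] at h2
  rw [← map_natCast (C : ℕ →+* MvPolynomial (Fin (k + 1)) ℕ)]
  exact h2

theorem weight_eq (m : Fin (k + 1) →₀ ℕ) :
    Finsupp.weight (fun i : Fin (k + 1) => i.1) m = ∑ i, i.1 * m i := by
  rw [Finsupp.weight_apply, Finsupp.sum_fintype _ _ (fun i => by simp)]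
  simp [mul_comm]

theorem coeff_pp (j : ℕ) (m : Fin (k + 1) →₀ ℕ) :
    coeff m (pp (xs k) j) * pf m ≤ j * (m.degree - 1).factorial := by
  by_cases h0 : coeff m (pp (xs k) j) = 0
  · simp [h0]
  have hw := pp_wh j h0
  rw [weight_eq] at hw
  rw [pp_eq, coeff_sum, Finset.sum_mul]
  have : ∀ i ∈ Finset.range j, coeff m (((i + 1 : ℕ) : MvPolynomial (Fin (k + 1)) ℕ) *
      (xs k (i + 1) * hh (xs k) (j - 1 - i))) * pf m ≤
        (i + 1) * mval m (i + 1) * (m.degree - 1).factorial := by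
    intro i _
    rw [← map_natCast (C : ℕ →+* MvPolynomial (Fin (k + 1)) ℕ), coeff_C_mul]
    simp only [Nat.cast_id]
    rw [mul_assoc, mul_assoc]
    refine Nat.mul_le_mul_left _ ?_
    refine coeff_xs_mul _ _ m _ 0 (fun m' h _ => ?_)
    rw [show m.degree - 1 = m'.degree by omega]
    exact GP_h _ m'
  refine (Finset.sum_le_sum this).trans ?_
  rw [← Finset.sum_mul]
  refine Nat.mul_le_mul_right _ ?_
  have := sum_mval_le m (fun l => l) j
  rw [hw] at this
  exact this

end

end modE1

section modE2
section
open Polynomial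

/-- all lengths at least two -/
noncomputable def yl (l : ℕ) : ℕ[X] := if 2 ≤ l then X else 0

theorem yl_add (l : ℕ) : yl (l + 2) = X := by simp [yl]
theorem yl_one : yl 1 = 0 := by simp [yl]

theorem hy_one : hh yl 1 = 0 := by
  rw [hh_succ]; simp [yl_one]

theorem hy_succ (j : ℕ) : hh yl (j + 2) = X * ∑ i ∈ Finset.range (j + 1), hh yl i := by
  rw [hh_succ, Finset.sum_range_succ', yl_one, zero_mul, add_zero, Finset.mul_sum,
    ← Finset.sum_range_reflect]
  refine Finset.sum_congr rfl fun i hi => ?_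
  rw [Finset.mem_range] at hi
  rw [add_assoc, yl_add]
  congr 2
  omega

theorem hy_rec (j : ℕ) : hh yl (j + 2) = hh yl (j + 1) + X * hh yl j := by
  rcases j with _ | j
  · rw [hy_succ, zero_add, hy_one]; simp
  · rw [hy_succ, Finset.sum_range_succ, mul_add, ← hy_succ]

theorem py_rec (n : ℕ) : pp yl (n + 2) = pp yl (n + 1) + hh yl (n + 2) + X * hh yl n := by
  have h1 : ∀ n, pp yl (n + 1) = X * ∑ l ∈ Finset.range n, ((l + 2 : ℕ) : ℕ[X]) * hh yl (n - 1 - l) := by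
    intro n
    rw [pp_eq, Finset.sum_range_succ']
    simp only [zero_add, yl_one, zero_mul, mul_zero, add_zero]
    rw [Finset.mul_sum]
    refine Finset.sum_congr rfl fun i _ => ?_
    rw [add_assoc, yl_add, show n + 1 - 1 - (i + 1) = n - 1 - i by omega]
    ring
  rw [h1, h1, hy_succ, Finset.sum_range_succ', ← Finset.sum_range_reflect (fun i => hh yl i),
    Finset.sum_range_succ', ← mul_add, ← mul_add]
  congr 1
  simp only [Nat.add_sub_cancel, Nat.sub_zero]
  have : ∀ i ∈ Finset.range n, ((i + 1 + 2 : ℕ) : ℕ[X]) * hh yl (n - (i + 1)) =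
    ((i + 2 : ℕ) : ℕ[X]) * hh yl (n - 1 - i) + hh yl (n - (i + 1)) := by
    intro i _
    rw [show n - 1 - i = n - (i + 1) by omega]
    push_cast; ring
  rw [Finset.sum_congr rfl this, Finset.sum_add_distrib]
  push_cast; ring

theorem hy_zero (j : ℕ) : ∀ a, j < 2 * a → (hh yl j).coeff a = 0 := by
  induction j using Nat.strong_induction_on with
  | _ j ih =>
    intro a ha
    match j, ih, ha with
    | 0, _, ha => rw [hh_zero, coeff_one, if_neg (by omega)]
    | 1, _, ha => rw [hy_one, coeff_zero]
    | j + 2, ih, ha =>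
      obtain ⟨a, rfl⟩ : ∃ a', a = a' + 1 := ⟨a - 1, by omega⟩
      rw [hy_rec, coeff_add, coeff_X_mul, ih (j + 1) (by omega) _ (by omega),
        ih j (by omega) _ (by omega)]

theorem hy_coeff0 (j : ℕ) : (hh yl (j + 1)).coeff 0 = 0 := by
  induction j with
  | zero => rw [zero_add, hy_one, coeff_zero]
  | succ j ih => rw [hy_rec, coeff_add, ih]; simp

theorem hy_coeff (j : ℕ) : ∀ a r, j = 2 * a + 2 + r →
    (hh yl j).coeff (a + 1) = (a + r).choose r := by
  induction j using Nat.strong_induction_on with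
  | _ j ih =>
    intro a r h
    subst h
    rw [show 2 * a + 2 + r = (2 * a + r) + 2 by ring, hy_rec, coeff_add, coeff_X_mul]
    have h1 : (hh yl (2 * a + r + 1)).coeff (a + 1) = if r = 0 then 0 else
        (a + (r - 1)).choose (r - 1) := by
      split_ifs with h
      · exact hy_zero _ _ (by omega)
      · exact ih _ (by omega) a (r - 1) (by omega)
    rw [h1]
    rcases a with _ | a
    · rcases r with _ | r
      · simp [hh_zero]
      · rw [show 2 * 0 + (r + 1) = r + 1 by ring, hy_coeff0]; simp
    · rw [ih (2 * (a + 1) + r) (by omega) a r (by ring)]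
      rcases r with _ | r
      · simp
      · rw [if_neg (by omega), Nat.add_sub_cancel, show a + 1 + (r + 1) = (a + 1 + r) + 1 by ring,
          Nat.choose_succ_succ, show a + 1 + r = a + (r + 1) by ring]

theorem py_zero (j : ℕ) : ∀ a, j < 2 * a → (pp yl j).coeff a = 0 := by
  induction j with
  | zero => intro a _; rw [pp_eq]; simp
  | succ j ih =>
    intro a ha
    rcases j with _ | j
    · rw [pp_eq]; simp [yl_one]
    · obtain ⟨a, rfl⟩ : ∃ a', a = a' + 1 := ⟨a - 1, by omega⟩
      rw [py_rec, coeff_add, coeff_add, coeff_X_mul, ih _ (by omega), hy_zero _ _ (by omega),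
        hy_zero _ _ (by omega)]

theorem py_coeff (a r : ℕ) : (pp yl (2 * a + 2 + r)).coeff (a + 1) =
    (a + 1 + r).choose r + (a + r).choose r := by
  induction r with
  | zero =>
    rw [show 2 * a + 2 + 0 = (2 * a) + 2 by ring, py_rec, coeff_add, coeff_add, coeff_X_mul,
      py_zero _ _ (by omega), hy_coeff _ a 0 (by ring)]
    rcases a with _ | a
    · simp [hh_zero]
    · rw [hy_coeff _ a 0 (by ring)]; simp
  | succ r ih =>
    rw [show 2 * a + 2 + (r + 1) = (2 * a + r + 1) + 2 by ring, py_rec, coeff_add, coeff_add, coeff_X_mul,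
      show 2 * a + r + 1 + 1 = 2 * a + 2 + r by ring, ih, hy_coeff _ a (r + 1) (by ring)]
    rcases a with _ | a
    · rw [show 2 * 0 + r + 1 = r + 1 by ring, hy_coeff0]; simp
      rw [show 1 + (r + 1) = (r + 1) + 1 by ring, Nat.choose_succ_self_right,
        show 1 + r = r + 1 by ring, Nat.choose_succ_self_right]
    · rw [hy_coeff _ a (r + 1) (by ring)]
      rw [show a + 1 + 1 + (r + 1) = (a + 1 + (r + 1)) + 1 by ring,
        Nat.choose_succ_succ, show a + 1 + (r + 1) = (a + (r + 1)) + 1 by ring,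
        Nat.choose_succ_succ (a + (r + 1)) r, show a + 1 + 1 + r = a + (r + 1) + 1 by ring,
        show a + 1 + r = a + (r + 1) by ring, Nat.succ_eq_add_one]
      ring

/-- coefficientwise order -/
def PLe (P Q : ℕ[X]) : Prop := ∀ a, P.coeff a ≤ Q.coeff a

theorem PLe.mul {P Q P' Q' : ℕ[X]} (h : PLe P Q) (h' : PLe P' Q') :
    PLe (P * P') (Q * Q') := by
  intro m
  rw [coeff_mul, coeff_mul]
  exact Finset.sum_le_sum fun x _ => Nat.mul_le_mul (h _) (h' _)

theorem PLe.sum {ι : Type*} (s : Finset ι) {P Q : ι → ℕ[X]} (h : ∀ i ∈ s, PLe (P i) (Q i)) :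
    PLe (∑ i ∈ s, P i) (∑ i ∈ s, Q i) := by
  intro m
  rw [finsetSum_coeff, finsetSum_coeff]
  exact Finset.sum_le_sum fun x hx => h x hx _

theorem PLe_hh {x y : ℕ → ℕ[X]} (h : ∀ l, PLe (x l) (y l)) (j : ℕ) : PLe (hh x j) (hh y j) := by
  induction j using Nat.strong_induction_on with
  | _ j ih =>
    rcases j with _ | j
    · rw [hh_zero, hh_zero]; exact fun _ => le_rfl
    · rw [hh_succ, hh_succ]
      exact PLe.sum _ fun i hi => (h _).mul (ih _ (by have := Finset.mem_range.1 hi; omega))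

theorem PLe_pp {x y : ℕ → ℕ[X]} (h : ∀ l, PLe (x l) (y l)) (j : ℕ) : PLe (pp x j) (pp y j) := by
  rw [pp_eq, pp_eq]
  exact PLe.sum _ fun i _ => PLe.mul (fun _ => le_rfl) ((h _).mul (PLe_hh h _))

/-- degree counting map -/
noncomputable def dgm (k : ℕ) : MvPolynomial (Fin (k + 1)) ℕ →+* ℕ[X] :=
  (MvPolynomial.aeval (fun _ => (X : ℕ[X]))).toRingHom

theorem dgm_apply (k : ℕ) (P : MvPolynomial (Fin (k + 1)) ℕ) :
    dgm k P = ∑ m ∈ P.support, C (P.coeff m) * X ^ m.degree := by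
  change MvPolynomial.aeval (fun _ => (X : ℕ[X])) P = _
  rw [MvPolynomial.aeval_def, MvPolynomial.eval₂_eq]
  refine Finset.sum_congr rfl fun m _ => ?_
  rw [Finset.prod_pow_eq_pow_sum, Finsupp.degree_apply]
  rfl

theorem dgm_sum (k : ℕ) (P : MvPolynomial (Fin (k + 1)) ℕ) (f : ℕ → ℝ) (n : ℕ)
    (hn : ∀ m ∈ P.support, m.degree < n) :
    ∑ m ∈ P.support, ((P.coeff m : ℕ) : ℝ) * f m.degree =
      ∑ a ∈ Finset.range n, ((dgm k P).coeff a : ℝ) * f a := by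
  have : ∀ a, (dgm k P).coeff a = ∑ m ∈ P.support, if a = m.degree then P.coeff m else 0 := by
    intro a
    rw [dgm_apply, finsetSum_coeff]
    simp only [coeff_C_mul_X_pow]
  simp only [this]
  push_cast
  simp only [Finset.sum_mul]
  rw [Finset.sum_comm]
  refine Finset.sum_congr rfl fun m hm => ?_
  rw [Finset.sum_eq_single m.degree]
  · simp
  · intro b _ hb; simp [hb]
  · intro h; exact absurd (Finset.mem_range.2 (hn m hm)) h

theorem dgm_xs (k l : ℕ) : PLe (dgm k (xs k l)) (yl l) := by
  intro a
  unfold xs yl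
  split_ifs with h1 h2 h2
  · simp [dgm]
  · omega
  · simp
  · simp

theorem dgm_pp (k j : ℕ) : PLe (dgm k (pp (xs k) j)) (pp yl j) := by
  rw [pp_map]
  exact PLe_pp (dgm_xs k) j

end

end modE2

section modE3
section
open MvPolynomial

/-- the quadratic functional -/
noncomputable def QN {k : ℕ} (N : ℕ) (P : MvPolynomial (Fin (k + 1)) ℕ) : ℝ :=
  ∑ m ∈ P.support, ((coeff m P : ℕ) : ℝ) ^ 2 * (pf m : ℝ) * 2 ^ m.degree * (df (N - m.degree) : ℝ)

/-- the sum over `b` -/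
noncomputable def WN (N : ℕ) : ℝ :=
  ∑ b ∈ Finset.range N, ((b + N).choose N : ℝ) * (1 / 4) ^ b * ((N : ℝ) ^ 2 / (((N : ℝ) - b) * (N + b)))

theorem py_coeff0 (j : ℕ) : (pp yl j).coeff 0 = 0 := by
  rw [pp_eq, Polynomial.finsetSum_coeff]
  refine Finset.sum_eq_zero fun i _ => ?_
  have : (yl (i + 1)).coeff 0 = 0 := by
    unfold yl; split_ifs <;> simp
  rw [Polynomial.mul_coeff_zero, Polynomial.mul_coeff_zero, this]; simp

theorem coeff_le_dgm {k : ℕ} (P : MvPolynomial (Fin (k + 1)) ℕ) (m : Fin (k + 1) →₀ ℕ) :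
    coeff m P ≤ (dgm k P).coeff m.degree := by
  by_cases hm : m ∈ P.support
  · rw [dgm_apply, Polynomial.finsetSum_coeff]
    refine le_trans ?_ (Finset.single_le_sum (f := fun m' => (Polynomial.C (coeff m' P) * Polynomial.X ^ m'.degree).coeff m.degree) (fun i _ => Nat.zero_le _) hm)
    simp
  · rw [notMem_support_iff.1 hm]; exact Nat.zero_le _

theorem deg_pp {k : ℕ} (N : ℕ) (m : Fin (k + 1) →₀ ℕ) (hm : m ∈ (pp (xs k) (2 * N)).support) :
    m.degree < N + 1 := by
  by_contra h
  have h1 := (coeff_le_dgm _ m).trans (dgm_pp k (2 * N) m.degree)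
  rw [py_zero _ _ (by omega)] at h1
  exact (mem_support_iff.1 hm) (by omega)

theorem term_eq (s b : ℕ) :
    ((((s + 1 + 2 * b).choose (2 * b) + (s + 2 * b).choose (2 * b) : ℕ) : ℝ)) *
      (((2 * (s + 1 + b) : ℕ) : ℝ) * (s.factorial : ℝ) * 2 ^ (s + 1) * (df b : ℝ)) =
    4 * 2 ^ (s + 1 + b) * ((s + 1 + b).factorial : ℝ) *
      (((b + (s + 1 + b)).choose (s + 1 + b) : ℝ) * (1 / 4) ^ b *
      (((s + 1 + b : ℕ) : ℝ) ^ 2 / ((((s + 1 + b : ℕ) : ℝ) - b) * ((s + 1 + b : ℕ) + b)))) := by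
  have h1 : (((s + 1 + 2 * b).choose (2 * b) : ℕ) : ℝ) = (s + 1 + 2 * b).factorial /
      ((2 * b).factorial * (s + 1).factorial) := by
    rw [add_comm (s + 1), Nat.cast_add_choose]
  have h2 : (((s + 2 * b).choose (2 * b) : ℕ) : ℝ) = (s + 2 * b).factorial /
      ((2 * b).factorial * s.factorial) := by
    rw [add_comm s, Nat.cast_add_choose]
  have h3 : (((b + (s + 1 + b)).choose (s + 1 + b) : ℕ) : ℝ) = (s + 1 + 2 * b).factorial /
      ((s + 1 + b).factorial * b.factorial) := by
    rw [add_comm b, Nat.cast_add_choose, show s + 1 + b + b = s + 1 + 2 * b by ring]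
  have h4 : (df b : ℝ) = (2 * b).factorial / (2 ^ b * b.factorial) := by
    rw [eq_div_iff (by positivity)]
    exact_mod_cast df_mul b
  have h5 : (((s + 1 + 2 * b).factorial : ℕ) : ℝ) = (s + 1 + 2 * b) * (s + 2 * b).factorial := by
    rw [show s + 1 + 2 * b = (s + 2 * b) + 1 by ring, Nat.factorial_succ]; push_cast; ring
  have h6 : (((s + 1).factorial : ℕ) : ℝ) = (s + 1) * s.factorial := by
    rw [Nat.factorial_succ]; push_cast; ring
  rw [Nat.cast_add, h1, h2, h3, h4, h5, h6]
  have e4 : (4 : ℝ) ^ b = 2 ^ b * 2 ^ b := by rw [← mul_pow]; norm_num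
  rw [one_div, inv_pow, e4, pow_add 2 (s + 1) b]
  have p1 : ((s + 2 * b).factorial : ℝ) ≠ 0 := by positivity
  have p2 : ((s).factorial : ℝ) ≠ 0 := by positivity
  have p3 : ((2 * b).factorial : ℝ) ≠ 0 := by positivity
  have p4 : ((b).factorial : ℝ) ≠ 0 := by positivity
  have p5 : ((s + 1 + b).factorial : ℝ) ≠ 0 := by positivity
  have p6 : (s + 1 : ℝ) ≠ 0 := by positivity
  have p7 : (s + 1 + 2 * b : ℝ) ≠ 0 := by positivity
  push_cast
  rw [show (s : ℝ) + 1 + b - b = s + 1 by ring, show (s : ℝ) + 1 + b + b = s + 1 + 2 * b by ring]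
  field_simp
  ring

theorem H_le (k N : ℕ) : QN N (pp (xs k) (2 * N)) ≤ 4 * 2 ^ N * (N.factorial : ℝ) * WN N := by
  have h1 : QN N (pp (xs k) (2 * N)) ≤ ∑ m ∈ (pp (xs k) (2 * N)).support,
      ((coeff m (pp (xs k) (2 * N)) : ℕ) : ℝ) * (((2 * N : ℕ) : ℝ) * ((m.degree - 1).factorial : ℝ) * 2 ^ m.degree *
        (df (N - m.degree) : ℝ)) := by
    refine Finset.sum_le_sum fun m _ => ?_
    have := coeff_pp (k := k) (2 * N) m
    have h2 : ((coeff m (pp (xs k) (2 * N)) : ℕ) : ℝ) * (pf m : ℝ) ≤ ((2 * N : ℕ) : ℝ) * ((m.degree - 1).factorial : ℝ) := by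
      exact_mod_cast this
    calc _ = ((coeff m (pp (xs k) (2 * N)) : ℕ) : ℝ) * ((((coeff m (pp (xs k) (2 * N)) : ℕ) : ℝ) * (pf m : ℝ)) * 2 ^ m.degree * (df (N - m.degree) : ℝ)) := by ring
      _ ≤ _ := by gcongr
  refine h1.trans ?_
  rw [dgm_sum k _ (fun a => ((2 * N : ℕ) : ℝ) * ((a - 1).factorial : ℝ) * 2 ^ a *
        (df (N - a) : ℝ)) (N + 1) (deg_pp N)]
  calc _ ≤ ∑ a ∈ Finset.range (N + 1), ((pp yl (2 * N)).coeff a : ℝ) * (((2 * N : ℕ) : ℝ) * ((a - 1).factorial : ℝ) * 2 ^ a *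
        (df (N - a) : ℝ)) := by
        refine Finset.sum_le_sum fun a _ => ?_
        have : (((dgm k (pp (xs k) (2 * N))).coeff a : ℕ) : ℝ) ≤ ((pp yl (2 * N)).coeff a : ℝ) := by
          exact_mod_cast dgm_pp k (2 * N) a
        gcongr
    _ = _ := by
        rw [Finset.sum_range_succ', py_coeff0, Nat.cast_zero, zero_mul, add_zero,
          ← Finset.sum_range_reflect, WN, Finset.mul_sum]
        refine Finset.sum_congr rfl fun b hb => ?_
        rw [Finset.mem_range] at hb
        obtain ⟨s, rfl⟩ : ∃ s, N = s + 1 + b := ⟨N - 1 - b, by omega⟩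
        rw [show s + 1 + b - 1 - b = s by omega, show 2 * (s + 1 + b) = 2 * s + 2 + 2 * b by ring,
          py_coeff, show s + 1 + b - (s + 1) = b by omega, Nat.add_sub_cancel, ← term_eq,
          show 2 * (s + 1 + b) = 2 * s + 2 + 2 * b by ring]

end

end modE3

section modE4
section

theorem HasSum.congr_fn {f g : ℕ → ℝ} {a : ℝ} (h : HasSum f a) (e : ∀ b, g b = f b) : HasSum g a :=
  (funext e : g = f) ▸ h

theorem HasSum.congr_val {f : ℕ → ℝ} {a b : ℝ} (h : HasSum f a) (e : a = b) : HasSum f b := e ▸ h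

theorem ms0 (N : ℕ) : HasSum (fun b : ℕ => ((b + N).choose N : ℝ) * (1 / 4 : ℝ) ^ b) ((4 / 3 : ℝ) ^ (N + 1)) := by
  have := hasSum_choose_mul_geometric_of_norm_lt_one (𝕜 := ℝ) N (r := 1 / 4) (by norm_num)
  have h2 : (1 : ℝ) / (1 - 1 / 4) ^ (N + 1) = (4 / 3) ^ (N + 1) := by
    rw [one_div, ← inv_pow]; norm_num
  rw [h2] at this
  exact this

theorem ms1 (N : ℕ) : HasSum (fun b : ℕ => ((b : ℝ) + N + 1) * (((b + N).choose N : ℝ) * (1 / 4 : ℝ) ^ b))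
    (((N : ℝ) + 1) * (4 / 3 : ℝ) ^ (N + 2)) := by
  have h := (ms0 (N + 1)).mul_left ((N : ℝ) + 1)
  refine h.congr_fn fun b => ?_
  have := Nat.add_one_mul_choose_eq (b + N) N
  have h2 : ((b : ℝ) + N + 1) * ((b + N).choose N : ℝ) = ((b + (N + 1)).choose (N + 1) : ℝ) * ((N : ℝ) + 1) := by
    exact_mod_cast this
  rw [← mul_assoc ((b : ℝ) + N + 1), h2]; ring

theorem ms2 (N : ℕ) : HasSum (fun b : ℕ => ((b : ℝ) + N + 2) * (((b : ℝ) + N + 1) * (((b + N).choose N : ℝ) * (1 / 4 : ℝ) ^ b)))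
    (((N : ℝ) + 1) * ((N : ℝ) + 2) * (4 / 3) ^ (N + 3)) := by
  have h := (ms1 (N + 1)).mul_left ((N : ℝ) + 1)
  have h0 : ((N : ℝ) + 1) * (((N + 1 : ℕ) : ℝ) + 1) * (4 / 3) ^ (N + 1 + 2) = ((N : ℝ) + 1) * ((N : ℝ) + 2) * (4 / 3) ^ (N + 3) := by
    push_cast; ring
  rw [← mul_assoc, h0] at h
  refine h.congr_fn fun b => ?_
  · have := Nat.add_one_mul_choose_eq (b + N) N
    have h2 : ((b : ℝ) + N + 1) * ((b + N).choose N : ℝ) = ((b + (N + 1)).choose (N + 1) : ℝ) * ((N : ℝ) + 1) := by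
      exact_mod_cast this
    rw [← mul_assoc ((b : ℝ) + N + 1), h2]; push_cast; ring

theorem quad_ub (x : ℝ) (h0 : 0 ≤ x) (h1 : x ≤ 1 / 2) :
    1 / (1 - x ^ 2) ≤ 9 / 8 + 27 / 32 * (x - 1 / 3) + 4 * (x - 1 / 3) ^ 2 := by
  have : 0 < 1 - x ^ 2 := by nlinarith
  rw [div_le_iff₀ this]
  nlinarith [mul_nonneg h0 (sub_nonneg.2 h1), sq_nonneg (x - 1 / 3), mul_nonneg (sq_nonneg (x - 1 / 3)) h0,
    mul_nonneg (sq_nonneg (x - 1 / 3)) (sub_nonneg.2 h1), mul_nonneg (sq_nonneg (x - 1 / 3)) (mul_nonneg h0 (sub_nonneg.2 h1))]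

theorem WN_low (N : ℕ) (hN : 0 < N) :
    ∑ b ∈ (Finset.range N).filter (fun b : ℕ => 2 * b ≤ N), ((b + N).choose N : ℝ) * (1 / 4 : ℝ) ^ b *
      ((N : ℝ) ^ 2 / (((N : ℝ) - b) * (N + b))) ≤ (4 / 3 : ℝ) ^ (N + 1) * (9 / 8 + 5 / (N : ℝ)) := by
  have hN' : (0 : ℝ) < N := by exact_mod_cast hN
  have hN1 : (1 : ℝ) ≤ N := by exact_mod_cast hN
  set q : ℕ → ℝ := fun b => 9 / 8 + 27 / 32 * ((b : ℝ) / N - 1 / 3) + 4 * ((b : ℝ) / N - 1 / 3) ^ 2 with hq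
  have hs : HasSum (fun b : ℕ => ((b + N).choose N : ℝ) * (1 / 4) ^ b * q b)
      ((9 / 8 + 9 / (32 * (N : ℝ)) + 4 * (4 * ((N : ℝ) + 1) / 9 + 1 / 9) / (N : ℝ) ^ 2) * (4 / 3 : ℝ) ^ (N + 1)) := by
    have := (((ms2 N).mul_left (4 / (N : ℝ) ^ 2)).add ((ms1 N).mul_left
      (27 / 32 / (N : ℝ) - 4 / (N : ℝ) ^ 2 - 8 / (N : ℝ) * (4 / 3 + 1 / (N : ℝ))))).add ((ms0 N).mul_left
        (9 / 8 - 27 / 32 * (4 / 3 + 1 / (N : ℝ)) + 4 * (4 / 3 + 1 / (N : ℝ)) ^ 2))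
    refine HasSum.congr_val (HasSum.congr_fn this fun b => ?_) ?_
    · simp only [hq]
      field_simp
      ring
    · field_simp
      ring
  have hq0 : ∀ b, 0 ≤ q b := by
    intro b
    simp only [hq]
    nlinarith [sq_nonneg ((b : ℝ) / N - 1 / 3 + 27 / 256)]
  calc _ ≤ ∑ b ∈ (Finset.range N).filter (fun b => 2 * b ≤ N), ((b + N).choose N : ℝ) * (1 / 4) ^ b * q b := by
        refine Finset.sum_le_sum fun b hb => ?_
        rw [Finset.mem_filter, Finset.mem_range] at hb
        refine mul_le_mul_of_nonneg_left ?_ (by positivity)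
        have hb2 : (2 : ℝ) * b ≤ N := by exact_mod_cast hb.2
        have := quad_ub ((b : ℝ) / N) (by positivity) (by rw [div_le_iff₀ hN']; linarith)
        refine le_trans (le_of_eq ?_) this
        have : (N : ℝ) ^ 2 - (b : ℝ) ^ 2 ≠ 0 := by
          have : (0 : ℝ) ≤ b := by positivity
          nlinarith
        rw [show ((N : ℝ) - b) * (N + b) = N ^ 2 - b ^ 2 by ring]
        have h3 : 1 - ((b : ℝ) / N) ^ 2 = (N ^ 2 - b ^ 2) / N ^ 2 := by field_simp
        rw [h3, one_div_div]
    _ ≤ _ := sum_le_hasSum _ (fun b _ => mul_nonneg (by positivity) (hq0 b)) hs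
    _ ≤ _ := by
        rw [mul_comm]
        refine mul_le_mul_of_nonneg_left ?_ (by positivity)
        have : 9 / (32 * (N : ℝ)) + 4 * (4 * (N + 1) / 9 + 1 / 9) / N ^ 2 ≤ 5 / N := by
          rw [div_add_div _ _ (by positivity) (by positivity), div_le_div_iff₀ (by positivity) (by positivity)]
          nlinarith [mul_pos hN' hN', mul_pos (mul_pos hN' hN') hN', mul_nonneg (mul_pos hN' hN').le (sub_nonneg.2 hN1)]
        linarith

theorem WN_high (N : ℕ) :
    ∑ b ∈ (Finset.range N).filter (fun b => ¬ 2 * b ≤ N), ((b + N).choose N : ℝ) * (1 / 4) ^ b *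
      ((N : ℝ) ^ 2 / (((N : ℝ) - b) * (N + b))) ≤ (3 / 2) * (N * (1.3005 : ℝ) ^ N) := by
  have hs : HasSum (fun b : ℕ => ((b + N).choose N : ℝ) * (1 / 3) ^ b) ((3 / 2) ^ (N + 1)) := by
    have := hasSum_choose_mul_geometric_of_norm_lt_one (𝕜 := ℝ) N (r := 1 / 3) (by norm_num)
    have h2 : (1 : ℝ) / (1 - 1 / 3) ^ (N + 1) = (3 / 2) ^ (N + 1) := by
      rw [one_div, ← inv_pow]; norm_num
    rw [h2] at this
    exact this
  have hs2 := hs.mul_right ((0.867 : ℝ) ^ N * N)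
  refine le_trans ?_ ((sum_le_hasSum ((Finset.range N).filter (fun b => ¬ 2 * b ≤ N)) (fun b _ => by positivity) hs2).trans
    (le_of_eq ?_))
  · refine Finset.sum_le_sum fun b hb => ?_
    rw [Finset.mem_filter, Finset.mem_range] at hb
    have hb1 : (b : ℝ) + 1 ≤ N := by exact_mod_cast hb.1
    have h1 : ((1 : ℝ) / 4) ^ b ≤ (1 / 3) ^ b * 0.867 ^ N := by
      calc ((1 : ℝ) / 4) ^ b = (1 / 3) ^ b * (3 / 4) ^ b := by rw [← mul_pow]; norm_num
        _ ≤ (1 / 3) ^ b * (0.867 ^ 2) ^ b := by gcongr; norm_num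
        _ = (1 / 3) ^ b * 0.867 ^ (2 * b) := by rw [pow_mul]
        _ ≤ _ := by
          refine mul_le_mul_of_nonneg_left ?_ (by positivity)
          exact pow_le_pow_of_le_one (by norm_num) (by norm_num) (by omega)
    have hb0 : (0 : ℝ) ≤ b := by positivity
    have h2 : (N : ℝ) ^ 2 / (((N : ℝ) - b) * (N + b)) ≤ N := by
      rw [div_le_iff₀ (by nlinarith)]
      have : (N : ℝ) ≤ ((N : ℝ) - b) * (N + b) := by nlinarith
      nlinarith
    have h3 : 0 ≤ (N : ℝ) ^ 2 / (((N : ℝ) - b) * (N + b)) := by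
      have : (0 : ℝ) ≤ N - b := by linarith
      positivity
    calc _ ≤ ((b + N).choose N : ℝ) * ((1 / 3) ^ b * 0.867 ^ N) * N := by gcongr
      _ = _ := by ring
  · rw [pow_succ, show (1.3005 : ℝ) = 3 / 2 * 0.867 by norm_num, mul_pow (3 / 2 : ℝ)]; ring

theorem WN_le (ε : ℝ) (hε : 0 < ε) : ∀ᶠ N : ℕ in Filter.atTop, 4 * WN N ≤ (6 + ε) * (4 / 3) ^ N := by
  have t1 : Filter.Tendsto (fun N : ℕ => (5 : ℝ) / N) Filter.atTop (nhds 0) :=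
    tendsto_const_div_atTop_nhds_zero_nat 5
  have t2 : Filter.Tendsto (fun N : ℕ => (N : ℝ) * (1.3005 * (3 / 4) : ℝ) ^ N) Filter.atTop (nhds 0) :=
    tendsto_self_mul_const_pow_of_lt_one (by norm_num) (by norm_num)
  filter_upwards [t1.eventually (gt_mem_nhds (show (0 : ℝ) < ε / 16 by positivity)),
    t2.eventually (gt_mem_nhds (show (0 : ℝ) < ε / 16 by positivity)), Filter.eventually_gt_atTop 0] with N h1 h2 hN
  have h3 := WN_low N hN
  have h4 := WN_high N
  have h5 : WN N ≤ (4 / 3 : ℝ) ^ (N + 1) * (9 / 8 + 5 / (N : ℝ)) + (3 / 2) * (N * (1.3005 : ℝ) ^ N) := by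
    unfold WN
    rw [← Finset.sum_filter_add_sum_filter_not (Finset.range N) (fun b => 2 * b ≤ N)]
    exact add_le_add h3 h4
  have h6 : N * (1.3005 : ℝ) ^ N ≤ ε / 16 * (4 / 3) ^ N := by
    have : (1.3005 : ℝ) ^ N = (1.3005 * (3 / 4) : ℝ) ^ N * (4 / 3) ^ N := by
      rw [← mul_pow]; norm_num
    rw [this, ← mul_assoc]
    gcongr
  have h7 : (4 / 3 : ℝ) ^ (N + 1) * (9 / 8 + 5 / N) ≤ (4 / 3) ^ N * (4 / 3 * (9 / 8 + ε / 16)) := by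
    rw [pow_succ, mul_assoc]; gcongr
  nlinarith [pow_pos (show (0 : ℝ) < 4 / 3 by norm_num) N]

end

end modE4

section modD1
section
open Stirling Filter

/-- reference size -/
noncomputable def Bs (N : ℕ) : ℝ := 2 ^ N * (N.factorial : ℝ) * (4 / 3) ^ N

theorem Bs_pos (N : ℕ) : 0 < Bs N := by unfold Bs; positivity

/-- the normalisation -/
noncomputable def Nm (N : ℕ) : ℝ :=
  ((2 * N).factorial : ℝ) * 6 ^ (2 * N) * (df N : ℝ) ^ 2 / (df (3 * N) : ℝ)

theorem df_real (b : ℕ) : (df b : ℝ) = (2 * b).factorial / (2 ^ b * b.factorial) := by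
  rw [eq_div_iff (by positivity)]
  exact_mod_cast df_mul b

theorem Nm_eq (N : ℕ) : Nm N = Bs N * (27 ^ N * ((2 * N).factorial : ℝ) ^ 3 * ((3 * N).factorial : ℝ) /
    ((N.factorial : ℝ) ^ 3 * ((6 * N).factorial : ℝ))) := by
  unfold Nm Bs
  rw [df_real, df_real, show 2 * (3 * N) = 6 * N by ring]
  have h1 : (6 : ℝ) ^ (2 * N) = 36 ^ N := by rw [pow_mul]; norm_num
  have h2 : (2 : ℝ) ^ (3 * N) = 8 ^ N := by rw [pow_mul]; norm_num
  have h3 : (4 / 3 : ℝ) ^ N * 27 ^ N = 36 ^ N := by rw [← mul_pow]; norm_num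
  have h4 : (8 : ℝ) ^ N = 2 ^ N * (2 ^ N) ^ 2 := by rw [← pow_mul, mul_comm N 2, pow_mul, ← mul_pow]; norm_num
  rw [h1, h2, h4, ← h3]
  have : ((2 * N).factorial : ℝ) ≠ 0 := by positivity
  have : ((3 * N).factorial : ℝ) ≠ 0 := by positivity
  have : ((6 * N).factorial : ℝ) ≠ 0 := by positivity
  have : ((N).factorial : ℝ) ≠ 0 := by positivity
  field_simp

theorem fact_st (m : ℕ) (hm : 0 < m) : (m.factorial : ℝ) = stirlingSeq m * (Real.sqrt (2 * m) * (m / Real.exp 1) ^ m) := by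
  have : (0 : ℝ) < m := by exact_mod_cast hm
  unfold stirlingSeq
  rw [div_mul_cancel₀]
  positivity

theorem Nm_lim : ∀ ε : ℝ, 0 < ε → ∀ᶠ N : ℕ in atTop, (2 - ε) * Bs N ≤ Nm N := by
  intro ε hε
  have hs := tendsto_stirlingSeq_sqrt_pi
  have h2 : Tendsto (fun N : ℕ => stirlingSeq (2 * N)) atTop (nhds (Real.sqrt Real.pi)) :=
    hs.comp (tendsto_id.const_mul_atTop' (by norm_num))
  have h3 : Tendsto (fun N : ℕ => stirlingSeq (3 * N)) atTop (nhds (Real.sqrt Real.pi)) :=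
    hs.comp (tendsto_id.const_mul_atTop' (by norm_num))
  have h6 : Tendsto (fun N : ℕ => stirlingSeq (6 * N)) atTop (nhds (Real.sqrt Real.pi)) :=
    hs.comp (tendsto_id.const_mul_atTop' (by norm_num))
  have hp : Real.sqrt Real.pi ≠ 0 := by positivity
  have hl := ((((h2.pow 3).mul h3).div ((hs.pow 3).mul h6) (by positivity)).const_mul 2)
  have hv : 2 * (Real.sqrt Real.pi ^ 3 * Real.sqrt Real.pi / (Real.sqrt Real.pi ^ 3 * Real.sqrt Real.pi)) = 2 := by
    field_simp
  rw [hv] at hl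
  filter_upwards [hl.eventually (lt_mem_nhds (show 2 - ε < 2 by linarith)), eventually_gt_atTop 0] with N h hN
  simp only [Pi.div_apply] at h
  rw [Nm_eq, mul_comm]
  refine mul_le_mul_of_nonneg_left ?_ (Bs_pos N).le
  refine h.le.trans (le_of_eq ?_)
  have hN' : (0 : ℝ) < N := by exact_mod_cast hN
  rw [fact_st (2 * N) (by omega), fact_st (3 * N) (by omega), fact_st (6 * N) (by omega), fact_st N hN]
  have q1 : Real.sqrt (2 * (2 * N : ℕ)) = Real.sqrt 2 * Real.sqrt (2 * N) := by
    rw [← Real.sqrt_mul (by norm_num)]; push_cast; ring_nf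
  have q2 : Real.sqrt (2 * (3 * N : ℕ)) = Real.sqrt 3 * Real.sqrt (2 * N) := by
    rw [← Real.sqrt_mul (by norm_num)]; push_cast; ring_nf
  have q3 : Real.sqrt (2 * (6 * N : ℕ)) = Real.sqrt 2 * Real.sqrt 3 * Real.sqrt (2 * N) := by
    rw [← Real.sqrt_mul (by norm_num), ← Real.sqrt_mul (by norm_num)]; push_cast; ring_nf
  rw [q1, q2, q3]
  have w1 : (((2 * N : ℕ) : ℝ) / Real.exp 1) ^ (2 * N) = 4 ^ N * ((N / Real.exp 1) ^ N) ^ 2 := by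
    push_cast
    rw [mul_div_assoc, mul_pow, pow_mul, pow_mul', ]; norm_num
  have w2 : (((3 * N : ℕ) : ℝ) / Real.exp 1) ^ (3 * N) = 27 ^ N * ((N / Real.exp 1) ^ N) ^ 3 := by
    push_cast
    rw [mul_div_assoc, mul_pow, pow_mul, pow_mul', ]; norm_num
  have w3 : (((6 * N : ℕ) : ℝ) / Real.exp 1) ^ (6 * N) = 46656 ^ N * ((N / Real.exp 1) ^ N) ^ 6 := by
    push_cast
    rw [mul_div_assoc, mul_pow, pow_mul, pow_mul', ]; norm_num
  have w4 : (46656 : ℝ) ^ N = (27 ^ N) * 27 ^ N * (4 ^ N) ^ 3 := by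
    rw [← pow_mul, mul_comm N 3, pow_mul, ← mul_pow, ← mul_pow]; norm_num
  rw [w1, w2, w3, w4]
  have s1 : stirlingSeq N ≠ 0 := by unfold stirlingSeq; positivity
  have s2 : stirlingSeq (6 * N) ≠ 0 := by unfold stirlingSeq; positivity
  have s3 : Real.sqrt (2 * N) ≠ 0 := by positivity
  have s4 : ((N / Real.exp 1) ^ N) ≠ 0 := by positivity
  have s5 : Real.sqrt 2 ≠ 0 := by positivity
  have s6 : Real.sqrt 3 ≠ 0 := by positivity
  have s7 : Real.sqrt 2 ^ 2 = 2 := Real.sq_sqrt (by norm_num)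
  generalize Real.sqrt (2 * N) = a at *
  generalize (N / Real.exp 1) ^ N = b at *
  generalize stirlingSeq N = c at *
  generalize stirlingSeq (6 * N) = d at *
  generalize Real.sqrt 2 = e at *
  generalize Real.sqrt 3 = f at *
  field_simp
  rw [← s7]
  ring

theorem st_ub (m : ℕ) (hm : 0 < m) : stirlingSeq m ≤ 2 := by
  obtain ⟨m, rfl⟩ : ∃ j, m = j + 1 := ⟨m - 1, by omega⟩
  have := stirlingSeq'_antitone (Nat.zero_le m)
  simp only [Function.comp, Nat.succ_eq_add_one] at this
  rw [zero_add, stirlingSeq_one] at this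
  refine this.trans ?_
  rw [div_le_iff₀ (by positivity)]
  have h1 := Real.exp_one_lt_d9
  have h2 : (1.4 : ℝ) ≤ Real.sqrt 2 := Real.le_sqrt_of_sq_le (by norm_num)
  linarith

theorem st_lb (m : ℕ) (hm : 0 < m) : 1 ≤ stirlingSeq m := by
  refine le_trans ?_ (sqrt_pi_le_stirlingSeq hm.ne')
  exact Real.one_le_sqrt.2 (by linarith [Real.pi_gt_three])

theorem T0_le (N c k : ℕ) (hN : 0 < N) (hck : c * k = 2 * N)
    (hcond : 4 * (N : ℝ) / Real.exp 1 ≤ (2 / Real.sqrt 3) ^ k) :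
    (c.factorial : ℝ) * (2 * k) ^ c * (df N : ℝ) ≤ 8 / Real.sqrt k * Bs N := by
  have hc : 0 < c := Nat.pos_of_ne_zero (by rintro rfl; simp at hck; omega)
  have hk : 0 < k := Nat.pos_of_ne_zero (by rintro rfl; simp at hck; omega)
  have hN' : (0 : ℝ) < N := by exact_mod_cast hN
  have hc' : (0 : ℝ) < c := by exact_mod_cast hc
  have hk' : (0 : ℝ) < k := by exact_mod_cast hk
  have hckr : (c : ℝ) * k = 2 * N := by exact_mod_cast hck
  have h1 : (c.factorial : ℝ) * (2 * k) ^ c ≤ 2 * Real.sqrt (2 * c) * (4 / 3) ^ N := by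
    rw [fact_st c hc]
    calc _ = stirlingSeq c * Real.sqrt (2 * c) * (4 * N / Real.exp 1) ^ c := by
          rw [mul_assoc, mul_assoc, ← mul_pow, mul_assoc]
          congr 3
          field_simp
          linarith
      _ ≤ 2 * Real.sqrt (2 * c) * ((2 / Real.sqrt 3) ^ k) ^ c := by
          gcongr
          exact st_ub c hc
      _ = _ := by
          rw [← pow_mul, mul_comm k c, hck, pow_mul, div_pow, Real.sq_sqrt (by norm_num)]; norm_num
  have h2 : (df N : ℝ) ≤ 2 * (2 ^ N * N.factorial) / Real.sqrt N := by
    rw [df_real, fact_st N hN, fact_st (2 * N) (by omega)]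
    have w1 : (((2 * N : ℕ) : ℝ) / Real.exp 1) ^ (2 * N) = (2 ^ N) ^ 2 * ((N / Real.exp 1) ^ N) ^ 2 := by
      push_cast
      rw [mul_div_assoc, mul_pow, pow_mul, pow_mul', pow_right_comm]
    have q1 : Real.sqrt (2 * (2 * N : ℕ)) = Real.sqrt 2 * Real.sqrt 2 * Real.sqrt N := by
      rw [← Real.sqrt_mul (by norm_num), ← Real.sqrt_mul (by norm_num)]; push_cast; ring_nf
    have q2 : Real.sqrt (2 * N) = Real.sqrt 2 * Real.sqrt N := by
      rw [← Real.sqrt_mul (by norm_num)]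
    rw [w1, q1, q2]
    have s1 := st_lb N hN
    have s2 := st_ub (2 * N) (by omega)
    have s3 : stirlingSeq (2 * N) ≤ 2 * stirlingSeq N ^ 2 := by nlinarith
    have s4 : 0 < (N / Real.exp 1) ^ N := by positivity
    have s5 : 0 < Real.sqrt N := by positivity
    have s6 : 0 < Real.sqrt 2 := by positivity
    generalize Real.sqrt N = a at *
    generalize (N / Real.exp 1) ^ N = b at *
    generalize stirlingSeq N = x at *
    generalize stirlingSeq (2 * N) = d at *
    generalize Real.sqrt 2 = e at *
    rw [div_le_div_iff₀ (by positivity) (by positivity)]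
    calc _ = d * (e * e * a * a * (2 ^ N) ^ 2 * b ^ 2) := by ring
      _ ≤ (2 * x ^ 2) * (e * e * a * a * (2 ^ N) ^ 2 * b ^ 2) := by gcongr
      _ = _ := by ring
  have h3 : Real.sqrt (2 * c) / Real.sqrt N = 2 / Real.sqrt k := by
    rw [← Real.sqrt_div (by positivity), show 2 * (c : ℝ) / N = 2 ^ 2 / k by field_simp; linarith,
      Real.sqrt_div (by positivity), Real.sqrt_sq (by norm_num)]
  calc _ ≤ 2 * Real.sqrt (2 * c) * (4 / 3) ^ N * (2 * (2 ^ N * N.factorial) / Real.sqrt N) := by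
        gcongr
    _ = 4 * (Real.sqrt (2 * c) / Real.sqrt N) * Bs N := by unfold Bs; ring
    _ = _ := by rw [h3]; ring

theorem k_large (K : ℕ) : ∃ n0 : ℕ, ∀ N k : ℕ, n0 ≤ N →
    4 * (N : ℝ) / Real.exp 1 ≤ (2 / Real.sqrt 3) ^ k → K ≤ k := by
  obtain ⟨n0, hn0⟩ := exists_nat_gt (Real.exp 1 * 2 ^ K)
  refine ⟨n0, fun N k hN h => ?_⟩
  by_contra hk
  have h1 : (2 / Real.sqrt 3) ^ k ≤ 2 ^ K := by
    calc (2 / Real.sqrt 3) ^ k ≤ 2 ^ k := by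
          gcongr
          refine div_le_self (by norm_num) (Real.one_le_sqrt.2 (by norm_num))
      _ ≤ 2 ^ K := pow_le_pow_right₀ (by norm_num) (by omega)
  have h2 := h.trans h1
  rw [div_le_iff₀ (by positivity)] at h2
  have : (n0 : ℝ) ≤ N := by exact_mod_cast hN
  nlinarith

end

end modD1

section modC1
section
open MvPolynomial

theorem PLe.pow {P Q : Polynomial ℕ} (h : PLe P Q) (c : ℕ) : PLe (P ^ c) (Q ^ c) := by
  induction c with
  | zero => intro m; simp
  | succ c ih => rw [pow_succ, pow_succ]; exact ih.mul h

theorem py_le (k : ℕ) : PLe (pp yl k) ((1 + Polynomial.X) ^ k) := by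
  intro a
  rw [Polynomial.coeff_one_add_X_pow, Nat.cast_id]
  rcases a with _ | a
  · rw [py_coeff0]; exact Nat.zero_le _
  by_cases h : k < 2 * (a + 1)
  · rw [py_zero _ _ h]; exact Nat.zero_le _
  obtain ⟨r, rfl⟩ : ∃ r, k = 2 * a + 2 + r := ⟨k - (2 * a + 2), by omega⟩
  rw [py_coeff, ← Nat.choose_symm_add (a := a + 1), ← Nat.choose_symm_add (a := a)]
  calc _ ≤ (a + 1 + r).choose (a + 1) + (a + 1 + r).choose a :=
        Nat.add_le_add_left (Nat.choose_le_choose _ (by omega)) _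
    _ = (a + 1 + r + 1).choose (a + 1) := by rw [Nat.choose_succ_succ (a + 1 + r) a]; ring
    _ ≤ _ := Nat.choose_le_choose _ (by omega)

theorem natDegree_py (k : ℕ) : 2 * (pp yl k).natDegree ≤ k := by
  by_contra h
  push Not at h
  have h0 : pp yl k ≠ 0 := by rintro h0; rw [h0] at h; simp at h
  exact (Polynomial.leadingCoeff_ne_zero.2 h0) (py_zero k _ h)

theorem py_pow_zero_hi (k c a : ℕ) (h : c * k < 2 * a) : ((pp yl k) ^ c).coeff a = 0 := by
  apply Polynomial.coeff_eq_zero_of_natDegree_lt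
  have h1 := Polynomial.natDegree_pow_le (p := pp yl k) (n := c)
  have h2 := natDegree_py k
  nlinarith

theorem py_pow_zero_lo (k c a : ℕ) (h : a < c) : ((pp yl k) ^ c).coeff a = 0 := by
  have : Polynomial.X ^ c ∣ (pp yl k) ^ c := pow_dvd_pow_of_dvd (Polynomial.X_dvd_iff.2 (py_coeff0 k)) c
  exact Polynomial.X_pow_dvd_iff.1 this a h

theorem py_pow_fact (k c a : ℕ) : ((pp yl k) ^ c).coeff a * a.factorial ≤ (k * c) ^ a := by
  have := (py_le k).pow c a
  rw [← pow_mul, Polynomial.coeff_one_add_X_pow, Nat.cast_id] at this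
  calc _ ≤ (k * c).choose a * a.factorial := Nat.mul_le_mul_right _ this
    _ = (k * c).descFactorial a := by rw [mul_comm, ← Nat.descFactorial_eq_factorial_mul_choose]
    _ ≤ _ := Nat.descFactorial_le_pow _ _

theorem df_ratio (N a : ℕ) (ha : a ≤ N) : df (N - a) * (2 * N - 2 * a) ^ a ≤ df N := by
  obtain ⟨b, rfl⟩ := Nat.exists_eq_add_of_le' ha
  have : ∀ s, df b * (2 * b) ^ s ≤ df (b + s) := by
    intro s
    induction s with
    | zero => simp
    | succ s ih =>
      rw [pow_succ, ← mul_assoc, ← add_assoc, df, mul_comm (2 * (b + s) + 1)]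
      exact Nat.mul_le_mul ih (by omega)
  have := this a
  rwa [Nat.add_sub_cancel, show 2 * (b + a) - 2 * a = 2 * b by omega]

theorem dgm_pow (k c : ℕ) : PLe (dgm k (pp (xs k) k ^ c)) ((pp yl k) ^ c) := by
  rw [map_pow]; exact (dgm_pp k k).pow c

theorem QN_pow_le (N k c : ℕ) : QN N (pp (xs k) k ^ c) ≤ k ^ c * ∑ a ∈ Finset.range (k * c + 1),
    (((pp yl k) ^ c).coeff a : ℝ) * (a.factorial : ℝ) * 2 ^ a * df (N - a) := by
  set P := pp (xs k) k ^ c with hP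
  have h1 : QN N P ≤ ∑ m ∈ P.support,
      ((coeff m P : ℕ) : ℝ) * (k ^ c * ((m.degree).factorial : ℝ) * 2 ^ m.degree *
        (df (N - m.degree) : ℝ)) := by
    refine Finset.sum_le_sum fun m _ => ?_
    have := coeff_pp_pow (k := k) k c m
    have h2 : ((coeff m P : ℕ) : ℝ) * (pf m : ℝ) ≤ k ^ c * ((m.degree).factorial : ℝ) := by
      exact_mod_cast this
    calc _ = ((coeff m P : ℕ) : ℝ) * ((((coeff m P : ℕ) : ℝ) * (pf m : ℝ)) * 2 ^ m.degree * (df (N - m.degree) : ℝ)) := by ring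
      _ ≤ _ := by gcongr
  refine h1.trans ?_
  have hd : ∀ m ∈ P.support, m.degree < k * c + 1 := by
    intro m hm
    by_contra h
    have h1 := (coeff_le_dgm _ m).trans (dgm_pow k c m.degree)
    rw [py_pow_zero_hi k c _ (by rw [mul_comm c k]; omega)] at h1
    exact (mem_support_iff.1 hm) (Nat.le_zero.1 h1)
  rw [dgm_sum k _ (fun a => k ^ c * ((a).factorial : ℝ) * 2 ^ a * (df (N - a) : ℝ)) (k * c + 1) hd, Finset.mul_sum]
  refine Finset.sum_le_sum fun a _ => ?_
  have : (((dgm k P).coeff a : ℕ) : ℝ) ≤ ((pp yl k ^ c).coeff a : ℝ) := by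
    exact_mod_cast dgm_pow k c a
  calc _ ≤ ((pp yl k ^ c).coeff a : ℝ) * (k ^ c * ((a).factorial : ℝ) * 2 ^ a * (df (N - a) : ℝ)) := by gcongr
    _ = _ := by ring

theorem QN_small (N k c c' : ℕ) (hN : 0 < N) (hck : c * k = 2 * N) (hc : 10 * c' ≤ c) :
    QN N (pp (xs k) k ^ c') ≤ k ^ c' * (df N : ℝ) * (9 / 7 * (20 * c' / (9 * c)) ^ c') := by
  refine (QN_pow_le N k c').trans ?_
  have hc0 : 0 < c := Nat.pos_of_ne_zero (by rintro rfl; simp at hck; omega)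
  have hk0 : 0 < k := Nat.pos_of_ne_zero (by rintro rfl; simp at hck; omega)
  have hc0' : (0 : ℝ) < c := by exact_mod_cast hc0
  have hk0' : (0 : ℝ) < k := by exact_mod_cast hk0
  have hN' : (0 : ℝ) < N := by exact_mod_cast hN
  have hckr : (c : ℝ) * k = 2 * N := by exact_mod_cast hck
  have hcr : (10 : ℝ) * c' ≤ c := by exact_mod_cast hc
  rw [mul_assoc]
  refine mul_le_mul_of_nonneg_left ?_ (by positivity)
  set y : ℝ := 20 * c' / (9 * c) with hy
  have hy0 : 0 ≤ y := by positivity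
  have hy1 : y ≤ 2 / 9 := by
    rw [hy, div_le_iff₀ (by positivity)]; linarith
  have hterm : ∀ a ∈ Finset.range (k * c' + 1), (((pp yl k) ^ c').coeff a : ℝ) * (a.factorial : ℝ) * 2 ^ a * df (N - a) ≤
      if c' ≤ a then (df N : ℝ) * y ^ a else 0 := by
    intro a _
    split_ifs with h1
    · by_cases h2 : c' * k < 2 * a
      · rw [py_pow_zero_hi _ _ _ h2]; simp; positivity
      · have hN10 : 10 * (2 * a) ≤ 2 * N := by
          calc 10 * (2 * a) ≤ 10 * (c' * k) := by omega
            _ = (10 * c') * k := by ring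
            _ ≤ c * k := Nat.mul_le_mul_right _ hc
            _ = _ := hck
        have e1 : (((pp yl k) ^ c').coeff a : ℝ) * (a.factorial : ℝ) ≤ (k * c') ^ a := by
          exact_mod_cast py_pow_fact k c' a
        have e2 : (df (N - a) : ℝ) * (9 / 10 * (2 * N)) ^ a ≤ df N := by
          calc (df (N - a) : ℝ) * (9 / 10 * (2 * N)) ^ a ≤ (df (N - a) : ℝ) * ((2 * N - 2 * a : ℕ) : ℝ) ^ a := by
                gcongr
                rw [Nat.cast_sub (by omega)]
                have : (10 : ℝ) * (2 * a) ≤ 2 * N := by exact_mod_cast hN10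
                push_cast
                linarith
            _ ≤ _ := by exact_mod_cast df_ratio N a (by omega)
        have e3 : ((k : ℝ) * c') * 2 = y * (9 / 10 * (2 * N)) := by
          rw [hy, ← hckr]; field_simp; ring
        calc _ ≤ ((k : ℝ) * c') ^ a * 2 ^ a * df (N - a) := by gcongr
          _ = y ^ a * (df (N - a) * (9 / 10 * (2 * N)) ^ a) := by
              rw [← mul_pow, e3, mul_pow]; ring
          _ ≤ y ^ a * df N := by gcongr
          _ = _ := by ring
    · rw [py_pow_zero_lo _ _ _ (by omega)]; simp
  refine (Finset.sum_le_sum hterm).trans ?_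
  rw [← Finset.sum_filter, ← Finset.mul_sum]
  refine mul_le_mul_of_nonneg_left ?_ (by positivity)
  have hgs : HasSum (fun i : ℕ => y ^ c' * y ^ i) (y ^ c' * (1 - y)⁻¹) :=
    (hasSum_geometric_of_lt_one hy0 (by linarith)).mul_left _
  have hsub : ∑ a ∈ (Finset.range (k * c' + 1)).filter (fun a => c' ≤ a), y ^ a ≤ ∑ i ∈ Finset.range (k * c' + 1), y ^ c' * y ^ i := by
    have : (Finset.range (k * c' + 1)).filter (fun a => c' ≤ a) ⊆ (Finset.range (k * c' + 1)).image (fun i => c' + i) := by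
      intro a ha
      rw [Finset.mem_filter, Finset.mem_range] at ha
      rw [Finset.mem_image]
      exact ⟨a - c', Finset.mem_range.2 (by omega), by omega⟩
    refine (Finset.sum_le_sum_of_subset_of_nonneg this (fun i _ _ => by positivity)).trans ?_
    rw [Finset.sum_image (fun a _ b _ h => by simpa using h)]
    simp only [pow_add]; exact le_rfl
  refine hsub.trans ((sum_le_hasSum _ (fun i _ => by positivity) hgs).trans ?_)
  rw [mul_comm]
  refine mul_le_mul_of_nonneg_right ?_ (by positivity)
  rw [inv_le_comm₀ (by linarith) (by norm_num)]
  norm_num; linarith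

/-- the terms -/
noncomputable def Tc (c k N c' : ℕ) : ℝ :=
  (c.choose c' : ℝ) ^ 2 * ((c - c').factorial : ℝ) * (2 * k) ^ (c - c') * QN N (pp (xs k) k ^ c')

theorem QN_nonneg {k : ℕ} (N : ℕ) (P : MvPolynomial (Fin (k + 1)) ℕ) : 0 ≤ QN N P := by
  unfold QN; positivity

theorem Tc_small (N k c c' : ℕ) (hN : 0 < N) (hck : c * k = 2 * N) (hc : 10 * c' ≤ c) :
    Tc c k N c' ≤ (c.factorial : ℝ) * (2 * k) ^ c * df N * (9 / 7 * ((10 / 9 * Real.exp 1) ^ c' / c'.factorial)) := by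
  have h := QN_small N k c c' hN hck hc
  have hc0 : 0 < c := Nat.pos_of_ne_zero (by rintro rfl; simp at hck; omega)
  have hk0 : 0 < k := Nat.pos_of_ne_zero (by rintro rfl; simp at hck; omega)
  have hc0' : (0 : ℝ) < c := by exact_mod_cast hc0
  have hk0' : (0 : ℝ) < k := by exact_mod_cast hk0
  have hle : c' ≤ c := by omega
  have e1 : (c.choose c' : ℝ) * ((c - c').factorial : ℝ) * (c'.factorial : ℝ) = c.factorial := by
    exact_mod_cast (by rw [← Nat.choose_mul_factorial_mul_factorial hle]; ring : c.choose c' * (c - c').factorial * c'.factorial = c.factorial)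
  have e2 : (c.choose c' : ℝ) ≤ c ^ c' / c'.factorial := Nat.choose_le_pow_div c' c
  have e3 : (c' : ℝ) ^ c' / c'.factorial ≤ Real.exp 1 ^ c' := by
    rw [← Real.exp_nat_mul, mul_one]
    exact Real.pow_div_factorial_le_exp _ (by positivity) _
  have e4 : ((2 : ℝ) * k) ^ c = (2 * k) ^ (c - c') * (2 ^ c' * k ^ c') := by
    rw [← mul_pow 2, ← pow_add, Nat.sub_add_cancel hle]
  unfold Tc
  have hf : (0 : ℝ) < c'.factorial := by positivity
  have e1' : (c.choose c' : ℝ) * ((c - c').factorial : ℝ) = c.factorial / c'.factorial := by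
    rw [eq_div_iff hf.ne']; exact e1
  calc _ = ((c.choose c' : ℝ) * ((c - c').factorial : ℝ)) * (2 * k) ^ (c - c') * c.choose c' * QN N (pp (xs k) k ^ c') := by ring
    _ ≤ (c.factorial / c'.factorial) * (2 * k) ^ (c - c') * (c ^ c' / c'.factorial) * (k ^ c' * (df N : ℝ) * (9 / 7 * (20 * c' / (9 * c)) ^ c')) := by
        rw [e1']
        have := QN_nonneg N (pp (xs k) k ^ c')
        gcongr
    _ = (c.factorial : ℝ) * ((2 * k) ^ (c - c') * (2 ^ c' * k ^ c')) * df N * (9 / 7 * ((10 / 9) ^ c' * ((c' : ℝ) ^ c' / c'.factorial) / c'.factorial)) := by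
        rw [show (20 * c' / (9 * c) : ℝ) = 2 * (10 / 9) * c' / c by field_simp; ring, div_pow, mul_pow (2 * (10 / 9) : ℝ), mul_pow 2 (10 / 9 : ℝ)]
        generalize (10 / 9 : ℝ) ^ c' = t
        field_simp
    _ ≤ _ := by
        rw [← e4, mul_pow (10 / 9 : ℝ)]
        gcongr

theorem Tc_small_sum (N k c : ℕ) (hN : 0 < N) (hck : c * k = 2 * N) :
    ∑ c' ∈ (Finset.range (c + 1)).filter (fun c' => 10 * c' ≤ c), Tc c k N c' ≤
      (c.factorial : ℝ) * (2 * k) ^ c * df N * (9 / 7 * Real.exp (10 / 9 * Real.exp 1)) := by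
  calc _ ≤ ∑ c' ∈ (Finset.range (c + 1)).filter (fun c' => 10 * c' ≤ c), (c.factorial : ℝ) * (2 * k) ^ c * df N * (9 / 7 * ((10 / 9 * Real.exp 1) ^ c' / c'.factorial)) :=
        Finset.sum_le_sum fun c' h => Tc_small N k c c' hN hck (Finset.mem_filter.1 h).2
    _ ≤ ∑ c' ∈ (Finset.range (c + 1)), (c.factorial : ℝ) * (2 * k) ^ c * df N * (9 / 7 * ((10 / 9 * Real.exp 1) ^ c' / c'.factorial)) :=
        Finset.sum_le_sum_of_subset_of_nonneg (Finset.filter_subset _ _) (fun i _ _ => by positivity)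
    _ ≤ _ := by
        rw [← Finset.mul_sum, ← Finset.mul_sum]
        gcongr
        exact Real.sum_le_exp_of_nonneg (by positivity) _

end

end modC1

section modG1
section
open PowerSeries

/-- power-sum series of a multiset -/
noncomputable def PS (ρ : Multiset ℂ) : PowerSeries ℂ :=
  PowerSeries.mk fun j => if j = 0 then 0 else (ρ.map (fun r => r ^ j)).sum

theorem PS_one (r : ℂ) : (1 - PowerSeries.C r * X) * (PowerSeries.mk fun j => if j = 0 then 0 else r ^ j) = PowerSeries.C r * X := by
  ext j
  rw [sub_mul, one_mul, map_sub, mul_assoc, coeff_C_mul, coeff_C_mul]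
  rcases j with _ | j
  · simp
  · rw [coeff_succ_X_mul, coeff_mk, coeff_mk, if_neg (by omega), coeff_X]
    rcases j with _ | j
    · simp
    · rw [if_neg (by omega), if_neg (by omega)]; ring

theorem PS_mul (ρ : Multiset ℂ) :
    (ρ.map (fun r => (1 - PowerSeries.C r * X : PowerSeries ℂ))).prod * PS ρ =
      - (X * d⁄dX ℂ (ρ.map (fun r => (1 - PowerSeries.C r * X : PowerSeries ℂ))).prod) := by
  induction ρ using Multiset.induction_on with
  | empty => 
    have : PS 0 = 0 := by
      ext j; simp [PS]
    simp [this]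
  | cons r ρ ih =>
    have h1 : PS (r ::ₘ ρ) = (PowerSeries.mk fun j => if j = 0 then 0 else r ^ j) + PS ρ := by
      ext j
      simp only [PS, coeff_mk, map_add, Multiset.map_cons, Multiset.sum_cons]
      split_ifs <;> simp
    rw [Multiset.map_cons, Multiset.prod_cons, h1, Derivation.leibniz]
    have h2 : d⁄dX ℂ (1 - PowerSeries.C r * X : PowerSeries ℂ) = - PowerSeries.C r := by
      rw [map_sub, Derivation.leibniz]
      simp
    rw [h2]
    set E := (ρ.map (fun r => (1 - PowerSeries.C r * X : PowerSeries ℂ))).prod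
    have h3 := PS_one r
    simp only [smul_eq_mul]
    linear_combination E * h3 + (1 - PowerSeries.C r * X) * ih

theorem pp_PS (v : ℕ → ℂ) (hv0 : v 0 = 0) (ρ : Multiset ℂ)
    (hE : (ρ.map (fun r => (1 - PowerSeries.C r * X : PowerSeries ℂ))).prod = 1 - PowerSeries.mk v) (j : ℕ) (hj : 0 < j) :
    pp v j = (ρ.map (fun r => r ^ j)).sum := by
  set H : PowerSeries ℂ := PowerSeries.mk (hh v) with hH
  have h1 : (1 - PowerSeries.mk v) * H = 1 := by
    have : H = 1 + PowerSeries.mk v * H := by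
      ext n
      rcases n with _ | n
      · rw [map_add, coeff_mul]; simp [hH, hh_zero, hv0]
      · rw [map_add, coeff_mul, Finset.Nat.sum_antidiagonal_eq_sum_range_succ (fun a b => coeff a (PowerSeries.mk v) * coeff b H),
          Finset.sum_range_succ']
        simp only [hH, coeff_mk, hv0, zero_mul, add_zero]
        rw [hh_succ]
        simp
    linear_combination this
  set P : PowerSeries ℂ := PowerSeries.mk (pp v) with hP
  have h2 : P = (X * d⁄dX ℂ (PowerSeries.mk v)) * H := by
    ext n
    rcases n with _ | n
    · simp [hP, pp_eq, mul_assoc]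
    · rw [mul_assoc, coeff_succ_X_mul, coeff_mul, Finset.Nat.sum_antidiagonal_eq_sum_range_succ (fun a b => coeff a (d⁄dX ℂ (PowerSeries.mk v)) * coeff b H)]
      simp only [hP, hH, coeff_mk, coeff_derivative]
      rw [pp_eq]
      refine Finset.sum_congr rfl fun i _ => ?_
      push_cast
      ring
  have h3 := PS_mul ρ
  rw [hE] at h3
  have h4 : PS ρ = P := by
    have h5 : d⁄dX ℂ (1 - PowerSeries.mk v) = - d⁄dX ℂ (PowerSeries.mk v) := by
      rw [map_sub]; simp
    rw [h5] at h3
    rw [h2]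
    linear_combination H * h3 - PS ρ * h1
  have h5 := congrArg (coeff j) h4
  rw [hP, coeff_mk, PS, coeff_mk, if_neg hj.ne'] at h5
  exact h5.symm

/-- the polynomial `1 - f` -/
noncomputable def Fv (k : ℕ) (v : ℕ → ℂ) : Polynomial ℂ :=
  1 - ∑ l ∈ Finset.range (k + 1), Polynomial.C (v l) * Polynomial.X ^ l

theorem Fv_eval (k : ℕ) (v : ℕ → ℂ) (x : ℂ) : (Fv k v).eval x = 1 - ∑ l ∈ Finset.range (k + 1), v l * x ^ l := by
  simp [Fv, Polynomial.eval_finsetSum]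

theorem Fv_deg (k : ℕ) (v : ℕ → ℂ) : (Fv k v).natDegree ≤ k := by
  unfold Fv
  refine (Polynomial.natDegree_sub_le _ _).trans ?_
  simp only [Polynomial.natDegree_one, zero_le, sup_of_le_right]
  refine Polynomial.natDegree_sum_le_of_forall_le _ _ fun l hl => ?_
  exact (Polynomial.natDegree_C_mul_X_pow_le _ _).trans (by have := Finset.mem_range.1 hl; omega)

theorem Fv_ne (k : ℕ) (v : ℕ → ℂ) (hv0 : v 0 = 0) : Fv k v ≠ 0 := by
  intro h
  have := Fv_eval k v 0
  rw [h, Finset.sum_range_succ'] at this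
  simp [hv0] at this

theorem Fv_root (k : ℕ) (v : ℕ → ℂ) (w : ℂ) (hw : w ∈ (Fv k v).roots) :
    ∑ l ∈ Finset.range (k + 1), v l * w ^ l = 1 := by
  have := (Polynomial.mem_roots'.1 hw).2
  rw [Polynomial.IsRoot, Fv_eval] at this
  linear_combination -this

theorem Fv_root_ne (k : ℕ) (v : ℕ → ℂ) (hv0 : v 0 = 0) (w : ℂ) (hw : w ∈ (Fv k v).roots) : w ≠ 0 := by
  rintro rfl
  have := Fv_root k v 0 hw
  rw [Finset.sum_range_succ'] at this
  simp [hv0] at this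

theorem pp_roots (k : ℕ) (v : ℕ → ℂ) (hv0 : v 0 = 0) (hv : ∀ l, k < l → v l = 0) (j : ℕ) (hj : 0 < j) :
    pp v j = ((Fv k v).roots.map (fun w => (w⁻¹) ^ j)).sum := by
  have hs := IsAlgClosed.splits (Fv k v)
  have h1 := hs.eq_prod_roots
  have h2 : Fv k v = ((Fv k v).roots.map (fun w => (1 - Polynomial.C w⁻¹ * Polynomial.X))).prod := by
    have e1 : ((Fv k v).roots.map (fun w => (Polynomial.X - Polynomial.C w))).prod =
        ((Fv k v).roots.map (fun w => Polynomial.C (-w))).prod *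
        ((Fv k v).roots.map (fun w => (1 - Polynomial.C w⁻¹ * Polynomial.X))).prod := by
      rw [← Multiset.prod_map_mul]
      refine congrArg _ (Multiset.map_congr rfl fun w hw => ?_)
      have hw0 := Fv_root_ne k v hv0 w hw
      rw [mul_sub, mul_one, ← mul_assoc, ← Polynomial.C_mul, neg_mul, mul_inv_cancel₀ hw0]
      simp
      ring
    have e2 : ((Fv k v).roots.map (fun w => Polynomial.C (-w))).prod = Polynomial.C ((Fv k v).roots.map (fun w => -w)).prod := by
      rw [map_multiset_prod, Multiset.map_map]; rfl
    rw [e1, e2, ← mul_assoc, ← Polynomial.C_mul] at h1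
    generalize (Fv k v).leadingCoeff * ((Fv k v).roots.map (fun w => -w)).prod = κ at h1
    have h0 := congrArg (Polynomial.eval 0) h1
    rw [Polynomial.eval_mul, Polynomial.eval_C, Polynomial.eval_multiset_prod, Multiset.map_map, Fv_eval, Finset.sum_range_succ'] at h0
    simp [hv0] at h0
    rw [← h0] at h1
    simpa using h1
  have h3 : (1 - PowerSeries.mk v : PowerSeries ℂ) = ((Fv k v : Polynomial ℂ) : PowerSeries ℂ) := by
    ext n
    rw [Polynomial.coeff_coe, Fv, map_sub, Polynomial.coeff_sub, Polynomial.finsetSum_coeff, coeff_mk, coeff_one, Polynomial.coeff_one]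
    congr 1
    · simp only [Polynomial.coeff_C_mul_X_pow]
      by_cases hn : n < k + 1
      · rw [Finset.sum_eq_single n]
        · simp
        · intro b _ hb; rw [if_neg hb.symm]
        · intro h; exact absurd (Finset.mem_range.2 hn) h
      · rw [hv n (by omega), Finset.sum_eq_zero]
        intro b hb
        rw [if_neg]
        have := Finset.mem_range.1 hb
        omega
  have h4 := pp_PS v hv0 ((Fv k v).roots.map (fun w => w⁻¹)) (by
    rw [h3]
    conv_rhs => rw [h2]
    rw [Multiset.map_map, ← Polynomial.coeToPowerSeries.ringHom_apply, map_multiset_prod, Multiset.map_map]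
    refine congrArg _ (Multiset.map_congr rfl fun w _ => ?_)
    simp) j hj
  rw [h4, Multiset.map_map]
  rfl

end

end modG1

section modG2
section

noncomputable def Bc (c k c' : ℕ) : ℝ := (c.choose c' : ℝ) ^ 2 * ((c - c').factorial : ℝ) * (2 * k) ^ (c - c')

theorem Bc_nonneg (c k c' : ℕ) : 0 ≤ Bc c k c' := by unfold Bc; positivity

/-- the range of large indices -/
def Big (c : ℕ) : Finset ℕ := (Finset.range (c + 1)).filter (fun c' => ¬ 10 * c' ≤ c)

noncomputable def Sv (c k : ℕ) (v : ℕ → ℂ) : ℝ := ∑ c' ∈ Big c, Bc c k c' * ‖pp v k‖ ^ (2 * c')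

theorem pp_norm_le (k : ℕ) (v : ℕ → ℂ) (hv0 : v 0 = 0) (hv : ∀ l, k < l → v l = 0) (M : ℝ) (hM0 : 0 ≤ M)
    (hM : ∀ w ∈ (Fv k v).roots, ‖w⁻¹‖ ≤ M) (hk : 0 < k) : ‖pp v k‖ ≤ k * M ^ k := by
  rw [pp_roots k v hv0 hv k hk]
  have h1 : ∀ ρ : Multiset ℂ, (∀ w ∈ ρ, ‖w⁻¹‖ ≤ M) → ‖(ρ.map (fun w => (w⁻¹) ^ k)).sum‖ ≤ ρ.card * M ^ k := by
    intro ρ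
    induction ρ using Multiset.induction_on with
    | empty => simp
    | cons w ρ ih =>
      intro h
      rw [Multiset.map_cons, Multiset.sum_cons, Multiset.card_cons]
      have h2 := ih fun x hx => h x (Multiset.mem_cons_of_mem hx)
      have h3 : ‖(w⁻¹) ^ k‖ ≤ M ^ k := by
        rw [norm_pow]; exact pow_le_pow_left₀ (norm_nonneg _) (h w (Multiset.mem_cons_self _ _)) _
      push_cast
      refine (norm_add_le _ _).trans ?_
      linarith
  refine (h1 _ hM).trans ?_
  have : (Fv k v).roots.card ≤ k := (Polynomial.card_roots' _).trans (Fv_deg k v)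
  gcongr

theorem Bc_le (c k N c' : ℕ) (hck : c * k = 2 * N) (A : ℝ) (hA : 4 * (N : ℝ) / Real.exp 1 ≤ A ^ k) :
    Bc c k c' ≤ 4 ^ c * Real.exp 1 ^ c * (A ^ k) ^ (c - c') := by
  have e1 : (1:ℝ) ≤ Real.exp 1 := by have := Real.add_one_le_exp (1:ℝ); linarith
  have h1 : ((c.choose c' : ℕ) : ℝ) ^ 2 ≤ 4 ^ c := by
    have : c.choose c' ≤ 2 ^ c := Nat.choose_le_two_pow _ _
    have h : ((c.choose c' : ℕ) : ℝ) ≤ 2 ^ c := by exact_mod_cast this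
    calc _ ≤ ((2:ℝ) ^ c) ^ 2 := by gcongr
      _ = 4 ^ c := by rw [← pow_mul, mul_comm, pow_mul]; norm_num
  have h2 : ((c - c').factorial : ℝ) ≤ (c : ℝ) ^ (c - c') := by
    have h := Nat.factorial_le_pow (c - c')
    have h' : (c - c') ^ (c - c') ≤ c ^ (c - c') := Nat.pow_le_pow_left (Nat.sub_le _ _) _
    exact_mod_cast h.trans h'
  have h3 : (c : ℝ) * (2 * k) = 4 * N := by
    have : (c : ℝ) * k = 2 * N := by exact_mod_cast hck
    linarith
  have h4 : 4 * (N : ℝ) ≤ Real.exp 1 * A ^ k := by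
    rw [div_le_iff₀ (Real.exp_pos _)] at hA; linarith
  have hA0 : 0 ≤ A ^ k := le_trans (by positivity) hA
  unfold Bc
  calc _ ≤ (4:ℝ) ^ c * (c : ℝ) ^ (c - c') * (2 * k) ^ (c - c') := by gcongr
    _ = 4 ^ c * (4 * N) ^ (c - c') := by rw [mul_assoc, ← mul_pow, h3]
    _ ≤ 4 ^ c * (Real.exp 1 * A ^ k) ^ (c - c') := by gcongr
    _ = 4 ^ c * (Real.exp 1 ^ (c - c') * (A ^ k) ^ (c - c')) := by rw [mul_pow]
    _ ≤ 4 ^ c * (Real.exp 1 ^ c * (A ^ k) ^ (c - c')) := by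
        gcongr
        · exact Nat.sub_le _ _
    _ = _ := by ring

theorem bad_le (c k N : ℕ) (v : ℕ → ℂ) (hck : c * k = 2 * N) (hk : 0 < k) (A θ Y M : ℝ) (hA0 : 0 ≤ A)
    (hA : 4 * (N : ℝ) / Real.exp 1 ≤ A ^ k) (hAY : A ≤ Y) (hθ0 : 0 ≤ θ) (hθ : θ ≤ 1)
    (hM0 : 0 ≤ M) (hp : ‖pp v k‖ ≤ k * M ^ k) (hMY : M ^ 2 ≤ θ ^ 10 * Y) :
    Sv c k v ≤ (8 * Real.exp 1 * (k : ℝ) ^ 2) ^ c * (θ ^ (2 * N) * Y ^ (2 * N)) := by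
  have e1 : (1:ℝ) ≤ Real.exp 1 := by have := Real.add_one_le_exp (1:ℝ); linarith
  have hk1 : (1:ℝ) ≤ k := by exact_mod_cast hk
  have hY0 : 0 ≤ Y := hA0.trans hAY
  have key : ∀ c' ∈ Big c, Bc c k c' * ‖pp v k‖ ^ (2 * c') ≤
      (4 * Real.exp 1 * (k : ℝ) ^ 2) ^ c * (θ ^ (2 * N) * Y ^ (2 * N)) := by
    intro c' hc'
    simp only [Big, Finset.mem_filter, Finset.mem_range] at hc'
    have hcc : c' ≤ c := by omega
    have h1 : ‖pp v k‖ ^ (2 * c') ≤ ((k : ℝ) ^ 2) ^ c * (θ ^ (2 * N) * (Y ^ k) ^ c') := by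
      calc ‖pp v k‖ ^ (2 * c') ≤ (k * M ^ k) ^ (2 * c') := by gcongr
        _ = ((k : ℝ) ^ 2) ^ c' * ((M ^ 2) ^ k) ^ c' := by ring
        _ ≤ ((k : ℝ) ^ 2) ^ c * ((θ ^ 10 * Y) ^ k) ^ c' := by
            gcongr
            exact one_le_pow₀ hk1
        _ = ((k : ℝ) ^ 2) ^ c * (θ ^ (10 * k * c') * (Y ^ k) ^ c') := by ring
        _ ≤ _ := by
            have : 2 * N ≤ 10 * k * c' := by
              rw [← hck]; nlinarith
            gcongr ?_ * (?_ * _)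
            exact pow_le_pow_of_le_one hθ0 hθ this
    calc _ ≤ (4 ^ c * Real.exp 1 ^ c * (A ^ k) ^ (c - c')) * (((k : ℝ) ^ 2) ^ c * (θ ^ (2 * N) * (Y ^ k) ^ c')) := by
          gcongr
          exact Bc_le c k N c' hck A hA
      _ ≤ (4 ^ c * Real.exp 1 ^ c * (Y ^ k) ^ (c - c')) * (((k : ℝ) ^ 2) ^ c * (θ ^ (2 * N) * (Y ^ k) ^ c')) := by
          gcongr
      _ = 4 ^ c * Real.exp 1 ^ c * ((k : ℝ) ^ 2) ^ c * (θ ^ (2 * N) * ((Y ^ k) ^ (c - c') * (Y ^ k) ^ c')) := by ring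
      _ = _ := by
          rw [← pow_add, Nat.sub_add_cancel hcc, ← mul_pow, ← mul_pow, ← pow_mul, ← hck, mul_comm k c]
  unfold Sv
  refine (Finset.sum_le_card_nsmul _ _ _ key).trans ?_
  rw [nsmul_eq_mul]
  have hcard : ((Big c).card : ℝ) ≤ 2 ^ c := by
    have h1 : (Big c).card ≤ c + 1 := by
      refine (Finset.card_filter_le _ _).trans ?_
      simp
    have h2 : c + 1 ≤ 2 ^ c := Nat.lt_two_pow_self
    exact_mod_cast h1.trans h2
  calc _ ≤ (2:ℝ) ^ c * ((4 * Real.exp 1 * (k : ℝ) ^ 2) ^ c * (θ ^ (2 * N) * Y ^ (2 * N))) := by gcongr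
    _ = _ := by rw [← mul_assoc, ← mul_pow]; ring

/-- the polynomial factors are subexponential -/
theorem G_small (θ : ℝ) (hθ0 : 0 < θ) (hθ1 : θ < 1) : ∃ k0 : ℕ, ∀ k, k0 ≤ k → ∀ c N : ℕ, c * k = 2 * N →
    (8 * Real.exp 1 * (k : ℝ) ^ 2) ^ c * θ ^ N ≤ 1 := by
  set q := Real.sqrt θ with hq
  have hq0 : 0 < q := Real.sqrt_pos.2 hθ0
  have hqq : q ^ 2 = θ := Real.sq_sqrt hθ0.le
  have hq1 : q < 1 := by nlinarith
  have ht : Filter.Tendsto (fun k : ℕ => 8 * Real.exp 1 * ((k : ℝ) ^ 2 * q ^ k)) Filter.atTop (nhds (8 * Real.exp 1 * 0)) :=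
    (tendsto_pow_const_mul_const_pow_of_lt_one 2 hq0.le hq1).const_mul _
  rw [mul_zero] at ht
  obtain ⟨k0, hk0⟩ := Filter.eventually_atTop.1 (ht.eventually (gt_mem_nhds one_pos))
  refine ⟨k0, fun k hk c N hck => ?_⟩
  have h1 := (hk0 k hk).le
  have h2 : θ ^ N = (q ^ k) ^ c := by rw [← hqq, ← pow_mul, ← pow_mul, ← hck, mul_comm]
  rw [h2, ← mul_pow]
  refine pow_le_one₀ (by positivity) ?_
  rw [mul_assoc]; exact h1

end

end modG2

section modG3
section
open ComplexConjugate

/-- complete homogeneous polynomials in two variables -/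
def Hr (t s : ℂ) : ℕ → ℂ
  | 0 => 1
  | m + 1 => s * Hr t s m + t ^ (m + 1)

/-- divided differences of powers -/
def gr (x w : ℂ) : ℕ → ℂ
  | 0 => 0
  | m + 1 => w * gr x w m + x ^ m

theorem Hr_sum (t s : ℂ) (K : ℕ) :
    (1 - t) * (1 - s) * ∑ m ∈ Finset.range (K + 1), Hr t s m = 1 - Hr t s (K + 1) + t * s * Hr t s K := by
  induction K with
  | zero => simp [Hr]; ring
  | succ K ih =>
    rw [Finset.sum_range_succ, mul_add, ih]
    have h1 : Hr t s (K + 2) = s * Hr t s (K + 1) + t ^ (K + 2) := rfl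
    have h2 : Hr t s (K + 1) = s * Hr t s K + t ^ (K + 1) := rfl
    rw [h1, h2]; ring

theorem Hr_norm (t s : ℂ) (b : ℝ) (ht : ‖t‖ ≤ b) (hs : ‖s‖ ≤ b) (m : ℕ) : ‖Hr t s m‖ ≤ (m + 1) * b ^ m := by
  have hb : 0 ≤ b := (norm_nonneg _).trans ht
  induction m with
  | zero => simp [Hr]
  | succ m ih =>
    rw [Hr]
    refine (norm_add_le _ _).trans ?_
    rw [norm_mul, norm_pow]
    calc _ ≤ b * ((m + 1) * b ^ m) + b ^ (m + 1) := by gcongr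
      _ = _ := by push_cast; ring

theorem gr_norm (x w : ℂ) (b : ℝ) (ht : ‖x‖ ≤ b) (hs : ‖w‖ ≤ b) (m : ℕ) : b * ‖gr x w m‖ ≤ m * b ^ m := by
  have hb : 0 ≤ b := (norm_nonneg _).trans ht
  induction m with
  | zero => simp [gr]
  | succ m ih =>
    rw [gr]
    have h1 : ‖w * gr x w m + x ^ m‖ ≤ b * ‖gr x w m‖ + b ^ m := by
      refine (norm_add_le _ _).trans ?_
      rw [norm_mul, norm_pow]
      gcongr
    calc _ ≤ b * (m * b ^ m + b ^ m) := by gcongr; linarith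
      _ = _ := by push_cast; ring

theorem gr_Hr (x w : ℂ) (m : ℕ) : conj w ^ (m + 1) * gr x w (m + 1) = conj w * Hr (conj w * x) (conj w * w) m := by
  induction m with
  | zero => simp [gr, Hr]
  | succ m ih =>
    rw [gr, Hr]
    calc _ = conj w * w * (conj w ^ (m + 1) * gr x w (m + 1)) + conj w ^ (m + 2) * x ^ (m + 1) := by ring
      _ = _ := by rw [ih]; ring

theorem sq_geom (n : ℕ) : ∑ l ∈ Finset.range n, (l : ℝ) ^ 2 * (361 / 400 : ℝ) ^ l ≤ 1855 := by
  have : ∀ n : ℕ, ∑ l ∈ Finset.range n, (l : ℝ) ^ 2 * (361 / 400 : ℝ) ^ l =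
     109888400 / 59319 - (361/400 : ℝ) ^ n * (400 / 39 * (n : ℝ) ^ 2 + 2 * 361 * 400 / 39 ^ 2 * n + 109888400 / 59319) := by
    intro n
    induction n with
    | zero => norm_num
    | succ n ih => rw [Finset.sum_range_succ, ih]; push_cast; ring
  rw [this]
  have : 0 ≤ (361/400 : ℝ) ^ n * (400 / 39 * (n : ℝ) ^ 2 + 2 * 361 * 400 / 39 ^ 2 * n + 109888400 / 59319) := by positivity
  have h2 : (109888400 / 59319 : ℝ) ≤ 1855 := by norm_num
  linarith

theorem good_struct (K : ℕ) (u : ℕ → ℂ) (w : ℂ) (s V E : ℝ) (hs : s = ‖w‖ ^ 2)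
    (hw : ∑ l ∈ Finset.range K, u l * w ^ (l + 2) = 1)
    (hV : V = ∑ l ∈ Finset.range K, s ^ (l + 2))
    (hE : E = ∑ l ∈ Finset.range K, ‖u l - conj w ^ (l + 2) / V‖ ^ 2)
    (hgood : s ^ 2 * (1 + ∑ l ∈ Finset.range K, ‖u l‖ ^ 2) < 3 / 4 * (1 + 1 / 10 ^ 7)) :
    0 < s ∧ s < 1 ∧ 0 < V ∧ (1 - s) * V ≤ s ^ 2 ∧ (s - 1 / 2) ^ 2 + s ^ 2 * E ≤ 3 / 4 / 10 ^ 7 := by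
  have hK : K ≠ 0 := by rintro rfl; simp at hw
  have hw0 : w ≠ 0 := by rintro rfl; simp at hw
  have hs0 : 0 < s := by rw [hs]; positivity
  have hX : 0 ≤ ∑ l ∈ Finset.range K, ‖u l‖ ^ 2 := Finset.sum_nonneg fun _ _ => by positivity
  have hs1 : s < 1 := by
    by_contra h
    push Not at h
    have : 1 ≤ s ^ 2 := one_le_pow₀ h
    nlinarith
  have hV0 : 0 < V := by
    rw [hV]; exact Finset.sum_pos (fun _ _ => by positivity) (Finset.nonempty_range_iff.2 hK)
  have hV1 : (1 - s) * V ≤ s ^ 2 := by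
    have : (1 - s) * V = s ^ 2 * (1 - s ^ K) := by
      rw [hV, ← mul_neg_geom_sum, mul_left_comm, Finset.mul_sum (a := s ^ 2)]
      refine congrArg _ (Finset.sum_congr rfl fun _ _ => by ring)
    rw [this]
    have : 0 ≤ s ^ K := by positivity
    have : 0 ≤ s ^ 2 := by positivity
    nlinarith
  refine ⟨hs0, hs1, hV0, hV1, ?_⟩
  have hE1 : E = ∑ l ∈ Finset.range K, ‖u l‖ ^ 2 - 1 / V := by
    have h1 : ∀ l, ‖u l - conj w ^ (l + 2) / V‖ ^ 2 = ‖u l‖ ^ 2 + s ^ (l + 2) / V ^ 2 - 2 / V * (u l * w ^ (l + 2)).re := by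
      intro l
      rw [← Complex.normSq_eq_norm_sq, Complex.normSq_sub, Complex.normSq_eq_norm_sq, Complex.normSq_eq_norm_sq]
      have a1 : ‖conj w ^ (l + 2) / (V : ℂ)‖ ^ 2 = s ^ (l + 2) / V ^ 2 := by
        rw [norm_div, norm_pow, div_pow, Complex.norm_conj, ← pow_mul, mul_comm, pow_mul, hs]
        simp
      have a2 : (u l * conj (conj w ^ (l + 2) / (V : ℂ))).re = (u l * w ^ (l + 2)).re / V := by
        rw [map_div₀, map_pow, Complex.conj_conj, Complex.conj_ofReal, ← mul_div_assoc, Complex.div_ofReal_re]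
      rw [a1, a2]; ring
    rw [hE, Finset.sum_congr rfl fun l _ => h1 l, Finset.sum_sub_distrib, Finset.sum_add_distrib, ← Finset.sum_div, ← hV, ← Finset.mul_sum,
      ← Complex.re_sum, hw, Complex.one_re]
    field_simp
    ring
  have h2 : 1 - s ≤ s ^ 2 * (1 / V) := by
    rw [mul_one_div, le_div_iff₀ hV0]; exact hV1
  rw [hE1]
  nlinarith

set_option maxHeartbeats 1000000 in
theorem sep (K : ℕ) (u : ℕ → ℂ) (w x : ℂ) (hw : ∑ l ∈ Finset.range K, u l * w ^ (l + 2) = 1)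
    (hgood : (‖w‖ ^ 2) ^ 2 * (1 + ∑ l ∈ Finset.range K, ‖u l‖ ^ 2) < 3 / 4 * (1 + 1 / 10 ^ 7))
    (hx : ‖x‖ ≤ 19 / 20) (hK : (K + 2) * (71 / 100 : ℝ) ^ K ≤ 1 / 200) :
    ‖w‖ ^ 2 ≤ 5003 / 10000 ∧ ∑ l ∈ Finset.range K, u l * gr x w (l + 2) ≠ 0 := by
  obtain ⟨s, hs⟩ : ∃ s, s = ‖w‖ ^ 2 := ⟨_, rfl⟩
  obtain ⟨V, hV⟩ : ∃ V, V = ∑ l ∈ Finset.range K, s ^ (l + 2) := ⟨_, rfl⟩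
  obtain ⟨E, hE⟩ : ∃ E, E = ∑ l ∈ Finset.range K, ‖u l - conj w ^ (l + 2) / V‖ ^ 2 := ⟨_, rfl⟩
  rw [← hs] at hgood
  obtain ⟨hs0, hs1, hV0, hV1, hm⟩ := good_struct K u w s V E hs hw hV hE hgood
  have hE0 : 0 ≤ E := by rw [hE]; exact Finset.sum_nonneg fun _ _ => by positivity
  have hsE : 0 ≤ s ^ 2 * E := by positivity
  have b1 : s ≤ 5003 / 10000 := by nlinarith
  have b2 : 4997 / 10000 ≤ s := by nlinarith
  have b3 : E ≤ 4 / 10 ^ 7 := by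
    have : (4997 / 10000) ^ 2 * E ≤ s ^ 2 * E := by gcongr
    nlinarith [sq_nonneg (s - 1 / 2)]
  have b4 : V ≤ 51 / 100 := by nlinarith
  have hwn : 7 / 10 ≤ ‖w‖ := by
    by_contra h; push Not at h
    nlinarith [norm_nonneg w]
  have hwn2 : ‖w‖ ≤ 7074 / 10000 := by
    by_contra h; push Not at h
    nlinarith [norm_nonneg w]
  refine ⟨hs ▸ b1, fun h0 => ?_⟩
  set t := conj w * x with ht
  have htn : ‖t‖ ≤ 673 / 1000 := by
    rw [ht, norm_mul, Complex.norm_conj]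
    nlinarith [norm_nonneg w, norm_nonneg x]
  have hsw : conj w * w = (s : ℂ) := by
    rw [mul_comm, Complex.mul_conj, Complex.normSq_eq_norm_sq, hs]
  have hsn : ‖(s : ℂ)‖ = s := by simp [abs_of_pos hs0]
  set SS := ∑ l ∈ Finset.range K, Hr t s (l + 1) with hSS
  set Δ := ∑ l ∈ Finset.range K, (u l - conj w ^ (l + 2) / V) * gr x w (l + 2) with hΔ
  have e1 : conj w * SS = - (V * Δ) := by
    have : ∑ l ∈ Finset.range K, conj w ^ (l + 2) * gr x w (l + 2) = conj w * SS := by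
      rw [hSS, Finset.mul_sum]
      refine Finset.sum_congr rfl fun l _ => ?_
      rw [gr_Hr x w (l + 1), hsw]
    have hVc : (V : ℂ) ≠ 0 := by exact_mod_cast hV0.ne'
    rw [← this, hΔ, Finset.mul_sum]
    have h2 : ∀ l ∈ Finset.range K, (V : ℂ) * ((u l - conj w ^ (l + 2) / V) * gr x w (l + 2)) =
        V * (u l * gr x w (l + 2)) - conj w ^ (l + 2) * gr x w (l + 2) := by
      intro l _; field_simp
    rw [Finset.sum_congr rfl h2, Finset.sum_sub_distrib, ← Finset.mul_sum, h0]
    ring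
  have e2 : (1 - t) * (1 - s) * SS = t + s - t * s - Hr t s (K + 1) + t * s * Hr t s K := by
    have := Hr_sum t s K
    rw [Finset.sum_range_succ', ← hSS, Hr] at this
    linear_combination this
  have e3 : 15 / 100 ≤ ‖(1 - t) * (1 - s) * SS‖ := by
    have n1 : ‖Hr t s (K + 1)‖ ≤ ((K + 1 : ℕ) + 1) * (71 / 100) ^ (K + 1) :=
      Hr_norm t s _ (htn.trans (by norm_num)) (by rw [hsn]; linarith) _
    have n2 : ‖Hr t s K‖ ≤ (K + 1) * (71 / 100) ^ K :=
      Hr_norm t s _ (htn.trans (by norm_num)) (by rw [hsn]; linarith) _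
    have hp : (0:ℝ) ≤ (71 / 100) ^ K := by positivity
    have n1' : ‖Hr t s (K + 1)‖ ≤ 1 / 200 := by
      refine n1.trans ?_
      push_cast
      rw [pow_succ]
      have : (0:ℝ) ≤ K * (71 / 100) ^ K := by positivity
      nlinarith
    have n2' : ‖t * s * Hr t s K‖ ≤ 1 / 200 := by
      rw [norm_mul, norm_mul, hsn]
      have : ‖Hr t s K‖ ≤ 1 / 200 := by linarith
      have h3 : ‖t‖ * s ≤ 1 := mul_le_one₀ (by linarith) hs0.le hs1.le
      calc _ ≤ 1 * (1 / 200 : ℝ) := mul_le_mul h3 this (norm_nonneg _) one_pos.le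
        _ = _ := one_mul _
    have n3 : 16 / 100 ≤ ‖t + s - t * s‖ := by
      have h1 : ‖(s:ℂ)‖ - ‖t * (1 - s)‖ ≤ ‖t + s - t * s‖ := by
        have := norm_sub_norm_le (s : ℂ) (-(t * (1 - s)))
        rw [norm_neg] at this
        refine this.trans (le_of_eq (congrArg _ (by ring)))
      have h2 : ‖(1 - s : ℂ)‖ = 1 - s := by
        rw [show (1 - s : ℂ) = ((1 - s : ℝ) : ℂ) by push_cast; rfl, Complex.norm_real, Real.norm_of_nonneg (by linarith)]
      rw [hsn, norm_mul, h2] at h1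
      nlinarith [norm_nonneg t]
    rw [e2]
    have h1 := norm_sub_norm_le (t + s - t * s) (Hr t s (K + 1) - t * s * Hr t s K)
    have h2 := norm_sub_le (Hr t s (K + 1)) (t * s * Hr t s K)
    rw [show t + s - t * s - (Hr t s (K + 1) - t * s * Hr t s K) = t + s - t * s - Hr t s (K + 1) + t * s * Hr t s K by ring] at h1
    linarith
  have e4 : ‖(1 - t) * (1 - s) * SS‖ ≤ 17 / 10 * (51 / 100) * ‖SS‖ := by
    have h2 : ‖(1 - s : ℂ)‖ = 1 - s := by
      rw [show (1 - s : ℂ) = ((1 - s : ℝ) : ℂ) by push_cast; rfl, Complex.norm_real, Real.norm_of_nonneg (by linarith)]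
    have h3 : ‖1 - t‖ ≤ 17 / 10 := by
      refine (norm_sub_le _ _).trans ?_
      rw [norm_one]; linarith
    rw [norm_mul, norm_mul, h2]
    gcongr
    linarith
  have e5 : ‖Δ‖ ^ 2 ≤ (3 / 100) ^ 2 := by
    have c1 : ‖Δ‖ ≤ ∑ l ∈ Finset.range K, ‖u l - conj w ^ (l + 2) / V‖ * ‖gr x w (l + 2)‖ := by
      rw [hΔ]
      refine (norm_sum_le _ _).trans (le_of_eq ?_)
      exact Finset.sum_congr rfl fun _ _ => norm_mul _ _
    have c2 := Finset.sum_mul_sq_le_sq_mul_sq (Finset.range K) (fun l => ‖u l - conj w ^ (l + 2) / V‖) (fun l => ‖gr x w (l + 2)‖)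
    have c3 : ∑ l ∈ Finset.range K, ‖gr x w (l + 2)‖ ^ 2 ≤ 2100 := by
      have d1 : ∀ l, ‖gr x w (l + 2)‖ ^ 2 ≤ 400 / 361 * (((l + 2 : ℕ) : ℝ) ^ 2 * (361 / 400) ^ (l + 2)) := by
        intro l
        have := gr_norm x w (19 / 20) hx (by linarith) (l + 2)
        have h3 : (19 / 20 * ‖gr x w (l + 2)‖) ^ 2 ≤ (((l + 2 : ℕ) : ℝ) * (19 / 20) ^ (l + 2)) ^ 2 := by gcongr
        rw [mul_pow, mul_pow, ← pow_mul (19 / 20 : ℝ), mul_comm (l + 2) 2, pow_mul] at h3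
        norm_num at h3 ⊢
        linarith
      calc _ ≤ ∑ l ∈ Finset.range K, 400 / 361 * (((l + 2 : ℕ) : ℝ) ^ 2 * (361 / 400) ^ (l + 2)) := Finset.sum_le_sum fun l _ => d1 l
        _ = 400 / 361 * ∑ l ∈ Finset.range K, (((l + 2 : ℕ) : ℝ) ^ 2 * (361 / 400) ^ (l + 2)) := by rw [Finset.mul_sum]
        _ ≤ 400 / 361 * ∑ l ∈ Finset.range (K + 2), ((l : ℝ) ^ 2 * (361 / 400) ^ l) := by
            gcongr
            rw [Finset.sum_range_succ', Finset.sum_range_succ']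
            have : (0:ℝ) ≤ ((0 + 1 : ℕ) : ℝ) ^ 2 * (361 / 400) ^ (0 + 1) := by positivity
            have : (0:ℝ) ≤ ((0 : ℕ) : ℝ) ^ 2 * (361 / 400) ^ 0 := by positivity
            linarith
        _ ≤ 400 / 361 * 1855 := by gcongr; exact sq_geom _
        _ ≤ 2100 := by norm_num
    calc ‖Δ‖ ^ 2 ≤ (∑ l ∈ Finset.range K, ‖u l - conj w ^ (l + 2) / V‖ * ‖gr x w (l + 2)‖) ^ 2 := by gcongr
      _ ≤ E * ∑ l ∈ Finset.range K, ‖gr x w (l + 2)‖ ^ 2 := by rw [hE]; exact c2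
      _ ≤ 4 / 10 ^ 7 * 2100 := by gcongr
      _ ≤ _ := by norm_num
  have e6 : ‖Δ‖ ≤ 3 / 100 := le_of_sq_le_sq e5 (by norm_num)
  have e7 := congrArg norm e1
  rw [norm_mul, norm_neg, norm_mul, Complex.norm_conj, Complex.norm_real, Real.norm_of_nonneg hV0.le] at e7
  have e8 : 17 / 100 ≤ ‖SS‖ := by linarith
  have e9 : V * ‖Δ‖ ≤ 51 / 100 * (3 / 100) := by gcongr
  nlinarith [norm_nonneg SS]

end

end modG3

section modG4
section

noncomputable def XX (k : ℕ) (v : ℕ → ℂ) : ℝ := ∑ l ∈ Finset.range (k + 1), ‖v l‖ ^ 2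

theorem XX_nonneg (k : ℕ) (v : ℕ → ℂ) : 0 ≤ XX k v := Finset.sum_nonneg fun _ _ => by positivity

noncomputable def gP (w : ℂ) : ℕ → Polynomial ℂ
  | 0 => 0
  | m + 1 => Polynomial.C w * gP w m + Polynomial.X ^ m

theorem gP_mul (w : ℂ) (m : ℕ) : (Polynomial.X - Polynomial.C w) * gP w m = Polynomial.X ^ m - Polynomial.C (w ^ m) := by
  induction m with
  | zero => simp [gP]
  | succ m ih =>
    rw [gP, mul_add, mul_left_comm, ih, pow_succ w, Polynomial.C_mul]; ring

theorem gP_eval (x w : ℂ) (m : ℕ) : (gP w m).eval x = gr x w m := by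
  induction m with
  | zero => simp [gP, gr]
  | succ m ih => simp [gP, gr, ih]

theorem good_roots (k : ℕ) (v : ℕ → ℂ) (hk : 0 < k) (hv0 : v 0 = 0) (hv1 : v 1 = 0) (w : ℂ) (hw : w ∈ (Fv k v).roots)
    (hgood : (‖w‖ ^ 2) ^ 2 * (1 + XX k v) < 3 / 4 * (1 + 1 / 10 ^ 7))
    (hK : (k + 1) * (71 / 100 : ℝ) ^ (k - 1) ≤ 1 / 200) :
    ‖w‖ ^ 2 ≤ 5003 / 10000 ∧ ∃ W : Multiset ℂ, (Fv k v).roots = w ::ₘ W ∧ ∀ x ∈ W, 19 / 20 < ‖x‖ := by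
  obtain ⟨K, rfl⟩ : ∃ K, k = K + 1 := ⟨k - 1, by omega⟩
  have hw1 := Fv_root _ v w hw
  have hne := Fv_ne (K + 1) v hv0
  rw [Finset.sum_range_succ', Finset.sum_range_succ'] at hw1
  simp only [zero_add, hv0, hv1, zero_mul, add_zero] at hw1
  unfold XX at hgood
  rw [Finset.sum_range_succ', Finset.sum_range_succ'] at hgood
  simp only [zero_add, hv0, hv1, norm_zero, add_zero, ne_eq, OfNat.ofNat_ne_zero, not_false_eq_true, zero_pow] at hgood
  have hK' : (K + 2) * (71 / 100 : ℝ) ^ K ≤ 1 / 200 := by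
    refine le_trans (le_of_eq ?_) hK
    push_cast; rw [show ((K:ℝ) + 2) = K + 1 + 1 by ring]
  have hsep := fun x hx => sep K (fun l => v (l + 2)) w x hw1 hgood hx hK'
  refine ⟨(hsep 0 (by norm_num)).1, ?_⟩
  set Q : Polynomial ℂ := - ∑ l ∈ Finset.range K, Polynomial.C (v (l + 2)) * gP w (l + 2) with hQ
  have hF : Fv (K + 1) v = (Polynomial.X - Polynomial.C w) * Q := by
    rw [Fv, Finset.sum_range_succ', Finset.sum_range_succ', hQ, mul_neg, Finset.mul_sum]
    have : ∀ l ∈ Finset.range K, (Polynomial.X - Polynomial.C w) * (Polynomial.C (v (l + 2)) * gP w (l + 2)) =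
        Polynomial.C (v (l + 2)) * Polynomial.X ^ (l + 2) - Polynomial.C (v (l + 2) * w ^ (l + 2)) := by
      intro l _
      rw [mul_left_comm, gP_mul, Polynomial.C_mul]; ring
    rw [Finset.sum_congr rfl this, Finset.sum_sub_distrib, ← map_sum, hw1]
    simp [hv0, hv1]
  rw [hF] at hne
  refine ⟨Q.roots, ?_, ?_⟩
  · rw [hF, Polynomial.roots_mul hne, Polynomial.roots_X_sub_C, Multiset.singleton_add]
  · intro x hx
    by_contra h
    push Not at h
    refine (hsep x h).2 ?_
    have := (Polynomial.mem_roots'.1 hx).2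
    rw [Polynomial.IsRoot, hQ, Polynomial.eval_neg, neg_eq_zero, Polynomial.eval_finsetSum] at this
    rw [← this]
    refine Finset.sum_congr rfl fun l _ => ?_
    rw [Polynomial.eval_mul, Polynomial.eval_C, gP_eval]

theorem dev_le (w : ℂ) (hw0 : w ≠ 0) (hw : ‖w‖ ^ 2 ≤ 5003 / 10000) (W : Multiset ℂ) (hW : ∀ x ∈ W, 19 / 20 < ‖x‖) (j : ℕ) :
    ‖w ^ j * (((w ::ₘ W).map (fun x => (x⁻¹) ^ j)).sum) - 1‖ ≤ W.card * (3 / 4) ^ j := by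
  have hwn2 : ‖w‖ ≤ 7125 / 10000 := by
    by_contra h; push Not at h
    nlinarith [norm_nonneg w]
  have h1 : w ^ j * (((w ::ₘ W).map (fun x => (x⁻¹) ^ j)).sum) - 1 = w ^ j * (W.map (fun x => (x⁻¹) ^ j)).sum := by
    rw [Multiset.map_cons, Multiset.sum_cons, mul_add, ← mul_pow, mul_inv_cancel₀ hw0]; simp
  rw [h1]
  clear h1
  induction W using Multiset.induction_on with
  | empty => simp
  | cons x W ih =>
    have h2 := ih fun y hy => hW y (Multiset.mem_cons_of_mem hy)
    rw [Multiset.map_cons, Multiset.sum_cons, mul_add, ← mul_pow, Multiset.card_cons]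
    have hx := hW x (Multiset.mem_cons_self _ _)
    have h3 : ‖(w * x⁻¹) ^ j‖ ≤ (3 / 4) ^ j := by
      rw [norm_pow]
      refine pow_le_pow_left₀ (norm_nonneg _) ?_ _
      rw [norm_mul, norm_inv, ← div_eq_mul_inv, div_le_iff₀ (by linarith)]
      linarith
    refine (norm_add_le _ _).trans ?_
    push_cast
    linarith

theorem Bsum_le (c k : ℕ) (y : ℝ) (hy : 0 ≤ y) : ∑ c' ∈ Big c, Bc c k c' * y ^ (c - c') ≤ Real.exp (2 * k * (c : ℝ) ^ 2 * y) := by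
  have h1 : ∑ c' ∈ Big c, Bc c k c' * y ^ (c - c') ≤ ∑ c' ∈ Finset.range (c + 1), Bc c k c' * y ^ (c - c') :=
    Finset.sum_le_sum_of_subset_of_nonneg (Finset.filter_subset _ _) fun i _ _ => mul_nonneg (Bc_nonneg _ _ _) (by positivity)
  refine h1.trans ?_
  rw [← Finset.sum_range_reflect]
  refine le_trans ?_ (Real.sum_le_exp_of_nonneg (x := 2 * k * (c : ℝ) ^ 2 * y) (by positivity) (c + 1))
  refine Finset.sum_le_sum fun j hj => ?_
  have hj' : j ≤ c := by have := Finset.mem_range.1 hj; omega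
  rw [show c + 1 - 1 - j = c - j by omega, Bc, Nat.choose_symm hj', show c - (c - j) = j by omega, le_div_iff₀ (by positivity)]
  have h2 : ((c.choose j : ℕ) : ℝ) * (j.factorial : ℝ) ≤ (c : ℝ) ^ j := by
    have : c.choose j * j.factorial ≤ c ^ j := by
      rw [mul_comm, ← Nat.descFactorial_eq_factorial_mul_choose]; exact Nat.descFactorial_le_pow _ _
    exact_mod_cast this
  calc _ = (((c.choose j : ℕ) : ℝ) * (j.factorial : ℝ)) ^ 2 * ((2 * k) ^ j * y ^ j) := by ring
    _ ≤ ((c : ℝ) ^ j) ^ 2 * ((2 * k) ^ j * y ^ j) := by gcongr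
    _ = _ := by rw [mul_pow, mul_pow]; ring

theorem good_le (c k N : ℕ) (v : ℕ → ℂ) (hck : c * k = 2 * N) (hk : 0 < k) (hc : 0 < c) (w : ℂ) (hw0 : w ≠ 0)
    (hw : ‖w‖ ^ 2 ≤ 5003 / 10000) (hA : 4 * (N : ℝ) / Real.exp 1 ≤ (2 / Real.sqrt 3) ^ k)
    (hp : ∀ j, 0 < j → ‖w ^ j * pp v j - 1‖ ≤ k * (3 / 4) ^ j)
    (ε : ℝ) (hε : 0 < ε) (hD : k * (3 / 4 : ℝ) ^ k < 1)
    (hk2 : Real.exp (8 * (9 / 10) ^ k) ≤ (1 + ε) * (1 - k * (3 / 4) ^ k) ^ 2) :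
    Sv c k v ≤ (1 + ε) * ‖pp v (2 * N)‖ ^ 2 := by
  set D : ℝ := k * (3 / 4) ^ k with hDdef
  have hD0 : 0 ≤ D := by positivity
  set s := ‖w‖ ^ 2 with hs
  have hs0 : 0 < s := by positivity
  have h3 : Real.sqrt 3 ^ 2 = 3 := Real.sq_sqrt (by norm_num)
  have h3' : 0 < Real.sqrt 3 := by positivity
  set A := 2 / Real.sqrt 3 with hAdef
  have hA2 : A ^ 2 = 4 / 3 := by rw [hAdef, div_pow, h3]; norm_num
  have hA0 : 0 < A := by positivity
  have hA1 : A ≤ 12 / 10 := by nlinarith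
  have hN4 : 4 * (N : ℝ) ≤ Real.exp 1 * A ^ k := by
    rw [div_le_iff₀ (Real.exp_pos _)] at hA; linarith
  have hck' : (c : ℝ) * k = 2 * N := by exact_mod_cast hck
  have he : Real.exp 1 ≤ 3 := by have := Real.exp_one_lt_d9; linarith
  have ex1 : 2 * c * D ≤ 3 * (9 / 10) ^ k := by
    calc 2 * c * D = 4 * N * (3 / 4) ^ k := by rw [hDdef]; linear_combination 2 * (3 / 4 : ℝ) ^ k * hck'
      _ ≤ Real.exp 1 * A ^ k * (3 / 4) ^ k := by gcongr
      _ = Real.exp 1 * (A * (3 / 4)) ^ k := by rw [mul_pow]; ring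
      _ ≤ 3 * (9 / 10) ^ k := by gcongr; linarith
  have ex2 : 2 * k * (c : ℝ) ^ 2 * s ^ k ≤ 5 * (9 / 10) ^ k := by
    have hk1 : (1:ℝ) ≤ k := by exact_mod_cast hk
    calc 2 * k * (c : ℝ) ^ 2 * s ^ k ≤ 2 * k * (c : ℝ) ^ 2 * s ^ k * k := le_mul_of_one_le_right (by positivity) hk1
      _ = 1 / 2 * (4 * N) ^ 2 * s ^ k := by linear_combination 2 * s ^ k * (c * k + 2 * N) * hck'
      _ ≤ 1 / 2 * (Real.exp 1 * A ^ k) ^ 2 * s ^ k := by gcongr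
      _ = 1 / 2 * Real.exp 1 ^ 2 * (A ^ 2 * s) ^ k := by rw [mul_pow, mul_pow, ← pow_mul, ← pow_mul, mul_comm k 2]; ring
      _ ≤ 1 / 2 * 3 ^ 2 * (9 / 10) ^ k := by gcongr; rw [hA2]; linarith
      _ ≤ _ := by gcongr; norm_num
  set P := ‖pp v k‖ with hP
  have hα : ‖w‖ ^ k * P ≤ 1 + D := by
    have := hp k hk
    have h2 := norm_sub_norm_le (w ^ k * pp v k) 1
    rw [norm_one, norm_mul, norm_pow] at h2
    linarith
  have hβ : 1 - D ≤ ‖w‖ ^ (2 * N) * ‖pp v (2 * N)‖ := by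
    have h1 := hp (2 * N) (by rw [← hck]; positivity)
    have h2 := norm_sub_norm_le 1 (w ^ (2 * N) * pp v (2 * N))
    rw [norm_one, norm_mul, norm_pow, norm_sub_rev] at h2
    have h3 : k * (3 / 4 : ℝ) ^ (2 * N) ≤ D := by
      rw [hDdef]
      gcongr ?_ * ?_
      refine pow_le_pow_of_le_one (by norm_num) (by norm_num) ?_
      rw [← hck]; exact Nat.le_mul_of_pos_left _ hc
    linarith
  have hsN : s ^ (2 * N) = (‖w‖ ^ (2 * N)) ^ 2 := by rw [hs, ← pow_mul, ← pow_mul, mul_comm]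
  have m1 : s ^ (2 * N) * Sv c k v ≤ Real.exp (8 * (9 / 10) ^ k) := by
    have t1 : ∀ c' ∈ Big c, s ^ (2 * N) * (Bc c k c' * P ^ (2 * c')) ≤ (1 + D) ^ (2 * c) * (Bc c k c' * (s ^ k) ^ (c - c')) := by
      intro c' hc'
      simp only [Big, Finset.mem_filter, Finset.mem_range] at hc'
      have hcc : c' ≤ c := by omega
      have hB := Bc_nonneg c k c'
      have e1 : s ^ (2 * N) = (s ^ k) ^ (c - c') * (s ^ k) ^ c' := by
        rw [← pow_add, Nat.sub_add_cancel hcc, ← hck, mul_comm c k]; exact pow_mul s k c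
      have e2 : (s ^ k) ^ c' * P ^ (2 * c') = (‖w‖ ^ k * P) ^ (2 * c') := by rw [hs]; ring
      calc _ = (Bc c k c' * (s ^ k) ^ (c - c')) * ((s ^ k) ^ c' * P ^ (2 * c')) := by rw [e1]; ring
        _ ≤ (Bc c k c' * (s ^ k) ^ (c - c')) * (1 + D) ^ (2 * c') := by rw [e2]; gcongr
        _ ≤ (Bc c k c' * (s ^ k) ^ (c - c')) * (1 + D) ^ (2 * c) := by gcongr; linarith
        _ = _ := by ring
    rw [Sv, Finset.mul_sum]
    refine (Finset.sum_le_sum t1).trans ?_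
    rw [← Finset.mul_sum]
    have t2 := Bsum_le c k (s ^ k) (by positivity)
    have t3 : (1 + D) ^ (2 * c) ≤ Real.exp (2 * c * D) := by
      have : 1 + D ≤ Real.exp D := by have := Real.add_one_le_exp D; linarith
      calc _ ≤ Real.exp D ^ (2 * c) := by gcongr
        _ = _ := by rw [← Real.exp_nat_mul]; push_cast; ring_nf
    have t4 : 0 ≤ ∑ c' ∈ Big c, Bc c k c' * (s ^ k) ^ (c - c') :=
      Finset.sum_nonneg fun i _ => mul_nonneg (Bc_nonneg _ _ _) (by positivity)
    calc _ ≤ Real.exp (2 * c * D) * Real.exp (2 * k * (c : ℝ) ^ 2 * s ^ k) := by gcongr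
      _ = Real.exp (2 * c * D + 2 * k * (c : ℝ) ^ 2 * s ^ k) := by rw [Real.exp_add]
      _ ≤ _ := by apply Real.exp_le_exp.2; linarith
  have m2 : (1 - D) ^ 2 ≤ s ^ (2 * N) * ‖pp v (2 * N)‖ ^ 2 := by
    rw [hsN, ← mul_pow]
    have : 0 ≤ 1 - D := by linarith
    gcongr
  have m3 : s ^ (2 * N) * Sv c k v ≤ s ^ (2 * N) * ((1 + ε) * ‖pp v (2 * N)‖ ^ 2) := by
    have : 0 ≤ 1 + ε := by linarith
    calc _ ≤ (1 + ε) * (1 - D) ^ 2 := m1.trans hk2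
      _ ≤ (1 + ε) * (s ^ (2 * N) * ‖pp v (2 * N)‖ ^ 2) := by gcongr
      _ = _ := by ring
  exact le_of_mul_le_mul_left m3 (by positivity)

theorem det0 (θ : ℝ) (hθ0 : 0 < θ) (hθ1 : θ < 1) (hθ : 1 ≤ (1 + 1 / 10 ^ 7) * θ ^ 20) (ε : ℝ) (hε : 0 < ε) :
    ∃ k0 : ℕ, ∀ k, k0 ≤ k → ∀ c N : ℕ, c * k = 2 * N → 0 < N → 4 * (N : ℝ) / Real.exp 1 ≤ (2 / Real.sqrt 3) ^ k →
    ∀ v : ℕ → ℂ, v 0 = 0 → v 1 = 0 → (∀ l, k < l → v l = 0) →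
    Sv c k v ≤ (1 + ε) * ‖pp v (2 * N)‖ ^ 2 ∨ Sv c k v ≤ (θ * (4 / 3 * (1 + XX k v))) ^ N := by
  obtain ⟨k1, hk1⟩ := G_small θ hθ0 hθ1
  have l1 : Filter.Tendsto (fun k : ℕ => (k : ℝ) * (3 / 4 : ℝ) ^ k) Filter.atTop (nhds 0) :=
    tendsto_self_mul_const_pow_of_lt_one (by norm_num) (by norm_num)
  have l2 : Filter.Tendsto (fun k : ℕ => (9 / 10 : ℝ) ^ k) Filter.atTop (nhds 0) :=
    tendsto_pow_atTop_nhds_zero_of_lt_one (by norm_num) (by norm_num)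
  have l3 : Filter.Tendsto (fun k : ℕ => ((k : ℝ) + 2) * (71 / 100 : ℝ) ^ k) Filter.atTop (nhds 0) := by
    have a1 : Filter.Tendsto (fun k : ℕ => (k : ℝ) * (71 / 100 : ℝ) ^ k) Filter.atTop (nhds 0) :=
      tendsto_self_mul_const_pow_of_lt_one (by norm_num) (by norm_num)
    have a2 : Filter.Tendsto (fun k : ℕ => (71 / 100 : ℝ) ^ k) Filter.atTop (nhds 0) :=
      tendsto_pow_atTop_nhds_zero_of_lt_one (by norm_num) (by norm_num)
    have := a1.add (a2.const_mul 2)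
    simp only [mul_zero, add_zero] at this
    refine this.congr fun k => by ring
  have l4 : Filter.Tendsto (fun k : ℕ => Real.exp (8 * (9 / 10 : ℝ) ^ k)) Filter.atTop (nhds 1) := by
    have := (Real.continuous_exp.tendsto 0).comp (by simpa using l2.const_mul 8)
    simp only [Real.exp_zero] at this
    exact this
  have l5 : Filter.Tendsto (fun k : ℕ => (1 + ε) * (1 - (k : ℝ) * (3 / 4 : ℝ) ^ k) ^ 2) Filter.atTop (nhds (1 + ε)) := by
    have := ((tendsto_const_nhds (x := (1:ℝ))).sub l1).pow 2 |>.const_mul (1 + ε)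
    simpa using this
  obtain ⟨k2, hk2⟩ := Filter.eventually_atTop.1 (l1.eventually (gt_mem_nhds (show (0:ℝ) < 1 by norm_num)))
  obtain ⟨k3, hk3⟩ := Filter.eventually_atTop.1 (l3.eventually (gt_mem_nhds (show (0:ℝ) < 1 / 200 by norm_num)))
  obtain ⟨k4, hk4⟩ := Filter.eventually_atTop.1 (l4.eventually_lt l5 (by linarith))
  refine ⟨k1 + k2 + k3 + k4 + 1, fun k hk c N hck hN hA v hv0 hv1 hv => ?_⟩
  have hkpos : 0 < k := by omega
  have hcpos : 0 < c := by
    rcases Nat.eq_zero_or_pos c with h | h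
    · subst h; simp at hck; omega
    · exact h
  have hX := XX_nonneg k v
  by_cases h : ∃ w ∈ (Fv k v).roots, (‖w‖ ^ 2) ^ 2 * (1 + XX k v) < 3 / 4 * (1 + 1 / 10 ^ 7)
  · left
    obtain ⟨w, hw, hgood⟩ := h
    have hK := (hk3 (k - 1) (by omega)).le
    rw [Nat.cast_sub hkpos] at hK
    obtain ⟨hws, W, hW, hWR⟩ := good_roots k v hkpos hv0 hv1 w hw hgood (le_trans (le_of_eq (by push_cast; ring)) hK)
    have hw0 := Fv_root_ne k v hv0 w hw
    refine good_le c k N v hck hkpos hcpos w hw0 hws hA (fun j hj => ?_) ε hε (hk2 k (by omega)) (hk4 k (by omega)).le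
    rw [pp_roots k v hv0 hv j hj, hW]
    refine (dev_le w hw0 hws W hWR j).trans ?_
    have h1 : (Fv k v).roots.card ≤ k := (Polynomial.card_roots' _).trans (Fv_deg k v)
    rw [hW, Multiset.card_cons] at h1
    have h2 : W.card ≤ k := by omega
    gcongr
  · right
    push Not at h
    set Y := Real.sqrt (4 / 3 * (1 + XX k v)) with hY
    have hYsq : Y ^ 2 = 4 / 3 * (1 + XX k v) := Real.sq_sqrt (by positivity)
    have hY0 : 0 ≤ Y := Real.sqrt_nonneg _
    have hAY : 2 / Real.sqrt 3 ≤ Y := by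
      apply Real.le_sqrt_of_sq_le
      rw [div_pow, Real.sq_sqrt (by norm_num)]
      linarith
    set M := Real.sqrt (θ ^ 10 * Y) with hM
    have hMsq : M ^ 2 = θ ^ 10 * Y := Real.sq_sqrt (by positivity)
    have hMw : ∀ w ∈ (Fv k v).roots, ‖w⁻¹‖ ≤ M := by
      intro w hw
      have hw0 := Fv_root_ne k v hv0 w hw
      have hwp : 0 < ‖w‖ := norm_pos_iff.2 hw0
      have h1 := h w hw
      apply Real.le_sqrt_of_sq_le
      refine le_of_sq_le_sq ?_ (by positivity)
      rw [norm_inv, mul_pow, hYsq, inv_pow, inv_pow, inv_le_iff_one_le_mul₀ (by positivity)]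
      have h2 : (θ ^ 10) ^ 2 = θ ^ 20 := by ring
      rw [h2]
      calc (1:ℝ) ≤ (1 + 1 / 10 ^ 7) * θ ^ 20 := hθ
        _ = θ ^ 20 * (4 / 3) * (3 / 4 * (1 + 1 / 10 ^ 7)) := by ring
        _ ≤ θ ^ 20 * (4 / 3) * ((‖w‖ ^ 2) ^ 2 * (1 + XX k v)) := by gcongr
        _ = _ := by ring
    have hb := bad_le c k N v hck hkpos (2 / Real.sqrt 3) θ Y M (by positivity) hA hAY hθ0.le hθ1.le (Real.sqrt_nonneg _)
      (pp_norm_le k v hv0 hv M (Real.sqrt_nonneg _) hMw hkpos) hMsq.le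
    have hG := hk1 k (by omega) c N hck
    refine hb.trans ?_
    calc _ = ((8 * Real.exp 1 * (k : ℝ) ^ 2) ^ c * θ ^ N) * (θ ^ N * (Y ^ 2) ^ N) := by ring
      _ ≤ 1 * (θ ^ N * (Y ^ 2) ^ N) := by gcongr
      _ = _ := by rw [one_mul, hYsq, ← mul_pow]

end

end modG4

section modG5
section

theorem hh_scale (r : ℂ) (v : ℕ → ℂ) (j : ℕ) : hh (fun l => r ^ l * v l) j = r ^ j * hh v j := by
  induction j using Nat.strong_induction_on with
  | _ j ih =>
    rcases j with _ | j
    · simp [hh_zero]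
    · rw [hh_succ, hh_succ, Finset.mul_sum]
      refine Finset.sum_congr rfl fun i hi => ?_
      have hi' := Finset.mem_range.1 hi
      rw [ih (j - i) (by omega)]
      have : r ^ (j + 1) = r ^ (i + 1) * r ^ (j - i) := by rw [← pow_add]; congr 1; omega
      rw [this]; ring

theorem pp_scale (r : ℂ) (v : ℕ → ℂ) (j : ℕ) : pp (fun l => r ^ l * v l) j = r ^ j * pp v j := by
  rw [pp_eq, pp_eq, Finset.mul_sum]
  refine Finset.sum_congr rfl fun i hi => ?_
  have hi' := Finset.mem_range.1 hi
  rw [hh_scale]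
  have : r ^ j = r ^ (i + 1) * r ^ (j - 1 - i) := by rw [← pow_add]; congr 1; omega
  rw [this]; ring

theorem det1 (r : ℝ) (hr0 : 0 < r) (hr1 : r < 1) (hr : 1 ≤ (1 + 1 / 10 ^ 7) * r ^ 160) (ε : ℝ) (hε : 0 < ε) :
    ∃ k0 : ℕ, ∀ k, k0 ≤ k → ∀ c N : ℕ, c * k = 2 * N → 0 < N → 4 * (N : ℝ) / Real.exp 1 ≤ (2 / Real.sqrt 3) ^ k →
    ∀ v : ℕ → ℂ, v 0 = 0 → v 1 = 0 → (∀ l, k < l → v l = 0) →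
    Sv c k v ≤ (1 + ε) * ‖pp v (2 * N)‖ ^ 2 +
      (4 / 3 * r ^ 2 * (r ^ 2 + ∑ l ∈ Finset.range (k + 1), r ^ (2 * l) * ‖v l‖ ^ 2)) ^ N := by
  obtain ⟨k0, hk0⟩ := det0 (r ^ 8) (by positivity) (pow_lt_one₀ hr0.le hr1 (by norm_num)) (by rw [← pow_mul]; exact hr) ε hε
  refine ⟨k0, fun k hk c N hck hN hA v hv0 hv1 hv => ?_⟩
  set v' : ℕ → ℂ := fun l => (r : ℂ) ^ l * v l with hv'
  have h := hk0 k hk c N hck hN hA v' (by simp [hv', hv0]) (by simp [hv', hv1]) (fun l hl => by simp [hv', hv l hl])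
  have hX : XX k v' = ∑ l ∈ Finset.range (k + 1), r ^ (2 * l) * ‖v l‖ ^ 2 := by
    refine Finset.sum_congr rfl fun l _ => ?_
    rw [hv', norm_mul, norm_pow, Complex.norm_real, Real.norm_of_nonneg hr0.le, mul_pow, ← pow_mul, mul_comm l 2]
  have hX0 := XX_nonneg k v'
  have hpn : ∀ j, ‖pp v' j‖ = r ^ j * ‖pp v j‖ := by
    intro j
    rw [hv', pp_scale, norm_mul, norm_pow, Complex.norm_real, Real.norm_of_nonneg hr0.le]
  have hS : r ^ (4 * N) * Sv c k v ≤ Sv c k v' := by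
    unfold Sv
    rw [Finset.mul_sum]
    refine Finset.sum_le_sum fun c' hc' => ?_
    simp only [Big, Finset.mem_filter, Finset.mem_range] at hc'
    rw [hpn, mul_pow, mul_left_comm]
    have hB := Bc_nonneg c k c'
    gcongr
    rw [← pow_mul]
    refine pow_le_pow_of_le_one hr0.le hr1.le ?_
    have : 4 * N = k * (2 * c) := by linarith
    rw [this]
    exact Nat.mul_le_mul_left _ (by omega)
  rw [← hX]
  have hr4 : 0 < r ^ (4 * N) := by positivity
  have hnn : 0 ≤ (1 + ε) * ‖pp v (2 * N)‖ ^ 2 := by positivity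
  have hnn2 : 0 ≤ (4 / 3 * r ^ 2 * (r ^ 2 + XX k v')) ^ N := by positivity
  rcases h with h | h
  · have : Sv c k v ≤ (1 + ε) * ‖pp v (2 * N)‖ ^ 2 := by
      refine le_of_mul_le_mul_left (hS.trans (h.trans (le_of_eq ?_))) hr4
      rw [hpn, mul_pow, ← pow_mul]
      ring
    linarith
  · have : Sv c k v ≤ (4 / 3 * r ^ 2 * (r ^ 2 + XX k v')) ^ N := by
      refine le_of_mul_le_mul_left (hS.trans (h.trans ?_)) hr4
      rw [pow_mul, ← mul_pow]
      refine pow_le_pow_left₀ (by positivity) ?_ _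
      have h1 : r ^ 2 * (1 + XX k v') ≤ r ^ 2 + XX k v' := by
        have : r ^ 2 ≤ 1 := pow_le_one₀ hr0.le hr1.le
        nlinarith
      calc r ^ 8 * (4 / 3 * (1 + XX k v')) = r ^ 4 * (4 / 3 * r ^ 2 * (r ^ 2 * (1 + XX k v'))) := by ring
        _ ≤ _ := by gcongr
    linarith

end

end modG5

section modG6
section
open ComplexConjugate MeasureTheory

theorem gauss_norm (n : ℕ) : ∫ z : ℂ, ‖z‖ ^ n * Real.exp (-‖z‖ ^ 2) = Real.pi * Real.Gamma ((n + 2) / 2) := by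
  have := Complex.integral_rpow_mul_exp_neg_mul_rpow (p := 2) (q := n) (b := 1) (by norm_num) (by have : (0:ℝ) ≤ n := by positivity
                                                                                                  linarith) one_pos
  rw [Real.one_rpow] at this
  simp only [Real.rpow_natCast, Real.rpow_ofNat, neg_mul, one_mul] at this
  rw [this]; ring

theorem gauss_norm_int (n : ℕ) : Integrable (fun z : ℂ => ‖z‖ ^ n * Real.exp (-‖z‖ ^ 2)) := by
  apply Integrable.of_integral_ne_zero
  rw [gauss_norm]
  have : 0 < Real.Gamma (((n : ℝ) + 2) / 2) := Real.Gamma_pos_of_pos (by positivity)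
  positivity

noncomputable def gm (a b : ℕ) (z : ℂ) : ℂ := z ^ a * conj z ^ b * (Real.exp (-‖z‖ ^ 2) : ℝ)

theorem gm_int (a b : ℕ) : Integrable (gm a b) := by
  refine (gauss_norm_int (a + b)).mono' ?_ ?_
  · apply Continuous.aestronglyMeasurable
    unfold gm
    fun_prop
  · refine Filter.Eventually.of_forall fun z => le_of_eq ?_
    rw [gm, norm_mul, norm_mul, norm_pow, norm_pow, Complex.norm_conj, Complex.norm_real, Real.norm_of_nonneg (Real.exp_pos _).le, pow_add]

theorem gm_diag (a : ℕ) : ∫ z, gm a a z = (Real.pi * a.factorial : ℝ) := by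
  have h1 : ∀ z, gm a a z = ((‖z‖ ^ (2 * a) * Real.exp (-‖z‖ ^ 2) : ℝ) : ℂ) := by
    intro z
    rw [gm, ← mul_pow, Complex.mul_conj, Complex.normSq_eq_norm_sq]
    push_cast
    rw [pow_mul]
  simp_rw [h1]
  rw [integral_complex_ofReal, gauss_norm]
  have : ((2 * a : ℕ) + 2 : ℝ) / 2 = a + 1 := by push_cast; ring
  rw [this, Real.Gamma_nat_eq_factorial]

theorem gm_off (a b : ℕ) (h : a ≠ b) : ∫ z, gm a b z = 0 := by
  set φ : ℝ := Real.pi / ((a : ℝ) - b) with hφ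
  have hab : (a : ℝ) - b ≠ 0 := by
    intro h0; apply h; have : (a : ℝ) = b := by linarith
    exact_mod_cast this
  set ω := Circle.exp φ with hω
  have hω1 : (ω : ℂ) = Complex.exp (φ * Complex.I) := Circle.coe_exp φ
  have hω2 : (ω : ℂ) ^ a * conj (ω : ℂ) ^ b = -1 := by
    rw [← Circle.coe_inv_eq_conj, hω, ← Circle.exp_neg, Circle.coe_exp, Circle.coe_exp, ← Complex.exp_nat_mul, ← Complex.exp_nat_mul, ← Complex.exp_add,
      ← Complex.exp_pi_mul_I]
    congr 1
    have : ((a : ℂ) - b) * φ = Real.pi := by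
      have : ((a : ℝ) - b) * φ = Real.pi := by rw [hφ]; field_simp
      exact_mod_cast this
    rw [← this]; push_cast; ring
  have hmp := (rotation ω).measurePreserving
  have h1 := hmp.integral_comp (rotation ω).toHomeomorph.measurableEmbedding (gm a b)
  have h2 : ∀ z, gm a b (rotation ω z) = - gm a b z := by
    intro z
    rw [rotation_apply, gm, gm, map_mul, norm_mul, Circle.norm_coe, one_mul]
    linear_combination (z ^ a * conj z ^ b * (Real.exp (-‖z‖ ^ 2) : ℝ)) * hω2
  simp_rw [h2] at h1
  rw [integral_neg] at h1
  have : (2:ℂ) * ∫ z, gm a b z = 0 := by linear_combination -h1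
  simpa using this

open MvPolynomial

noncomputable def gev {k : ℕ} (P : MvPolynomial (Fin (k + 1)) ℕ) (t : ℝ) (z : Fin (k + 1) → ℂ) : ℂ :=
  aeval (fun i => (t : ℂ) * z i) P

theorem gev_eq {k : ℕ} (P : MvPolynomial (Fin (k + 1)) ℕ) (t : ℝ) (z : Fin (k + 1) → ℂ) :
    gev P t z = ∑ m ∈ P.support, (((coeff m P : ℕ) : ℝ) * t ^ m.degree : ℝ) * ∏ i, z i ^ m i := by
  rw [gev, aeval_def, eval₂_eq']
  refine Finset.sum_congr rfl fun m _ => ?_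
  simp only [mul_pow, Finset.prod_mul_distrib, Finset.prod_pow_eq_pow_sum]
  rw [Finsupp.degree_eq_sum]
  push_cast
  simp only [eq_natCast]
  ring

noncomputable def wt {k : ℕ} (z : Fin (k + 1) → ℂ) : ℝ := ∏ i, Real.exp (-‖z i‖ ^ 2)

theorem gev_sq {k : ℕ} (P : MvPolynomial (Fin (k + 1)) ℕ) (t : ℝ) (z : Fin (k + 1) → ℂ) :
    ((‖gev P t z‖ ^ 2 * wt z : ℝ) : ℂ) = ∑ m ∈ P.support, ∑ m' ∈ P.support,
      (((coeff m P : ℕ) : ℝ) * t ^ m.degree * (((coeff m' P : ℕ) : ℝ) * t ^ m'.degree) : ℝ) * ∏ i, gm (m i) (m' i) (z i) := by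
  have h1 : ((‖gev P t z‖ ^ 2 : ℝ) : ℂ) = gev P t z * conj (gev P t z) := by
    rw [Complex.mul_conj, Complex.normSq_eq_norm_sq]
  rw [Complex.ofReal_mul, h1, gev_eq, map_sum, Finset.sum_mul_sum, Finset.sum_mul]
  refine Finset.sum_congr rfl fun m _ => ?_
  rw [Finset.sum_mul]
  refine Finset.sum_congr rfl fun m' _ => ?_
  rw [map_mul, Complex.conj_ofReal, map_prod, wt]
  simp only [gm, Finset.prod_mul_distrib, map_pow]
  push_cast
  ring

theorem gev_term_int {k : ℕ} (m m' : Fin (k + 1) →₀ ℕ) : Integrable (fun z : Fin (k + 1) → ℂ => ∏ i, gm (m i) (m' i) (z i)) :=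
  Integrable.fintype_prod (f := fun i z => gm (m i) (m' i) z) fun i => gm_int _ _

theorem gev_int {k : ℕ} (P : MvPolynomial (Fin (k + 1)) ℕ) (t : ℝ) : Integrable (fun z => ‖gev P t z‖ ^ 2 * wt z) := by
  have h : Integrable (fun z => ((‖gev P t z‖ ^ 2 * wt z : ℝ) : ℂ)) := by
    simp_rw [gev_sq]
    exact integrable_finsetSum _ fun m _ => integrable_finsetSum _ fun m' _ => (gev_term_int m m').const_mul _
  exact h.re

noncomputable def JJ {k : ℕ} (P : MvPolynomial (Fin (k + 1)) ℕ) (x : ℝ) : ℝ :=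
  ∑ m ∈ P.support, ((coeff m P : ℕ) : ℝ) ^ 2 * (pf m : ℝ) * x ^ m.degree

theorem gev_integral {k : ℕ} (P : MvPolynomial (Fin (k + 1)) ℕ) (t : ℝ) :
    ∫ z, ‖gev P t z‖ ^ 2 * wt z = Real.pi ^ (k + 1) * JJ P (t ^ 2) := by
  apply Complex.ofReal_injective
  rw [← integral_complex_ofReal]
  simp_rw [gev_sq]
  rw [integral_finsetSum _ fun m _ => integrable_finsetSum _ fun m' _ => (gev_term_int m m').const_mul _, JJ, Finset.mul_sum, Complex.ofReal_sum]
  refine Finset.sum_congr rfl fun m hm => ?_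
  rw [integral_finsetSum _ fun m' _ => (gev_term_int m m').const_mul _, Finset.sum_eq_single m]
  · rw [integral_const_mul, integral_fintype_prod_volume_eq_prod (fun i z => gm (m i) (m i) z)]
    simp_rw [gm_diag]
    rw [← Complex.ofReal_prod, ← Complex.ofReal_mul]
    congr 1
    rw [Finset.prod_mul_distrib, Finset.prod_const, Finset.card_univ, Fintype.card_fin, pf]
    push_cast
    ring
  · intro m' _ hne
    rw [integral_const_mul, integral_fintype_prod_volume_eq_prod (fun i z => gm (m i) (m' i) z)]
    obtain ⟨i, hi⟩ : ∃ i, m i ≠ m' i := by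
      by_contra h; push Not at h
      exact hne (Finsupp.ext fun i => (h i).symm)
    rw [Finset.prod_eq_zero (Finset.mem_univ i) (gm_off _ _ hi), mul_zero]
  · intro h; exact absurd hm h

end

end modG6

section modG7
section
open MeasureTheory MvPolynomial Set

theorem gamma_df (q : ℕ) : Real.Gamma (q + 1 / 2) = df q * Real.sqrt Real.pi / 2 ^ q := by
  induction q with
  | zero => simp [df, ← one_div, Real.Gamma_one_half_eq]
  | succ q ih =>
    have : ((q + 1 : ℕ) : ℝ) + 1 / 2 = (q + 1 / 2) + 1 := by push_cast; ring
    rw [this, Real.Gamma_add_one (by positivity), ih, df]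
    push_cast
    field_simp
    ring

noncomputable def uw (N : ℕ) (u : ℝ) : ℝ := Real.exp (-u) * u ^ ((N : ℝ) - 1 / 2)

theorem uw_term (N a : ℕ) (ha : a ≤ N) : IntegrableOn (fun u => uw N u * (u⁻¹) ^ a) (Ioi 0) ∧
    ∫ u in Ioi 0, uw N u * (u⁻¹) ^ a = Real.Gamma ((N - a : ℕ) + 1 / 2) := by
  have h0 : ∀ u ∈ Ioi (0:ℝ), Real.exp (-u) * u ^ ((((N - a : ℕ) : ℝ) + 1 / 2) - 1) = uw N u * (u⁻¹) ^ a := by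
    intro u hu
    have hu : 0 < u := hu
    rw [uw, mul_assoc, ← Real.rpow_natCast, Real.inv_rpow hu.le, ← Real.rpow_neg hu.le, ← Real.rpow_add hu, Nat.cast_sub ha]
    congr 2; ring
  constructor
  · refine IntegrableOn.congr_fun (Real.GammaIntegral_convergent (s := ((N - a : ℕ) : ℝ) + 1 / 2) (by positivity)) h0 measurableSet_Ioi
  · rw [Real.Gamma_eq_integral (by positivity)]
    exact (setIntegral_congr_fun measurableSet_Ioi h0).symm

theorem QN_int {k : ℕ} (N : ℕ) (P : MvPolynomial (Fin (k + 1)) ℕ) (hdeg : ∀ m ∈ P.support, m.degree ≤ N) :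
    IntegrableOn (fun u => uw N u * JJ P u⁻¹) (Ioi 0) ∧
    QN N P = 2 ^ N / Real.sqrt Real.pi * ∫ u in Ioi 0, uw N u * JJ P u⁻¹ := by
  have h0 : ∀ u, uw N u * JJ P u⁻¹ = ∑ m ∈ P.support, (((coeff m P : ℕ) : ℝ) ^ 2 * (pf m : ℝ)) * (uw N u * (u⁻¹) ^ m.degree) := by
    intro u
    rw [JJ, Finset.mul_sum]
    exact Finset.sum_congr rfl fun m _ => by ring
  have hi : ∀ m ∈ P.support, IntegrableOn (fun u => (((coeff m P : ℕ) : ℝ) ^ 2 * (pf m : ℝ)) * (uw N u * (u⁻¹) ^ m.degree)) (Ioi 0) :=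
    fun m hm => (uw_term N m.degree (hdeg m hm)).1.const_mul _
  simp_rw [h0]
  refine ⟨integrable_finsetSum _ hi, ?_⟩
  rw [integral_finsetSum _ hi, QN, Finset.mul_sum]
  refine Finset.sum_congr rfl fun m hm => ?_
  rw [integral_const_mul, (uw_term N m.degree (hdeg m hm)).2, gamma_df]
  have hp : (2:ℝ) ^ N = 2 ^ m.degree * 2 ^ (N - m.degree) := by rw [← pow_add]; congr 1; have := hdeg m hm; omega
  have hpi : 0 < Real.sqrt Real.pi := Real.sqrt_pos.2 Real.pi_pos
  rw [hp]
  field_simp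

noncomputable def vz (k : ℕ) (t : ℝ) (z : Fin (k + 1) → ℂ) (l : ℕ) : ℂ :=
  if h : 2 ≤ l ∧ l ≤ k then (t : ℂ) * z ⟨l, by omega⟩ else 0

theorem gev_pp (k : ℕ) (t : ℝ) (z : Fin (k + 1) → ℂ) (j : ℕ) : gev (pp (xs k) j) t z = pp (vz k t z) j := by
  unfold gev
  have h := pp_map (xs k) ((MvPolynomial.aeval (fun i => (t:ℂ) * z i) : MvPolynomial (Fin (k + 1)) ℕ →ₐ[ℕ] ℂ) : MvPolynomial (Fin (k + 1)) ℕ →+* ℂ) j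
  refine h.trans ?_
  congr 1
  funext l
  unfold xs vz
  split_ifs <;> simp

theorem gev_pow {k : ℕ} (P : MvPolynomial (Fin (k + 1)) ℕ) (t : ℝ) (z : Fin (k + 1) → ℂ) (c : ℕ) : gev (P ^ c) t z = gev P t z ^ c := by
  unfold gev; rw [map_pow]

noncomputable def ρw (r : ℝ) (i : ℕ) : ℝ := if 2 ≤ i then r ^ (2 * i) else 0

theorem vz_sum (k : ℕ) (r u : ℝ) (hu : 0 < u) (t : ℝ) (ht : t ^ 2 = u⁻¹) (z : Fin (k + 1) → ℂ) :
    u * ∑ l ∈ Finset.range (k + 1), r ^ (2 * l) * ‖vz k t z l‖ ^ 2 = ∑ i : Fin (k + 1), ρw r i * ‖z i‖ ^ 2 := by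
  rw [Finset.sum_range, Finset.mul_sum]
  refine Finset.sum_congr rfl fun i _ => ?_
  unfold vz ρw
  have := i.2
  by_cases h : 2 ≤ (i : ℕ)
  · rw [dif_pos ⟨h, by omega⟩, if_pos h, norm_mul, mul_pow, Complex.norm_real, Real.norm_eq_abs, sq_abs, ht]
    field_simp
  · rw [dif_neg (by omega), if_neg h]; simp

theorem ρw_le (r : ℝ) (hr0 : 0 < r) (hr1 : r < 1) (i : ℕ) : 0 ≤ ρw r i ∧ ρw r i ≤ r ^ (2 * i) ∧ ρw r i ≤ r ^ 2 := by
  unfold ρw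
  split_ifs with h
  · refine ⟨by positivity, le_rfl, pow_le_pow_of_le_one hr0.le hr1.le (by omega)⟩
  · exact ⟨le_rfl, by positivity, by positivity⟩

theorem gauss1 (a : ℝ) (ha : 0 < a) : ∫ z : ℂ, Real.exp (-a * ‖z‖ ^ 2) = Real.pi / a := by
  have := Complex.integral_exp_neg_mul_rpow (p := 2) (b := a) (by norm_num) ha
  simp only [Real.rpow_ofNat] at this
  rw [this]
  norm_num
  rw [Real.rpow_neg_one]; rfl

theorem gauss1_int (a : ℝ) (ha : 0 < a) : Integrable (fun z : ℂ => Real.exp (-a * ‖z‖ ^ 2)) := by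
  apply Integrable.of_integral_ne_zero
  rw [gauss1 a ha]
  have := Real.pi_pos
  positivity

noncomputable def Ew (k : ℕ) (r : ℝ) (z : Fin (k + 1) → ℂ) : ℝ := ∏ i : Fin (k + 1), Real.exp (-(1 - ρw r i) * ‖z i‖ ^ 2)

theorem Ew_int (k : ℕ) (r : ℝ) (hr0 : 0 < r) (hr1 : r < 1) : Integrable (Ew k r) ∧
    ∫ z, Ew k r z ≤ Real.pi ^ (k + 1) * Real.exp (1 / (1 - r ^ 2) ^ 2) := by
  have hr2 : r ^ 2 < 1 := pow_lt_one₀ hr0.le hr1 (by norm_num)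
  have hpos : ∀ i, 0 < 1 - ρw r i := fun i => by have := (ρw_le r hr0 hr1 i).2.2; linarith
  constructor
  · exact Integrable.fintype_prod (f := fun (i : Fin (k + 1)) z => Real.exp (-(1 - ρw r i) * ‖z‖ ^ 2)) fun i => gauss1_int _ (hpos i)
  · unfold Ew
    rw [integral_fintype_prod_volume_eq_prod (fun (i : Fin (k + 1)) z => Real.exp (-(1 - ρw r i) * ‖z‖ ^ 2))]
    simp_rw [fun i : Fin (k + 1) => gauss1 _ (hpos i)]
    have h1 : ∀ i : Fin (k + 1), Real.pi / (1 - ρw r i) ≤ Real.pi * Real.exp (r ^ (2 * (i : ℕ)) / (1 - r ^ 2)) := by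
      intro i
      obtain ⟨a1, a2, a3⟩ := ρw_le r hr0 hr1 i
      rw [div_eq_mul_one_div]
      have := Real.pi_pos
      gcongr
      have h2 : 1 / (1 - ρw r i) = ρw r i / (1 - ρw r i) + 1 := by have := (hpos i).ne'; field_simp; ring
      rw [h2]
      refine (Real.add_one_le_exp _).trans (Real.exp_le_exp.2 ?_)
      have : 0 < 1 - r ^ 2 := by linarith
      gcongr
    refine (Finset.prod_le_prod (fun (i : Fin (k + 1)) _ => (div_pos Real.pi_pos (hpos (i : ℕ))).le) fun i _ => h1 i).trans ?_
    rw [Finset.prod_mul_distrib, Finset.prod_const, Finset.card_univ, Fintype.card_fin, ← Real.exp_sum, ← Finset.sum_div]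
    refine mul_le_mul_of_nonneg_left (Real.exp_le_exp.2 ?_) (by have := Real.pi_pos; positivity)
    rw [Fin.sum_univ_eq_sum_range (fun i => r ^ (2 * i)), div_le_iff₀ (by linarith)]
    have h3 : ∑ i ∈ Finset.range (k + 1), r ^ (2 * i) ≤ 1 / (1 - r ^ 2) := by
      simp_rw [pow_mul]
      rw [le_div_iff₀ (by linarith), geom_sum_mul_neg]
      have : 0 ≤ (r ^ 2) ^ (k + 1) := by positivity
      linarith
    refine h3.trans (le_of_eq ?_)
    have : 1 - r ^ 2 ≠ 0 := by linarith
    field_simp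

end

end modG7

section modG8
section
open MeasureTheory MvPolynomial Set

theorem exp_wt (k : ℕ) (r : ℝ) (z : Fin (k + 1) → ℂ) :
    Real.exp (∑ i : Fin (k + 1), ρw r i * ‖z i‖ ^ 2) * wt z = Ew k r z := by
  unfold wt Ew
  rw [Real.exp_sum, ← Finset.prod_mul_distrib]
  refine Finset.prod_congr rfl fun i _ => ?_
  rw [← Real.exp_add]; congr 1; ring

theorem pw_z (c k N : ℕ) (r ε u : ℝ) (hr0 : 0 < r) (hu : 0 < u)
    (HD : ∀ v : ℕ → ℂ, v 0 = 0 → v 1 = 0 → (∀ l, k < l → v l = 0) →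
      Sv c k v ≤ (1 + ε) * ‖pp v (2 * N)‖ ^ 2 +
      (4 / 3 * r ^ 2 * (r ^ 2 + ∑ l ∈ Finset.range (k + 1), r ^ (2 * l) * ‖v l‖ ^ 2)) ^ N)
    (t : ℝ) (ht : t ^ 2 = u⁻¹) (z : Fin (k + 1) → ℂ) :
    ∑ c' ∈ Big c, Bc c k c' * (‖gev (pp (xs k) k ^ c') t z‖ ^ 2 * wt z) ≤
      (1 + ε) * (‖gev (pp (xs k) (2 * N)) t z‖ ^ 2 * wt z) +
      ((4 / 3 * r ^ 2) ^ N * (N.factorial : ℝ) * u⁻¹ ^ N * Real.exp (r ^ 2 * u)) * Ew k r z := by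
  have h := HD (vz k t z) (by simp [vz]) (by simp [vz]) (fun l hl => dif_neg (by omega))
  have hw : 0 ≤ wt z := Finset.prod_nonneg fun i _ => (Real.exp_pos _).le
  have h1 := mul_le_mul_of_nonneg_right h hw
  have e1 : Sv c k (vz k t z) * wt z = ∑ c' ∈ Big c, Bc c k c' * (‖gev (pp (xs k) k ^ c') t z‖ ^ 2 * wt z) := by
    unfold Sv
    rw [Finset.sum_mul]
    refine Finset.sum_congr rfl fun c' _ => ?_
    rw [gev_pow, gev_pp, norm_pow, ← pow_mul, mul_comm c' 2, mul_assoc]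
  rw [e1, add_mul, ← gev_pp, mul_assoc] at h1
  refine h1.trans (add_le_add le_rfl ?_)
  set S := ∑ l ∈ Finset.range (k + 1), r ^ (2 * l) * ‖vz k t z l‖ ^ 2 with hS
  have hvs := vz_sum k r u hu t ht z
  rw [← hS] at hvs
  have hS0 : 0 ≤ S := Finset.sum_nonneg fun l _ => by positivity
  have hX : r ^ 2 + S = u⁻¹ * (r ^ 2 * u + u * S) := by field_simp
  have hT : 0 ≤ r ^ 2 * u + u * S := by positivity
  have hp := Real.pow_div_factorial_le_exp _ hT N
  rw [div_le_iff₀ (by positivity), Real.exp_add] at hp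
  rw [hX, mul_pow, mul_pow u⁻¹, ← exp_wt, ← hvs]
  calc (4 / 3 * r ^ 2) ^ N * (u⁻¹ ^ N * (r ^ 2 * u + u * S) ^ N) * wt z
      ≤ (4 / 3 * r ^ 2) ^ N * (u⁻¹ ^ N * (Real.exp (r ^ 2 * u) * Real.exp (u * S) * (N.factorial : ℝ))) * wt z := by gcongr
    _ = _ := by ring

theorem pw_u (c k N : ℕ) (r ε u : ℝ) (hr0 : 0 < r) (hr1 : r < 1) (hu : 0 < u)
    (HD : ∀ v : ℕ → ℂ, v 0 = 0 → v 1 = 0 → (∀ l, k < l → v l = 0) →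
      Sv c k v ≤ (1 + ε) * ‖pp v (2 * N)‖ ^ 2 +
      (4 / 3 * r ^ 2 * (r ^ 2 + ∑ l ∈ Finset.range (k + 1), r ^ (2 * l) * ‖v l‖ ^ 2)) ^ N) :
    ∑ c' ∈ Big c, Bc c k c' * JJ (pp (xs k) k ^ c') u⁻¹ ≤
      (1 + ε) * JJ (pp (xs k) (2 * N)) u⁻¹ +
      ((4 / 3 * r ^ 2) ^ N * (N.factorial : ℝ) * u⁻¹ ^ N * Real.exp (r ^ 2 * u)) * Real.exp (1 / (1 - r ^ 2) ^ 2) := by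
  have ht : ((Real.sqrt u)⁻¹) ^ 2 = u⁻¹ := by rw [inv_pow, Real.sq_sqrt hu.le]
  set t := (Real.sqrt u)⁻¹
  have hE := Ew_int k r hr0 hr1
  have i1 : ∀ c' ∈ Big c, Integrable (fun z : Fin (k + 1) → ℂ => Bc c k c' * (‖gev (pp (xs k) k ^ c') t z‖ ^ 2 * wt z)) :=
    fun c' _ => (gev_int _ t).const_mul _
  have i2 : Integrable (fun z : Fin (k + 1) → ℂ => (1 + ε) * (‖gev (pp (xs k) (2 * N)) t z‖ ^ 2 * wt z)) :=
    (gev_int _ t).const_mul _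
  set A := (4 / 3 * r ^ 2) ^ N * (N.factorial : ℝ) * u⁻¹ ^ N * Real.exp (r ^ 2 * u) with hA
  have hA0 : 0 ≤ A := by positivity
  have i3 : Integrable (fun z : Fin (k + 1) → ℂ => A * Ew k r z) := hE.1.const_mul _
  have h := integral_mono (integrable_finsetSum _ i1) (i2.add i3)
    (fun z => pw_z c k N r ε u hr0 hu HD t ht z)
  rw [integral_finsetSum _ i1, integral_add' i2 i3, integral_const_mul, integral_const_mul, gev_integral, ht] at h
  simp_rw [integral_const_mul, gev_integral, ht] at h
  have hpi : 0 < Real.pi ^ (k + 1) := pow_pos Real.pi_pos _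
  have h2 : A * ∫ z, Ew k r z ≤ A * (Real.pi ^ (k + 1) * Real.exp (1 / (1 - r ^ 2) ^ 2)) :=
    mul_le_mul_of_nonneg_left hE.2 hA0
  refine le_of_mul_le_mul_left ?_ hpi
  rw [Finset.mul_sum]
  calc _ = ∑ c' ∈ Big c, Bc c k c' * (Real.pi ^ (k + 1) * JJ (pp (xs k) k ^ c') u⁻¹) :=
        Finset.sum_congr rfl fun c' _ => by ring
    _ ≤ _ := h
    _ ≤ _ := add_le_add le_rfl h2
    _ = _ := by ring

theorem gint (a : ℝ) (ha : 0 < a) : IntegrableOn (fun u : ℝ => u ^ (-(1/2) : ℝ) * Real.exp (-(a * u))) (Ioi 0) := by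
  apply Integrable.of_integral_ne_zero
  have := Real.integral_rpow_mul_exp_neg_mul_Ioi (a := 1 / 2) (r := a) (by norm_num) ha
  rw [show (1 / 2 - 1 : ℝ) = -(1 / 2) by norm_num] at this
  rw [this]
  have := Real.Gamma_pos_of_pos (s := 1 / 2) (by norm_num)
  positivity

theorem deg_pow (c k N c' : ℕ) (hck : c * k = 2 * N) (hc : c' ≤ c) (m : Fin (k + 1) →₀ ℕ)
    (hm : m ∈ (pp (xs k) k ^ c').support) : m.degree ≤ N := by
  by_contra h
  have h1 := (coeff_le_dgm _ m).trans (dgm_pow k c' m.degree)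
  have h2 : c' * k ≤ c * k := Nat.mul_le_mul_right k hc
  rw [py_pow_zero_hi k c' _ (by omega)] at h1
  exact (mem_support_iff.1 hm) (by omega)

theorem big_int (r : ℝ) (hr0 : 0 < r) (hr1 : r < 1) : ∃ C : ℝ, ∀ c k N : ℕ, c * k = 2 * N → ∀ ε : ℝ,
    (∀ v : ℕ → ℂ, v 0 = 0 → v 1 = 0 → (∀ l, k < l → v l = 0) →
      Sv c k v ≤ (1 + ε) * ‖pp v (2 * N)‖ ^ 2 +
      (4 / 3 * r ^ 2 * (r ^ 2 + ∑ l ∈ Finset.range (k + 1), r ^ (2 * l) * ‖v l‖ ^ 2)) ^ N) →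
    ∑ c' ∈ Big c, Tc c k N c' ≤ (1 + ε) * QN N (pp (xs k) (2 * N)) + C * (r ^ 2) ^ N * Bs N := by
  have hr2 : r ^ 2 < 1 := pow_lt_one₀ hr0.le hr1 (by norm_num)
  have hg := gint (1 - r ^ 2) (by linarith)
  refine ⟨Real.exp (1 / (1 - r ^ 2) ^ 2) * (∫ u in Ioi (0:ℝ), u ^ (-(1/2) : ℝ) * Real.exp (-((1 - r ^ 2) * u))) / Real.sqrt Real.pi,
    fun c k N hck ε HD => ?_⟩
  set G := ∫ u in Ioi (0:ℝ), u ^ (-(1/2) : ℝ) * Real.exp (-((1 - r ^ 2) * u)) with hG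
  set E := Real.exp (1 / (1 - r ^ 2) ^ 2) with hE
  have q1 : ∀ c' ∈ Big c, _ := fun c' hc' => QN_int N (pp (xs k) k ^ c')
    (fun m hm => deg_pow c k N c' hck (by simp [Big] at hc'; omega) m hm)
  have q2 := QN_int N (pp (xs k) (2 * N)) (fun m hm => by have := deg_pp N m hm; omega)
  have i1 : ∀ c' ∈ Big c, Integrable (fun u => Bc c k c' * (uw N u * JJ (pp (xs k) k ^ c') u⁻¹)) (volume.restrict (Ioi 0)) :=
    fun c' hc' => (q1 c' hc').1.const_mul _
  have i2 : Integrable (fun u => (1 + ε) * (uw N u * JJ (pp (xs k) (2 * N)) u⁻¹)) (volume.restrict (Ioi 0)) :=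
    q2.1.const_mul _
  have i3 : Integrable (fun u : ℝ => ((4 / 3 * r ^ 2) ^ N * (N.factorial : ℝ) * E) *
      (u ^ (-(1/2) : ℝ) * Real.exp (-((1 - r ^ 2) * u)))) (volume.restrict (Ioi 0)) := hg.const_mul _
  have h := setIntegral_mono_on (integrable_finsetSum _ i1) (i2.add i3) measurableSet_Ioi (fun u hu => by
    have hu' : 0 < u := hu
    have h1 := pw_u c k N r ε u hr0 hr1 hu' HD
    have hw : 0 ≤ uw N u := by unfold uw; have := Real.rpow_nonneg hu'.le ((N:ℝ) - 1/2); positivity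
    have h2 := mul_le_mul_of_nonneg_left h1 hw
    rw [Finset.mul_sum] at h2
    have h3 : uw N u * (u⁻¹ ^ N * Real.exp (r ^ 2 * u)) = u ^ (-(1/2) : ℝ) * Real.exp (-((1 - r ^ 2) * u)) := by
      unfold uw
      rw [sub_eq_add_neg, Real.rpow_add hu', Real.rpow_natCast, show -((1 - r ^ 2) * u) = -u + r ^ 2 * u by ring, Real.exp_add, inv_pow]
      field_simp
    calc _ = _ := Finset.sum_congr rfl fun c' _ => by ring
      _ ≤ _ := h2
      _ = _ := by
        simp only [Pi.add_apply]
        rw [← h3, ← hE]; ring)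
  rw [integral_finsetSum _ i1, integral_add' i2 i3, integral_const_mul, integral_const_mul, ← hG] at h
  simp_rw [integral_const_mul] at h
  have hpi : 0 < Real.sqrt Real.pi := Real.sqrt_pos.2 Real.pi_pos
  have hm := mul_le_mul_of_nonneg_left h (show (0:ℝ) ≤ 2 ^ N / Real.sqrt Real.pi by positivity)
  calc ∑ c' ∈ Big c, Tc c k N c' = _ := by
        rw [Finset.mul_sum]
        refine Finset.sum_congr rfl fun c' hc' => ?_
        unfold Tc
        rw [(q1 c' hc').2]
        unfold Bc
        ring
    _ ≤ _ := hm
    _ = _ := by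
        rw [q2.2, Bs, mul_pow (4/3 : ℝ)]
        field_simp

theorem big_le (ε : ℝ) (hε : 0 < ε) : ∃ n0 : ℕ, ∀ N c k : ℕ, n0 ≤ N → 0 < N → c * k = 2 * N →
    4 * (N : ℝ) / Real.exp 1 ≤ (2 / Real.sqrt 3) ^ k →
    ∑ c' ∈ Big c, Tc c k N c' ≤ (1 + ε) * QN N (pp (xs k) (2 * N)) + ε * Bs N := by
  have hr0 : (0:ℝ) < 1 - 1 / 10 ^ 10 := by norm_num
  have hr1 : (1 - 1 / 10 ^ 10 : ℝ) < 1 := by norm_num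
  have hr : (1:ℝ) ≤ (1 + 1 / 10 ^ 7) * (1 - 1 / 10 ^ 10) ^ 160 := by
    have := one_add_mul_le_pow (a := (-(1 / 10 ^ 10) : ℝ)) (by norm_num) 160
    rw [← sub_eq_add_neg] at this
    have h2 : (1:ℝ) ≤ (1 + 1 / 10 ^ 7) * (1 + (160 : ℕ) * (-(1 / 10 ^ 10))) := by norm_num
    exact h2.trans (mul_le_mul_of_nonneg_left this (by norm_num))
  generalize (1 - 1 / 10 ^ 10 : ℝ) = r at hr0 hr1 hr
  obtain ⟨k0, hk0⟩ := det1 r hr0 hr1 hr ε hε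
  obtain ⟨C, hC⟩ := big_int r hr0 hr1
  obtain ⟨n1, hn1⟩ := k_large k0
  have hr2 : r ^ 2 < 1 := pow_lt_one₀ hr0.le hr1 (by norm_num)
  have hl : Filter.Tendsto (fun N : ℕ => C * (r ^ 2) ^ N) Filter.atTop (nhds 0) := by
    simpa using (tendsto_pow_atTop_nhds_zero_of_lt_one (by positivity) hr2).const_mul C
  obtain ⟨n2, hn2⟩ := Filter.eventually_atTop.1 (hl.eventually_le_const hε)
  refine ⟨max n1 n2, fun N c k hN hN0 hck hcond => ?_⟩
  have h1 := hC c k N hck ε (hk0 k (hn1 N k (le_trans (le_max_left _ _) hN) hcond) c N hck hN0 hcond)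
  refine h1.trans (add_le_add le_rfl ?_)
  exact mul_le_mul_of_nonneg_right (hn2 N (le_trans (le_max_right _ _) hN)) (Bs_pos N).le

end

end modG8

section
open MvPolynomial Filter

theorem Z_le_T (c k : ℕ) [NeZero k] (N : ℕ) (hN : c * k = 2 * N) :
    (Nat.card (Zset c k) : ℝ) ≤ ∑ c' ∈ Finset.range (c + 1), Tc c k N c' := by
  have h := Z_le_I (c := c) (k := k) N hN
  have h' : (Nat.card (Zset c k) : ℝ) ≤ ((∑ u ∈ Finset.range (c + 1),
      ∑ m ∈ (pp (xs k) k ^ (c - u)).support,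
        (c.choose u * MvPolynomial.coeff m (pp (xs k) k ^ (c - u))) ^ 2 * VV k N u m : ℕ) : ℝ) := by exact_mod_cast h
  refine h'.trans (le_of_eq ?_)
  rw [← Finset.sum_range_reflect, Nat.cast_sum]
  refine Finset.sum_congr rfl fun c' hc' => ?_
  have hc : c' ≤ c := by have := Finset.mem_range.1 hc'; omega
  have e1 : c + 1 - 1 - c' = c - c' := by omega
  have e2 : c - (c - c') = c' := by omega
  rw [e1, e2, Nat.choose_symm hc]
  unfold Tc QN VV
  rw [Nat.cast_sum, Finset.mul_sum]
  refine Finset.sum_congr rfl fun m _ => ?_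
  unfold pf
  push_cast
  ring

theorem ratio_final (ε : ℝ) (hε : 0 < ε) : ∃ n0 : ℕ, ∀ N c k : ℕ, n0 ≤ N → c * k = 2 * N →
    4 * (N : ℝ) / Real.exp 1 ≤ (2 / Real.sqrt 3) ^ k →
    EF2 (c * k) k / (EF (c * k) k) ^ 2 ≤ 3 + ε := by
  obtain ⟨δ, hδ0, hδ1, hδ2⟩ : ∃ δ : ℝ, 0 < δ ∧ δ ≤ 1 / 2 ∧ δ ≤ ε / 20 :=
    ⟨min (1/2) (ε / 20), lt_min (by norm_num) (by positivity), min_le_left _ _, min_le_right _ _⟩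
  obtain ⟨n1, hn1⟩ := big_le δ hδ0
  obtain ⟨n2, hn2⟩ := eventually_atTop.1 (WN_le δ hδ0)
  obtain ⟨n3, hn3⟩ := eventually_atTop.1 (Nm_lim δ hδ0)
  set A : ℝ := 9 / 7 * Real.exp (10 / 9 * Real.exp 1) with hA
  have hA0 : 0 < A := by positivity
  obtain ⟨K, hK⟩ := exists_nat_gt ((8 * A / δ) ^ 2)
  obtain ⟨n4, hn4⟩ := k_large (max K 2)
  refine ⟨n1 + n2 + n3 + n4 + 1, fun N c k hN hck hcond => ?_⟩
  have hkK := hn4 N k (by omega) hcond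
  have hk2 : 2 ≤ k := le_trans (le_max_right _ _) hkK
  have hkK' : (K : ℝ) ≤ k := by exact_mod_cast le_trans (le_max_left _ _) hkK
  haveI : NeZero k := ⟨by omega⟩
  have hB := Bs_pos N
  have hN0 : 0 < N := by omega
  have hb := hn1 N c k (by omega) hN0 hck hcond
  have hw := hn2 N (by omega)
  have hnm := hn3 N (by omega)
  have hq : QN N (pp (xs k) (2 * N)) ≤ (6 + δ) * Bs N := by
    refine (H_le k N).trans ?_
    unfold Bs
    have := mul_le_mul_of_nonneg_left hw (show (0:ℝ) ≤ 2 ^ N * (N.factorial : ℝ) by positivity)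
    linarith
  have hs := Tc_small_sum N k c hN0 hck
  rw [← hA] at hs
  have ht0 := mul_le_mul_of_nonneg_right (T0_le N c k hN0 hck hcond) hA0.le
  have hsk : 8 * A / δ ≤ Real.sqrt k := Real.le_sqrt_of_sq_le (by linarith)
  have hsk0 : 0 < Real.sqrt k := lt_of_lt_of_le (by positivity) hsk
  have h8 : 8 / Real.sqrt k * A ≤ δ := by
    rw [div_le_iff₀ hδ0] at hsk
    rw [div_mul_eq_mul_div, div_le_iff₀ hsk0]; linarith
  have h8' : 8 / Real.sqrt k * Bs N * A ≤ δ * Bs N := by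
    have := mul_le_mul_of_nonneg_right h8 hB.le
    linarith
  have hI : (Nat.card (Zset c k) : ℝ) ≤ (δ + (1 + δ) * (6 + δ) + δ) * Bs N := by
    refine (Z_le_T c k N hck).trans ?_
    rw [← Finset.sum_filter_add_sum_filter_not _ (fun c' => 10 * c' ≤ c)]
    have hb' : ∑ c' ∈ (Finset.range (c + 1)).filter (fun c' => ¬ 10 * c' ≤ c), Tc c k N c' ≤
      (1 + δ) * QN N (pp (xs k) (2 * N)) + δ * Bs N := hb
    have := mul_le_mul_of_nonneg_left hq (show 0 ≤ 1 + δ by linarith)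
    linarith
  have hdf : 0 < (df (3 * N) : ℝ) := by exact_mod_cast df_pos _
  have hdf' : 0 < (df N : ℝ) := by exact_mod_cast df_pos _
  have hNm0 : 0 < Nm N := lt_of_lt_of_le (mul_pos (by linarith) hB) hnm
  refine (ratio_le c k hk2 N hck).trans ?_
  have heq : (df (3 * N) : ℝ) * Nat.card (Zset c k) / ((c * k).factorial * 6 ^ (c * k) * (df N : ℝ) ^ 2) =
      Nat.card (Zset c k) / Nm N := by
    rw [hck, Nm]
    field_simp
  rw [heq, div_le_iff₀ hNm0]
  refine hI.trans (le_trans ?_ (mul_le_mul_of_nonneg_left hnm (by linarith)))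
  rw [← mul_assoc]
  refine mul_le_mul_of_nonneg_right ?_ hB.le
  nlinarith

theorem K0_cond (N k : ℕ) (hN : 0 < N) (h : K0 (2 * N) ≤ k) :
    4 * (N : ℝ) / Real.exp 1 ≤ (2 / Real.sqrt 3) ^ k := by
  unfold K0 at h
  have h3 : Real.logb 2 (2 / Real.sqrt 3) = 1 - Real.logb 2 3 / 2 := by
    rw [Real.logb_div (by norm_num) (by positivity), Real.logb_self_eq_one (by norm_num), Real.sqrt_eq_rpow,
      Real.logb_rpow_eq_mul_logb_of_pos (by norm_num)]
    ring
  have hs : Real.sqrt 3 < 2 := by rw [Real.sqrt_lt' (by norm_num)]; norm_num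
  have h1 : 1 < 2 / Real.sqrt 3 := by rw [one_lt_div (by positivity)]; exact hs
  have hpos : 0 < 1 - Real.logb 2 3 / 2 := by rw [← h3]; exact Real.logb_pos (by norm_num) h1
  rw [div_le_iff₀ hpos, ← h3, ← Real.logb_pow, Real.logb_le_logb (by norm_num) (by positivity) (by positivity)] at h
  refine le_trans (le_of_eq ?_) h
  push_cast
  ring

end

/-- With `n → ∞` through even integers and `k(n) ∣ n` with `k(n) ≥ K₀(n)`:
`limsup E[F_{k(n)}²]/(E[F_{k(n)}])² ≤ 3`, i.e. for every `ε > 0`, eventually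
`E[F_{k(n)}²]/(E[F_{k(n)}])² ≤ 3 + ε`. -/
theorem stmt17 (N k : ℕ → ℕ) (hNeven : ∀ i, Even (N i)) (hNpos : ∀ i, 0 < N i)
    (hN : Filter.Tendsto N Filter.atTop Filter.atTop)
    (hdvd : ∀ i, k i ∣ N i) (hK : ∀ i, K0 (N i) ≤ (k i : ℝ)) :
    ∀ ε : ℝ, 0 < ε → ∀ᶠ i in Filter.atTop,
      EF2 (N i) (k i) / (EF (N i) (k i)) ^ 2 ≤ 3 + ε := by
  intro ε hε
  obtain ⟨n0, hn0⟩ := ratio_final ε hε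
  filter_upwards [hN.eventually_ge_atTop (2 * n0)] with i hi
  obtain ⟨M, hM⟩ := hNeven i
  obtain ⟨c, hc⟩ := hdvd i
  have hM2 : N i = 2 * M := by omega
  have hp := hNpos i
  have hk := hK i
  rw [hM2] at hk
  have h := hn0 M c (k i) (by omega) (by rw [mul_comm, ← hc, hM2]) (K0_cond M (k i) (by omega) hk)
  rw [mul_comm c, ← hc] at h
  exact h
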